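/- Let d_1 ≥ … ≥ d_r be positive integers with largest value k, grouped as in the context, and for 1 ≤ h ≤ t set s̃(𝐤_h) = max{v_0(𝐤_h), (k/2)(1+ϖ_h)}. Suppose s ≥ 2·Σ_{h=1}^{t} (μ_h − μ_{h+1}) s̃(𝐤_h) + 1. Then for every highly non-singular system Σ_{j=1}^s c_{ij} x_j^{d_i} = 0 (1 ≤ i ≤ r) with nonzero integer coefficients which possesses a non-singular real solution with all coordinates positive and, for every prime p, a non-singular solution in ℚ_p^s, there exists a constant C > 0 such that the number N(P) of integer solutions x with 1 ≤ x_j ≤ P (1 ≤ j ≤ s) satisfies N(P) = (C + o(1)) P^{s − K} as P → ∞. -/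

import Mathlib

open MeasureTheory Filter Finset
open scoped Classical

noncomputable section

/-- `e(θ) = exp(2πiθ)`. -/
def eC (θ : ℝ) : ℂ := Complex.exp (2 * Real.pi * Complex.I * θ)

/-- Index pairs `(l, n)` for the distinct exponents `k_{l,n}`. -/
abbrev KIdx (t : ℕ) (ν : Fin t → ℕ) := Σ l : Fin t, Fin (ν l)

/-- Equation indices `(l, n, m)`: the `μ_l` equations of exponent `k_{l,n}`
(the interval `𝓘_{l,n}`). -/
abbrev EqIdx (t : ℕ) (ν μ : Fin t → ℕ) := Σ l : Fin t, Fin (ν l) × Fin (μ l)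

variable (t : ℕ) (ν μ : Fin t → ℕ) (k : (l : Fin t) → Fin (ν l) → ℕ)

/-- The degree `d_i` of equation `i`. -/
def deg (i : EqIdx t ν μ) : ℕ := k i.1 i.2.1

/-- `μ_h` for `1 ≤ h ≤ t` (`1`-based), with the convention `μ_{t+1} = 0`. -/
def mu1 (h : ℕ) : ℕ := if hh : 1 ≤ h ∧ h ≤ t then μ ⟨h - 1, by omega⟩ else 0

/-- `ϖ_h = ν(1) + ⋯ + ν(h)`. -/
def varpi (h : ℕ) : ℕ := ∑ l : Fin t, if (l : ℕ) < h then ν l else 0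

/-- `K_1 + ⋯ + K_h`. -/
def Ksum (h : ℕ) : ℕ := ∑ p : KIdx t ν, if (p.1 : ℕ) < h then k p.1 p.2 else 0

/-- The largest degree `k`. -/
def kmax : ℕ := Finset.univ.sup fun p : KIdx t ν => k p.1 p.2

/-- The total degree `K = d_1 + ⋯ + d_r`. -/
def Ktot : ℕ := ∑ i : EqIdx t ν μ, deg t ν μ k i

/-- The grouping hypotheses: `t ≥ 1`, all `ν l ≥ 1`, the multiplicities are
positive and strictly decreasing `μ_1 > ⋯ > μ_t`, and the exponents `k_{l,n}`
are positive and pairwise distinct. -/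
def GroupedDegrees : Prop :=
  0 < t ∧ (∀ l, 0 < ν l) ∧ (∀ l, 0 < μ l) ∧ StrictAnti μ ∧
    (∀ l n, 0 < k l n) ∧ Function.Injective fun p : KIdx t ν => k p.1 p.2

/-- `ℤ ∩ [1, P]` as a finite set. -/
def completeFS (P : ℝ) : Finset ℕ := Finset.Icc 1 ⌊P⌋₊

/-- `𝒜(P,R)`: the `R`-smooth numbers up to `P`. -/
def smoothFS (P R : ℝ) : Finset ℕ :=
  (Finset.Icc 1 ⌊P⌋₊).filter fun n => ∀ p : ℕ, p.Prime → p ∣ n → (p : ℝ) ≤ R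

/-- The exponential sum `f_{𝐤_h}(γ; 𝒜) = Σ_{x ∈ 𝒜} e(Σ_{l ≤ h, n} γ_{l,n} x^{k_{l,n}})`. -/
def fA (A : Finset ℕ) (h : ℕ) (γ : KIdx t ν → ℝ) : ℂ :=
  ∑ x ∈ A, eC (∑ p : KIdx t ν, if (p.1 : ℕ) < h then γ p * (x : ℝ) ^ (k p.1 p.2) else 0)

/-- The mean value `J_{u,𝐤_h}(𝒜)` (the coordinates `γ_{l,n}` with `l > h` are
dummy variables over the probability box, so this agrees with the
`ϖ_h`-dimensional integral). -/
def JA (A : Finset ℕ) (u h : ℕ) : ℝ :=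
  ∫ γ in Set.univ.pi fun _ : KIdx t ν => Set.Ico (0 : ℝ) 1, ‖fA t ν k A h γ‖ ^ (2 * u)

variable (s : ℕ) (c : EqIdx t ν μ → Fin s → ℤ)

/-- The system `Σ_j c_{ij} x_j^{d_i} = 0` is highly non-singular: all coefficients
are nonzero and every `μ_l × μ_l` minor taken from the rows `𝓘_{l,n}` is nonzero. -/
def HighlyNonSingular : Prop :=
  (∀ i j, c i j ≠ 0) ∧
  ∀ (l : Fin t) (n : Fin (ν l)) (J : Fin (μ l) → Fin s), Function.Injective J →
    (Matrix.of fun m m' : Fin (μ l) => c ⟨l, (n, m)⟩ (J m')).det ≠ 0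

/-- `x` is a solution of the system, with coordinates in a commutative ring. -/
def IsSol {A : Type*} [CommRing A] (x : Fin s → A) : Prop :=
  ∀ i, ∑ j, (c i j : A) * x j ^ deg t ν μ k i = 0

/-- The Jacobian `(d_i c_{ij} x_j^{d_i - 1})` has full rank `r` at `x`. -/
def JacFullRank {A : Type*} [CommRing A] (x : Fin s → A) : Prop :=
  (Matrix.of fun (i : EqIdx t ν μ) (j : Fin s) =>
      (deg t ν μ k i : A) * (c i j : A) * x j ^ (deg t ν μ k i - 1)).rank
    = Fintype.card (EqIdx t ν μ)

/-- The generalized exponential sum `f_j(α; 𝒜) = Σ_{x ∈ 𝒜} e(Σ_{l,n} γ_{j,l,n} x^{k_{l,n}})`,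
where `γ_{j,l,n} = Σ_{i ∈ 𝓘_{l,n}} c_{ij} α_i`. -/
def fj (A : Finset ℕ) (α : EqIdx t ν μ → ℝ) (j : Fin s) : ℂ :=
  ∑ x ∈ A, eC (∑ i : EqIdx t ν μ, (c i j : ℝ) * α i * (x : ℝ) ^ deg t ν μ k i)

end

noncomputable section

/-- `v_0(𝐤_h)`: the least `v` such that for every `ε > 0` one has
`∫ |f_{𝐤_h}(γ; [1,P])|^{2v} dγ ≪_ε P^{2v - (K_1+⋯+K_h) + ε}` for all `P ≥ 1`. -/
def v0 (t : ℕ) (ν : Fin t → ℕ) (k : (l : Fin t) → Fin (ν l) → ℕ) (h : ℕ) : ℕ :=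
  sInf {v : ℕ | ∀ ε : ℝ, 0 < ε → ∃ C : ℝ, ∀ P : ℝ, 1 ≤ P →
    JA t ν k (completeFS P) v h ≤ C * P ^ ((2 * v : ℝ) - (Ksum t ν k h : ℝ) + ε)}

/-- The number of solutions `x ∈ [1,P]^s` of the system. -/
def Ncount (t : ℕ) (ν μ : Fin t → ℕ) (k : (l : Fin t) → Fin (ν l) → ℕ) (s : ℕ)
    (c : EqIdx t ν μ → Fin s → ℤ) (P : ℕ) : ℕ :=
  Nat.card {x : Fin s → ℕ // (∀ j, 1 ≤ x j ∧ x j ≤ P) ∧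
    IsSol t ν μ k s c fun j => (x j : ℤ)}

theorem eC_eq (θ : ℝ) : eC θ = Complex.exp ((2 * Real.pi * θ : ℝ) * Complex.I) := by
  unfold eC
  congr 1
  push_cast
  ring

theorem eC_add (a b : ℝ) : eC (a + b) = eC a * eC b := by
  unfold eC
  rw [← Complex.exp_add]
  congr 1
  push_cast
  ring

@[simp] theorem eC_zero : eC 0 = 1 := by simp [eC]

@[simp] theorem norm_eC (θ : ℝ) : ‖eC θ‖ = 1 := by
  rw [eC_eq, Complex.norm_exp_ofReal_mul_I]

theorem eC_intCast (n : ℤ) : eC n = 1 := by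
  unfold eC
  rw [Complex.exp_eq_one_iff]
  exact ⟨n, by push_cast; ring⟩

theorem eC_add_intCast (a : ℝ) (n : ℤ) : eC (a + n) = eC a := by
  rw [eC_add, eC_intCast, mul_one]

theorem eC_neg (a : ℝ) : eC (-a) = (starRingEnd ℂ) (eC a) := by
  rw [eC_eq, eC_eq, ← Complex.exp_conj]
  congr 1
  simp only [map_mul, Complex.conj_ofReal, Complex.conj_I]
  push_cast
  ring

theorem eC_sum {ι : Type*} (S : Finset ι) (g : ι → ℝ) :
    eC (∑ i ∈ S, g i) = ∏ i ∈ S, eC (g i) := by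
  induction S using Finset.induction_on with
  | empty => simp
  | insert a S ha ih => rw [Finset.sum_insert ha, Finset.prod_insert ha, eC_add, ih]

theorem eC_nat_mul (n : ℕ) (a : ℝ) : eC (n * a) = eC a ^ n := by
  induction n with
  | zero => simp
  | succ n ih => rw [pow_succ, ← ih, ← eC_add]; congr 1; push_cast; ring

@[fun_prop] theorem continuous_eC : Continuous eC := by
  unfold eC
  fun_prop

theorem norm_eC_sub_one_le (a : ℝ) : ‖eC a - 1‖ ≤ 2 * Real.pi * |a| := by
  rw [eC_eq, mul_comm]
  have h := Real.norm_exp_I_mul_ofReal_sub_one_le (x := 2 * Real.pi * a)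
  refine h.trans (le_of_eq ?_)
  rw [Real.norm_eq_abs, abs_mul, abs_of_pos Real.two_pi_pos]

theorem norm_eC_sub_le (a b : ℝ) : ‖eC a - eC b‖ ≤ 2 * Real.pi * |a - b| := by
  have : eC a - eC b = eC b * (eC (a - b) - 1) := by
    rw [mul_sub, ← eC_add]; simp
  rw [this, norm_mul, norm_eC, one_mul]
  exact norm_eC_sub_one_le _

/-- The distance of `e(a)` from `1` controls the distance of `a` from the integers. -/
theorem exists_int_abs_sub_le_norm_eC_sub_one (a : ℝ) :
    ∃ n : ℤ, 4 * |a - n| ≤ ‖eC a - 1‖ := by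
  refine ⟨round a, ?_⟩
  set b := a - round a with hb
  have h1 : eC a = eC b := by
    have := eC_add_intCast b (round a)
    rw [← this]; congr 1; simp [hb]
  have hb2 : |b| ≤ 1 / 2 := abs_sub_round a
  rw [h1, eC_eq, mul_comm (_ : ℂ) Complex.I, Complex.norm_exp_I_mul_ofReal_sub_one]
  have h2 : 2 * Real.pi * b / 2 = Real.pi * b := by ring
  rw [h2, norm_mul, Real.norm_eq_abs, Real.norm_eq_abs]
  have h3 : |Real.sin (Real.pi * b)| = Real.sin (Real.pi * |b|) := by
    rw [Real.abs_sin_eq_sin_abs_of_abs_le_pi]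
    · rw [abs_mul, abs_of_pos Real.pi_pos]
    · rw [abs_mul, abs_of_pos Real.pi_pos]
      nlinarith [Real.pi_pos]
  have h4 := Real.mul_le_sin (x := Real.pi * |b|) (by positivity) (by nlinarith [Real.pi_pos])
  rw [h3]
  have h5 : 2 / Real.pi * (Real.pi * |b|) = 2 * |b| := by
    field_simp
  rw [h5] at h4
  simp only [abs_two]
  linarith

theorem integral_eC_int_mul (n : ℤ) (a : ℝ) :
    ∫ x in Set.Ico a (a + 1), eC (x * n) = if n = 0 then 1 else 0 := by
  rw [integral_Ico_eq_integral_Ioc, ← intervalIntegral.integral_of_le (by linarith)]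
  split_ifs with h
  · subst h; simp
  · have hc : (2 * Real.pi * Complex.I * n : ℂ) ≠ 0 := by
      simp [Real.pi_ne_zero, h]
    have h1 : ∀ x : ℝ, eC (x * n) = Complex.exp ((2 * Real.pi * Complex.I * n) * x) := by
      intro x
      unfold eC
      congr 1
      push_cast
      ring
    simp_rw [h1]
    rw [integral_exp_mul_complex hc]
    have : Complex.exp (2 * Real.pi * Complex.I * n * ((a + 1 : ℝ) : ℂ))
        = Complex.exp (2 * Real.pi * Complex.I * n * (a : ℂ)) := by
      rw [Complex.exp_eq_exp_iff_exists_int]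
      exact ⟨n, by push_cast; ring⟩
    rw [this, sub_self, zero_div]

section cube
variable {I : Type*} [Fintype I]

theorem volume_restrict_pi (S : I → Set ℝ) :
    (volume : Measure (I → ℝ)).restrict (Set.univ.pi S)
      = Measure.pi fun i => volume.restrict (S i) := by
  rw [volume_pi, Measure.restrict_pi_pi]

theorem integral_cube_eC (n : I → ℤ) (δ : I → ℝ) :
    ∫ x in Set.univ.pi fun i => Set.Ico (δ i) (δ i + 1), eC (∑ i, x i * n i)
      = if n = 0 then 1 else 0 := by
  rw [volume_restrict_pi]
  simp_rw [eC_sum]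
  rw [integral_fintype_prod_eq_prod (𝕜 := ℂ) (fun i (x : ℝ) => eC (x * n i))]
  simp_rw [integral_eC_int_mul]
  split_ifs with h
  · subst h; simp
  · obtain ⟨i, hi⟩ : ∃ i, n i ≠ 0 := by
      by_contra! h'; exact h (funext h')
    exact Finset.prod_eq_zero (Finset.mem_univ i) (by simp [hi])

theorem measurableSet_cube (δ δ' : I → ℝ) :
    MeasurableSet (Set.univ.pi fun i => Set.Ico (δ i) (δ' i)) :=
  MeasurableSet.univ_pi fun _ => measurableSet_Ico

theorem integrableOn_cube_of_bounded {E : Type*} [NormedAddCommGroup E] {δ : I → ℝ}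
    {g : (I → ℝ) → E} (hg : Continuous g) {S : Set (I → ℝ)}
    (hS : S ⊆ Set.univ.pi fun i => Set.Ico (δ i) (δ i + 1)) : IntegrableOn g S := by
  refine IntegrableOn.mono_set (t := Set.univ.pi fun i => Set.Icc (δ i) (δ i + 1)) ?_ ?_
  · exact hg.continuousOn.integrableOn_compact (isCompact_univ_pi fun _ => isCompact_Icc)
  · exact hS.trans (Set.pi_mono fun i _ => Set.Ico_subset_Icc_self)

/-- Orthogonality: the integral of an exponential sum counts the zeros of its frequencies. -/
theorem integral_cube_sum_eC {X : Type*} (S : Finset X) (Ψ : X → I → ℤ) (δ : I → ℝ) :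
    ∫ x in Set.univ.pi fun i => Set.Ico (δ i) (δ i + 1), ∑ z ∈ S, eC (∑ i, x i * Ψ z i)
      = (#{z ∈ S | Ψ z = 0} : ℂ) := by
  rw [integral_finsetSum]
  · simp_rw [integral_cube_eC]
    simp
  · intro z _
    exact integrableOn_cube_of_bounded (by fun_prop) subset_rfl

end cube

set_option maxHeartbeats 1000000 in
/-- If `‖hθ‖ ≤ ε` for a proportion `ρ` of the integers `h ≤ N`, where `ε` is small compared
to `ρ`, then `θ` has a good rational approximation with a small denominator. -/
theorem exists_approx_of_many_small_multiples {θ ρ ε : ℝ} {N : ℕ} {H : Finset ℕ}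
    (hH : H ⊆ Icc 1 N) (hρ : 0 < ρ) (hρ1 : ρ ≤ 1) (hcard : ρ * N ≤ #H)
    (hN : 16 / ρ ^ 2 ≤ N) (hε : ε ≤ ρ / 64) (hθ : ∀ h ∈ H, ∃ a : ℤ, |h * θ - a| ≤ ε) :
    ∃ q : ℕ, 1 ≤ q ∧ (q : ℝ) ≤ 4 / ρ ∧ ∃ a : ℤ, |q * θ - a| ≤ 16 * ε / (ρ ^ 2 * N) := by
  have hN' : 16 ≤ N * ρ ^ 2 := by rwa [div_le_iff₀ (by positivity)] at hN
  have hNpos : (0 : ℝ) < N := by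
    by_contra h
    nlinarith [sq_nonneg ρ]
  have hρN : 16 ≤ ρ * N := by nlinarith
  have h4ρ : 4 ≤ 4 / ρ := by rw [le_div_iff₀ hρ]; linarith
  set g := ⌊4 / ρ⌋₊ with hg
  have hgle : (g : ℝ) ≤ 4 / ρ := Nat.floor_le (by positivity)
  have hgge : 3 / ρ ≤ g := by
    have h1 := Nat.lt_floor_add_one (4 / ρ)
    have h2 : 4 / ρ = 3 / ρ + 1 / ρ := by ring
    have h3 : 1 ≤ 1 / ρ := by rw [le_div_iff₀ hρ]; linarith
    rw [← hg] at h1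
    linarith
  have hgpos : (0 : ℝ) < g := lt_of_lt_of_le (by positivity) hgge
  have hgpos' : 0 < g := by exact_mod_cast hgpos
  obtain ⟨q, hq1, hqg, a₀, ha₀⟩ : ∃ q : ℕ, 1 ≤ q ∧ q ≤ g ∧ ∃ a : ℤ, |q * θ - a| ≤ 2 * ε := by
    have hlt : #(range (N / g + 1)) < #H := by
      rw [card_range]
      have h1 : ((N / g : ℕ) : ℝ) ≤ ρ * N / 3 := by
        refine Nat.cast_div_le.trans ?_
        rw [div_le_iff₀ hgpos]
        have : 3 ≤ g * ρ := by rwa [div_le_iff₀ hρ] at hgge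
        nlinarith
      have h2 : ((N / g + 1 : ℕ) : ℝ) < (#H : ℝ) := by
        push_cast
        linarith
      exact_mod_cast h2
    obtain ⟨x, hx, y, hy, hxy, hfxy⟩ := Finset.exists_ne_map_eq_of_card_lt_of_maps_to hlt
      (f := fun h => h / g) (fun h hh => by
        have := (mem_Icc.1 (hH hh)).2
        exact mem_range.2 (Nat.lt_succ_of_le (Nat.div_le_div_right this)))
    have key : ∀ x ∈ H, ∀ y ∈ H, x < y → x / g = y / g →
        ∃ q : ℕ, 1 ≤ q ∧ q ≤ g ∧ ∃ a : ℤ, |q * θ - a| ≤ 2 * ε := by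
      intro x hx y hy hlt heq
      obtain ⟨a, ha⟩ := hθ x hx
      obtain ⟨b, hb⟩ := hθ y hy
      refine ⟨y - x, by omega, ?_, b - a, ?_⟩
      · have h1 := Nat.div_add_mod x g
        have h2 := Nat.div_add_mod y g
        have h3 := Nat.mod_lt y hgpos'
        rw [heq] at h1
        omega
      · rw [Nat.cast_sub hlt.le]
        push_cast
        rw [abs_le] at *
        constructor <;> linarith [ha.1, ha.2, hb.1, hb.2]
    rcases lt_or_gt_of_ne hxy with h | h
    · exact key x hx y hy h hfxy
    · exact key y hy x hx h hfxy.symm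
  have hqρ : (q : ℝ) ≤ 4 / ρ := le_trans (by exact_mod_cast hqg) hgle
  have hε0 : 0 ≤ ε := by
    have := abs_nonneg ((q : ℝ) * θ - a₀)
    linarith
  refine ⟨q, hq1, hqρ, a₀, ?_⟩
  have hqpos : (0 : ℝ) < q := by exact_mod_cast hq1
  set β := (q : ℝ) * θ - a₀ with hβ
  rcases eq_or_ne β 0 with h0 | h0
  · rw [h0, abs_zero]; positivity
  set b := |β| with hb
  have hbpos : 0 < b := abs_pos.2 h0
  set m₁ := ⌊1 / (2 * b)⌋₊ with hm₁
  have hm₁le : (m₁ : ℝ) ≤ 1 / (2 * b) := Nat.floor_le (by positivity)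
  have hm₁ge : 1 / (4 * b) ≤ m₁ := by
    have h1 := Nat.lt_floor_add_one (1 / (2 * b))
    rw [← hm₁] at h1
    have h2 : 1 / (2 * b) = 1 / (4 * b) + 1 / (4 * b) := by field_simp; norm_num
    have h3 : 1 ≤ 1 / (4 * b) := by rw [le_div_iff₀ (by positivity)]; linarith
    linarith
  have hm₁pos : (0 : ℝ) < m₁ := lt_of_lt_of_le (by positivity) hm₁ge
  have hm₁pos' : 0 < m₁ := by exact_mod_cast hm₁pos
  have hcardle : #H ≤ (⌊2 * ε / b⌋₊ + 1) * #(range q ×ˢ range (N / (q * m₁) + 1)) := by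
    refine Finset.card_le_mul_card_image_of_maps_to (f := fun h => (h % q, h / (q * m₁))) ?_ _ ?_
    · intro h hh
      have := (mem_Icc.1 (hH hh)).2
      exact mem_product.2 ⟨mem_range.2 (Nat.mod_lt _ hq1),
        mem_range.2 (Nat.lt_succ_of_le (Nat.div_le_div_right this))⟩
    · rintro ⟨u, v⟩ -
      set F := H.filter fun h => (h % q, h / (q * m₁)) = (u, v) with hF
      rcases F.eq_empty_or_nonempty with hFe | hFne
      · rw [hFe]; simp
      set h₀ := F.min' hFne
      have hh₀ : h₀ ∈ F := F.min'_mem hFne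
      have hmF : ∀ h ∈ F, h ∈ H ∧ h % q = u ∧ h / (q * m₁) = v := by
        intro h hh
        simpa [hF] using hh
      have hdiff : ∀ h ∈ F, ∃ m : ℕ, h = h₀ + q * m ∧ m ≤ ⌊2 * ε / b⌋₊ := by
        intro h hh
        obtain ⟨h1, h2, h3⟩ := hmF h hh
        obtain ⟨h1', h2', h3'⟩ := hmF h₀ hh₀
        have hle : h₀ ≤ h := F.min'_le h hh
        obtain ⟨m, hm⟩ : q ∣ h - h₀ := (Nat.modEq_iff_dvd' hle).1 (h2'.trans h2.symm)
        have hm' : h = h₀ + q * m := by omega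
        have hlt : h - h₀ < q * m₁ := by
          have e1 := Nat.div_add_mod h (q * m₁)
          have e2 := Nat.div_add_mod h₀ (q * m₁)
          have e3 := Nat.mod_lt h (Nat.mul_pos hq1 hm₁pos')
          rw [h3] at e1
          rw [h3'] at e2
          omega
        have hmlt : m < m₁ := by
          rw [hm] at hlt
          exact Nat.lt_of_mul_lt_mul_left hlt
        refine ⟨m, hm', Nat.le_floor ?_⟩
        obtain ⟨a, ha⟩ := hθ h h1
        obtain ⟨a', ha'⟩ := hθ h₀ h1'
        have hcast : (h : ℝ) = h₀ + q * m := by exact_mod_cast hm'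
        have hmβ : |m * β| ≤ 1 / 2 := by
          rw [abs_mul, Nat.abs_cast, ← hb]
          have : (m : ℝ) ≤ m₁ := by exact_mod_cast hmlt.le
          have h4 : (m : ℝ) ≤ 1 / (2 * b) := this.trans hm₁le
          rw [le_div_iff₀ (by positivity)] at h4
          linarith
        have hmβ' : |m * β - ((a - a' - m * a₀ : ℤ) : ℝ)| ≤ 2 * ε := by
          have : m * β - ((a - a' - m * a₀ : ℤ) : ℝ) = (h * θ - a) - (h₀ * θ - a') := by
            rw [hcast, hβ]; push_cast; ring
          rw [this]
          exact (abs_sub _ _).trans (by linarith)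
        have hzero : a - a' - m * a₀ = 0 := by
          rw [← Int.abs_lt_one_iff]
          have : |((a - a' - m * a₀ : ℤ) : ℝ)| < 1 := by
            rw [abs_le] at hmβ hmβ'
            rw [abs_lt]
            constructor <;> linarith [hmβ.1, hmβ.2, hmβ'.1, hmβ'.2]
          exact_mod_cast this
        rw [hzero] at hmβ'
        simp only [Int.cast_zero, sub_zero, abs_mul, Nat.abs_cast] at hmβ'
        rwa [le_div_iff₀ hbpos]
      calc #F ≤ #(range (⌊2 * ε / b⌋₊ + 1)) := by
            refine card_le_card_of_injOn (fun h => (h - h₀) / q) ?_ ?_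
            · intro h hh
              obtain ⟨m, hm, hmle⟩ := hdiff h hh
              simp only [coe_range, Set.mem_Iio]
              rw [hm, Nat.add_sub_cancel_left, Nat.mul_div_cancel_left _ hq1]
              omega
            · intro h hh h' hh' heq
              obtain ⟨m, hm, -⟩ := hdiff h hh
              obtain ⟨m', hm', -⟩ := hdiff h' hh'
              simp only at heq
              rw [hm, hm', Nat.add_sub_cancel_left, Nat.add_sub_cancel_left,
                Nat.mul_div_cancel_left _ hq1, Nat.mul_div_cancel_left _ hq1] at heq
              rw [hm, hm', heq]
        _ = _ := card_range _
  have hreal : (#H : ℝ) ≤ (2 * ε / b + 1) * (4 * b * N + q) := by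
    have h1 : (#H : ℝ) ≤ (⌊2 * ε / b⌋₊ + 1) * (q * ((N / (q * m₁) : ℕ) + 1)) := by
      rw [card_product, card_range, card_range] at hcardle
      exact_mod_cast hcardle
    refine h1.trans ?_
    have h2 : (⌊2 * ε / b⌋₊ : ℝ) ≤ 2 * ε / b := Nat.floor_le (by positivity)
    have h3 : ((N / (q * m₁) : ℕ) : ℝ) ≤ N / (q * m₁) := by
      refine Nat.cast_div_le.trans ?_
      push_cast; exact le_rfl
    have h4 : (N : ℝ) / (q * m₁) * q ≤ 4 * b * N := by
      have : (N : ℝ) / (q * m₁) * q = N / m₁ := by field_simp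
      rw [this, div_le_iff₀ hm₁pos]
      have h5 : 1 ≤ m₁ * (4 * b) := by rwa [div_le_iff₀ (by positivity)] at hm₁ge
      nlinarith
    have h6 : (q : ℝ) * ((N / (q * m₁) : ℕ) + 1) ≤ 4 * b * N + q := by
      have := mul_le_mul_of_nonneg_right h3 hqpos.le
      linarith
    gcongr
  have hqρ' : (q : ℝ) * ρ ≤ 4 := by rwa [le_div_iff₀ hρ] at hqρ
  have hqN : (q : ℝ) ≤ ρ * N / 4 := by
    have : (q : ℝ) * ρ ≤ ρ * N / 4 * ρ := by nlinarith
    exact le_of_mul_le_mul_right this hρ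
  have hexp : (2 * ε / b + 1) * (4 * b * N + q) = 8 * N * ε + 4 * b * N + 2 * ε * q / b + q := by
    field_simp
    ring
  have hbN : 4 * b * N ≤ 8 * N * ε := by nlinarith
  have hNε : 16 * N * ε ≤ ρ * N / 4 := by nlinarith
  have hmain : ρ * N / 2 ≤ 2 * ε * q / b := by linarith
  rw [le_div_iff₀ hbpos] at hmain
  rw [le_div_iff₀ (by positivity)]
  have h1 := mul_le_mul_of_nonneg_left hmain (by positivity : 0 ≤ 2 * ρ)
  have h2 := mul_le_mul_of_nonneg_left hqρ' hε0
  linarith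

theorem eventually_le_natCast_rpow (C : ℝ) {δ : ℝ} (hδ : 0 < δ) :
    ∀ᶠ P : ℕ in atTop, C ≤ (P : ℝ) ^ δ :=
  ((tendsto_rpow_atTop hδ).comp tendsto_natCast_atTop_atTop).eventually_ge_atTop C

theorem const_mul_rpow_le {P C κ a b : ℝ} (hP : 1 ≤ P) (hC : C ≤ P ^ κ) (hab : a + κ ≤ b) :
    C * P ^ a ≤ P ^ b := by
  have hP0 : 0 < P := by linarith
  calc C * P ^ a ≤ P ^ κ * P ^ a := by gcongr
    _ = P ^ (κ + a) := (Real.rpow_add hP0 _ _).symm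
    _ ≤ P ^ b := Real.rpow_le_rpow_of_exponent_le hP (by linarith)

/-- The exponential sum over `1 ≤ x ≤ N` of a polynomial of degree `k`. -/
def weylSum (k N : ℕ) (α : ℕ → ℝ) : ℂ :=
  ∑ x ∈ Icc 1 N, eC (∑ i ∈ Icc 1 k, α i * (x : ℝ) ^ i)

/-- Large polynomial exponential sums of degree `k` have coefficients that are simultaneously
close to rationals with a small common denominator. -/
def WeylProp (k : ℕ) : Prop :=
  ∀ σ : ℝ, 0 < σ → ∃ δ : ℝ, 0 < δ ∧ ∀ᶠ P : ℕ in atTop, ∀ N ≤ P, ∀ α : ℕ → ℝ,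
    (P : ℝ) ^ (1 - δ) ≤ ‖weylSum k N α‖ →
      ∃ q : ℕ, 1 ≤ q ∧ (q : ℝ) ≤ (P : ℝ) ^ σ ∧
        ∀ i ∈ Icc 1 k, ∃ a : ℤ, |q * α i - a| ≤ (P : ℝ) ^ (σ - i)

theorem norm_sum_le_natCast {N : ℕ} {g : ℕ → ℂ} (hg : ∀ x, ‖g x‖ ≤ 1) :
    ‖∑ x ∈ Icc 1 N, g x‖ ≤ N := by
  refine (norm_sum_le _ _).trans ((Finset.sum_le_sum fun x _ => hg x).trans ?_)
  simp

theorem norm_weylSum_le (k N : ℕ) (α : ℕ → ℝ) : ‖weylSum k N α‖ ≤ N :=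
  norm_sum_le_natCast fun _ => (norm_eC _).le

theorem weylProp_one : WeylProp 1 := by
  intro σ hσ
  refine ⟨σ, hσ, ?_⟩
  filter_upwards [eventually_ge_atTop 1] with P hP N hN α hα
  have hP1 : (1 : ℝ) ≤ P := by exact_mod_cast hP
  have hP0 : (0 : ℝ) < P := by linarith
  refine ⟨1, le_rfl, by simpa using Real.one_le_rpow hP1 hσ.le, fun i hi => ?_⟩
  obtain rfl : i = 1 := by simp at hi; omega
  have hgeo : ∀ n : ℕ, (eC (α 1) - 1) * weylSum 1 n α = eC (α 1 * (n + 1)) - eC (α 1) := by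
    intro n
    induction n with
    | zero => simp [weylSum]
    | succ n ih =>
      have : weylSum 1 (n + 1) α = weylSum 1 n α + eC (α 1 * (n + 1)) := by
        unfold weylSum
        rw [Finset.sum_Icc_succ_top (by omega)]
        simp
      rw [this, mul_add, ih]
      push_cast
      have e : α 1 * ((n : ℝ) + 1 + 1) = α 1 + α 1 * (n + 1) := by ring
      rw [e, eC_add]
      ring
  obtain ⟨a, ha⟩ := exists_int_abs_sub_le_norm_eC_sub_one (α 1)
  refine ⟨a, ?_⟩
  have h1 : ‖eC (α 1) - 1‖ * ‖weylSum 1 N α‖ ≤ 2 := by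
    rw [← norm_mul, hgeo]
    refine (norm_sub_le _ _).trans ?_
    simp; norm_num
  have h2 : 4 * |α 1 - a| * (P : ℝ) ^ (1 - σ) ≤ 2 :=
    (mul_le_mul ha hα (by positivity) (norm_nonneg _)).trans h1
  have h3 : (P : ℝ) ^ (1 - σ) * (P : ℝ) ^ (σ - (1 : ℕ)) = 1 := by
    rw [← Real.rpow_add hP0]; simp
  have h4 : 0 < (P : ℝ) ^ (σ - (1 : ℕ)) := by positivity
  simp only [Nat.cast_one, one_mul] at *
  nlinarith [mul_le_mul_of_nonneg_right h2 h4.le]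

theorem norm_sq_sum_Icc_le (N : ℕ) {z : ℕ → ℂ} (hz : ∀ x, ‖z x‖ = 1) :
    ‖∑ x ∈ Icc 1 N, z x‖ ^ 2
      ≤ N + 2 * ∑ h ∈ Icc 1 N, ‖∑ y ∈ Icc 1 (N - h), z (y + h) * (starRingEnd ℂ) (z y)‖ := by
  have h1 : ∀ n : ℕ, ‖∑ x ∈ Icc 1 n, z x‖ ^ 2 = n + 2 * (∑ x ∈ Icc 1 n, ∑ y ∈ Icc 1 (x - 1),
      z x * (starRingEnd ℂ) (z y)).re := by
    intro n
    induction n with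
    | zero => simp
    | succ n ih =>
      rw [Finset.sum_Icc_succ_top (by omega), Finset.sum_Icc_succ_top (by omega),
        Nat.add_sub_cancel, Complex.add_re, ← Finset.mul_sum, ← map_sum,
        ← Complex.normSq_eq_norm_sq, Complex.normSq_add, Complex.normSq_eq_norm_sq, ih,
        Complex.normSq_eq_norm_sq, hz]
      have : ((∑ x ∈ Icc 1 n, z x) * (starRingEnd ℂ) (z (n + 1))).re
          = (z (n + 1) * (starRingEnd ℂ) (∑ x ∈ Icc 1 n, z x)).re := by
        simp only [Complex.mul_re, Complex.conj_re, Complex.conj_im]; ring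
      rw [this]
      push_cast
      ring
  have h2 : ∑ x ∈ Icc 1 N, ∑ y ∈ Icc 1 (x - 1), z x * (starRingEnd ℂ) (z y)
      = ∑ h ∈ Icc 1 N, ∑ y ∈ Icc 1 (N - h), z (y + h) * (starRingEnd ℂ) (z y) := by
    rw [Finset.sum_sigma', Finset.sum_sigma']
    refine Finset.sum_bij' (fun p _ => ⟨p.1 - p.2, p.2⟩) (fun p _ => ⟨p.2 + p.1, p.2⟩) ?_ ?_ ?_ ?_ ?_
    · rintro ⟨x, y⟩ h; simp only [mem_sigma, mem_Icc] at h ⊢; omega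
    · rintro ⟨x, y⟩ h; simp only [mem_sigma, mem_Icc] at h ⊢; omega
    · rintro ⟨x, y⟩ h
      simp only [mem_sigma, mem_Icc] at h
      simp only [Sigma.mk.injEq, heq_eq_eq, and_true]; omega
    · rintro ⟨x, y⟩ h
      simp only [mem_sigma, mem_Icc] at h
      simp only [Sigma.mk.injEq, heq_eq_eq, and_true]; omega
    · rintro ⟨x, y⟩ h
      simp only [mem_sigma, mem_Icc] at h
      have : y + (x - y) = x := by omega
      simp only [this]
  rw [h1, h2]
  have := (Complex.re_le_norm _).trans (norm_sum_le (Icc 1 N)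
    fun h => ∑ y ∈ Icc 1 (N - h), z (y + h) * (starRingEnd ℂ) (z y))
  linarith

/-- The coefficients of the difference polynomial `φ(y + h) - φ(y)`. -/
def diffCoeff (k : ℕ) (α : ℕ → ℝ) (h m : ℕ) : ℝ :=
  ∑ i ∈ Icc 1 (k + 1), if m < i then α i * (h : ℝ) ^ (i - m) * (i.choose m) else 0

theorem sum_sub_sum_eq_diffCoeff (k : ℕ) (α : ℕ → ℝ) (h : ℕ) (y : ℝ) :
    ∑ i ∈ Icc 1 (k + 1), α i * (y + h) ^ i - ∑ i ∈ Icc 1 (k + 1), α i * y ^ i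
      = diffCoeff k α h 0 + ∑ m ∈ Icc 1 k, diffCoeff k α h m * y ^ m := by
  have h1 : diffCoeff k α h 0 + ∑ m ∈ Icc 1 k, diffCoeff k α h m * y ^ m
      = ∑ m ∈ range (k + 1), diffCoeff k α h m * y ^ m := by
    rw [Finset.range_eq_Ico, Finset.sum_eq_sum_Ico_succ_bot (by omega)]
    simp [Finset.Ico_add_one_right_eq_Icc]
  rw [h1, ← Finset.sum_sub_distrib]
  simp only [diffCoeff, Finset.sum_mul]
  rw [Finset.sum_comm]
  refine Finset.sum_congr rfl fun i hi => ?_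
  simp only [mem_Icc] at hi
  have h2 : (y + h) ^ i - y ^ i = ∑ m ∈ range i, y ^ m * (h : ℝ) ^ (i - m) * (i.choose m) := by
    rw [add_pow, Finset.sum_range_succ]; simp
  have h3 : range i = (range (k + 1)).filter (· < i) := by
    ext m; simp; omega
  rw [← mul_sub, h2, h3, Finset.mul_sum, Finset.sum_filter]
  refine Finset.sum_congr rfl fun m _ => ?_
  split_ifs <;> ring

theorem diffCoeff_self (k : ℕ) (α : ℕ → ℝ) (h : ℕ) :
    diffCoeff k α h k = (k + 1) * h * α (k + 1) := by
  unfold diffCoeff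
  rw [Finset.sum_Icc_succ_top (by omega), Finset.sum_eq_zero]
  · simp; ring
  · intro i hi
    simp only [mem_Icc] at hi
    rw [if_neg (by omega)]

theorem norm_sq_weylSum_succ_le (k N : ℕ) (α : ℕ → ℝ) :
    ‖weylSum (k + 1) N α‖ ^ 2
      ≤ N + 2 * ∑ h ∈ Icc 1 N, ‖weylSum k (N - h) (diffCoeff k α h)‖ := by
  refine (norm_sq_sum_Icc_le N fun x => norm_eC _).trans (le_of_eq ?_)
  congr 2
  refine Finset.sum_congr rfl fun h _ => ?_
  have : ∀ y : ℕ, eC (∑ i ∈ Icc 1 (k + 1), α i * ((y + h : ℕ) : ℝ) ^ i)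
      * (starRingEnd ℂ) (eC (∑ i ∈ Icc 1 (k + 1), α i * (y : ℝ) ^ i))
      = eC (diffCoeff k α h 0) * eC (∑ m ∈ Icc 1 k, diffCoeff k α h m * (y : ℝ) ^ m) := by
    intro y
    rw [← eC_neg, ← eC_add, ← eC_add, ← sub_eq_add_neg, Nat.cast_add, sum_sub_sum_eq_diffCoeff]
  simp_rw [this]
  rw [← Finset.mul_sum, norm_mul, norm_eC, one_mul]
  rfl

theorem card_large_weylSum_ge {k N P : ℕ} {α : ℕ → ℝ} {δ : ℝ} (hP : 1 ≤ P) (hNP : N ≤ P)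
    (hδ1 : 3 * δ ≤ 1) (hbig : 5 ≤ (P : ℝ) ^ δ) (hα : (P : ℝ) ^ (1 - δ) ≤ ‖weylSum (k + 1) N α‖) :
    (P : ℝ) ^ (1 - 3 * δ) ≤
      #{h ∈ Icc 1 N | (P : ℝ) ^ (1 - 3 * δ) ≤ ‖weylSum k (N - h) (diffCoeff k α h)‖} := by
  have hP1 : (1 : ℝ) ≤ P := by exact_mod_cast hP
  have hP0 : (0 : ℝ) < P := by linarith
  set B := (P : ℝ) ^ (1 - 3 * δ) with hB
  set H := {h ∈ Icc 1 N | B ≤ ‖weylSum k (N - h) (diffCoeff k α h)‖} with hH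
  have hN : (N : ℝ) ≤ P := by exact_mod_cast hNP
  have hB1 : 1 ≤ B := Real.one_le_rpow hP1 (by linarith)
  have h1 : ∑ h ∈ Icc 1 N, ‖weylSum k (N - h) (diffCoeff k α h)‖ ≤ #H * P + N * B := by
    calc _ ≤ ∑ h ∈ Icc 1 N, ((if h ∈ H then (P : ℝ) else 0) + B) := by
          refine Finset.sum_le_sum fun h hh => ?_
          split_ifs with hm
          · refine (norm_weylSum_le _ _ _).trans ?_
            have : ((N - h : ℕ) : ℝ) ≤ P := by exact_mod_cast (Nat.sub_le _ _).trans hNP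
            linarith
          · simp only [hH, mem_filter, hh, true_and, not_le] at hm
            linarith
      _ = _ := by
          rw [Finset.sum_add_distrib, Finset.sum_ite_mem, Finset.sum_const, Finset.sum_const,
            Finset.inter_eq_right.2 (Finset.filter_subset _ _)]
          simp [hH]
  have h2 : (P : ℝ) * (B * P ^ δ) = ((P : ℝ) ^ (1 - δ)) ^ 2 := by
    rw [hB, ← Real.rpow_natCast, ← Real.rpow_mul hP0.le, ← Real.rpow_add hP0]
    nth_rewrite 1 [← Real.rpow_one (P : ℝ)]
    rw [← Real.rpow_add hP0]
    congr 1
    push_cast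
    ring
  have h3 : ((P : ℝ) ^ (1 - δ)) ^ 2 ≤ ‖weylSum (k + 1) N α‖ ^ 2 := by gcongr
  have h4 := norm_sq_weylSum_succ_le k N α
  have h5 : (P : ℝ) * (B * 5) ≤ P * (B * P ^ δ) := by gcongr
  have h6 : (P : ℝ) * B ≤ P * #H := by nlinarith
  exact le_of_mul_le_mul_left h6 hP0

theorem WeylProp.leading_coeff {k : ℕ} (hk : 1 ≤ k) (hW : WeylProp k) {σ : ℝ} (hσ : 0 < σ) :
    ∃ δ : ℝ, 0 < δ ∧ ∀ᶠ P : ℕ in atTop, ∀ N ≤ P, ∀ α : ℕ → ℝ,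
      (P : ℝ) ^ (1 - δ) ≤ ‖weylSum (k + 1) N α‖ →
        ∃ q : ℕ, 1 ≤ q ∧ (q : ℝ) ≤ (P : ℝ) ^ σ ∧
          ∃ a : ℤ, |q * α (k + 1) - a| ≤ (P : ℝ) ^ (σ - (k + 1 : ℕ)) := by
  obtain ⟨σ₁, hσ₁, hσ₁σ, hσ₁1⟩ : ∃ σ₁ : ℝ, 0 < σ₁ ∧ 20 * σ₁ ≤ σ ∧ 20 * σ₁ ≤ 1 :=
    ⟨min σ 1 / 20, by positivity, by linarith [min_le_left σ 1], by linarith [min_le_right σ 1]⟩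
  obtain ⟨δ₀, hδ₀, hev⟩ := hW σ₁ hσ₁
  obtain ⟨δ, hδ, hδδ₀, hδσ⟩ : ∃ δ : ℝ, 0 < δ ∧ 3 * δ ≤ δ₀ ∧ 3 * δ ≤ σ₁ :=
    ⟨min δ₀ σ₁ / 3, by positivity, by linarith [min_le_left δ₀ σ₁],
      by linarith [min_le_right δ₀ σ₁]⟩
  refine ⟨δ, hδ, ?_⟩
  filter_upwards [hev, eventually_ge_atTop 1, eventually_le_natCast_rpow 5 hδ,
    eventually_le_natCast_rpow 64 hσ₁, eventually_le_natCast_rpow (4 * (k + 1)) hσ₁]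
    with P hWP hP h5 h64 h4k N hNP α hα
  have hP1 : (1 : ℝ) ≤ P := by exact_mod_cast hP
  have hP0 : (0 : ℝ) < P := by linarith
  have hcard := card_large_weylSum_ge hP hNP (by linarith) h5 hα
  set H := {h ∈ Icc 1 N | (P : ℝ) ^ (1 - 3 * δ) ≤ ‖weylSum k (N - h) (diffCoeff k α h)‖} with hH
  have hq : ∀ h : ℕ, ∃ q : ℕ, h ∈ H → 1 ≤ q ∧ (q : ℝ) ≤ (P : ℝ) ^ σ₁ ∧
      ∃ a : ℤ, |h * (q * (k + 1) * α (k + 1)) - a| ≤ (P : ℝ) ^ (σ₁ - k) := by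
    intro h
    by_cases hh : h ∈ H
    · have hh' := (Finset.mem_filter.1 hh).2
      obtain ⟨q, h1, h2, h3⟩ := hWP (N - h) ((Nat.sub_le _ _).trans hNP) _
        ((Real.rpow_le_rpow_of_exponent_le hP1 (by linarith)).trans hh')
      obtain ⟨a, ha⟩ := h3 k (by simp; omega)
      refine ⟨q, fun _ => ⟨h1, h2, a, ?_⟩⟩
      rw [diffCoeff_self] at ha
      convert ha using 3
      ring
    · exact ⟨0, fun h' => absurd h' hh⟩
  choose q hq using hq
  set Q := ⌊(P : ℝ) ^ σ₁⌋₊ with hQ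
  have hQle : (Q : ℝ) ≤ (P : ℝ) ^ σ₁ := Nat.floor_le (by positivity)
  have hQ1 : 1 ≤ Q := Nat.le_floor (by simpa using Real.one_le_rpow hP1 hσ₁.le)
  have hmaps : ∀ h ∈ H, q h ∈ Icc 1 Q := fun h hh =>
    Finset.mem_Icc.2 ⟨(hq h hh).1, Nat.le_floor (hq h hh).2.1⟩
  obtain ⟨q₀, hq₀, hfib⟩ := Finset.exists_le_card_fiber_of_nsmul_le_card_of_maps_to (b := (#H : ℝ) / Q)
    hmaps ⟨1, by simpa using hQ1⟩ (by
      rw [nsmul_eq_mul, Nat.card_Icc, Nat.add_sub_cancel]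
      have : (Q : ℝ) ≠ 0 := by positivity
      exact (mul_div_cancel₀ _ this).le)
  set ρ : ℝ := (P : ℝ) ^ (-(3 * δ) - σ₁) with hρ
  have hρ0 : 0 < ρ := by positivity
  have hρinv : ∀ x : ℝ, x / ρ = x * (P : ℝ) ^ (3 * δ + σ₁) := fun x => by
    rw [hρ, div_eq_mul_inv, ← Real.rpow_neg hP0.le]; congr 2; ring
  have hρ2 : ∀ x : ℝ, x / ρ ^ 2 = x * (P : ℝ) ^ (2 * (3 * δ + σ₁)) := fun x => by
    rw [hρ, div_eq_mul_inv, ← Real.rpow_natCast, ← Real.rpow_mul hP0.le, ← Real.rpow_neg hP0.le]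
    congr 2; push_cast; ring
  obtain ⟨q₁, h1, h2, a, h3⟩ := exists_approx_of_many_small_multiples
    (θ := q₀ * (k + 1) * α (k + 1)) (ρ := ρ) (ε := (P : ℝ) ^ (σ₁ - k)) (N := P)
    (H := {h ∈ H | q h = q₀}) (fun h hh => by
      simp only [hH, mem_filter, mem_Icc] at hh ⊢; omega) hρ0
    (Real.rpow_le_one_of_one_le_of_nonpos hP1 (by linarith)) (by
      refine le_trans ?_ hfib
      rw [le_div_iff₀ (by positivity)]
      calc ρ * P * Q ≤ ρ * P * (P : ℝ) ^ σ₁ := by gcongr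
        _ = (P : ℝ) ^ (1 - 3 * δ) := by
            nth_rewrite 1 [← Real.rpow_one (P : ℝ)]
            rw [hρ, ← Real.rpow_add hP0, ← Real.rpow_add hP0]; congr 1; ring
        _ ≤ _ := hcard) (by
      rw [hρ2]
      simpa using const_mul_rpow_le (b := 1) hP1 (by linarith : (16 : ℝ) ≤ _)
        (by linarith : 2 * (3 * δ + σ₁) + σ₁ ≤ 1)) (by
      have hk1 : (1 : ℝ) ≤ k := by exact_mod_cast hk
      have := const_mul_rpow_le hP1 h64 (by linarith : (σ₁ - k) + σ₁ ≤ -(3 * δ) - σ₁)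
      linarith) (fun h hh => by
      obtain ⟨hh', rfl⟩ := Finset.mem_filter.1 hh
      exact (hq h hh').2.2)
  have hq₀1 : 1 ≤ q₀ := (Finset.mem_Icc.1 hq₀).1
  have hq₀2 : (q₀ : ℝ) ≤ (P : ℝ) ^ σ₁ :=
    le_trans (by exact_mod_cast (Finset.mem_Icc.1 hq₀).2) hQle
  refine ⟨q₁ * (q₀ * (k + 1)), Nat.mul_pos h1 (by positivity), ?_, a, ?_⟩
  · push_cast
    calc (q₁ : ℝ) * (q₀ * (k + 1)) ≤ 4 / ρ * ((P : ℝ) ^ σ₁ * (k + 1)) := by gcongr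
      _ = 4 * (k + 1) * ((P : ℝ) ^ (3 * δ + σ₁ + σ₁)) := by
          rw [hρinv, Real.rpow_add hP0 (3 * δ + σ₁)]; ring
      _ ≤ _ := const_mul_rpow_le hP1 h4k (by linarith)
  · push_cast
    have e : (q₁ : ℝ) * (q₀ * (k + 1)) * α (k + 1) - a = q₁ * (q₀ * (k + 1) * α (k + 1)) - a := by
      ring
    rw [e]
    refine h3.trans ?_
    calc 16 * (P : ℝ) ^ (σ₁ - k) / (ρ ^ 2 * P)
        = 16 * (P : ℝ) ^ (σ₁ - k) / ρ ^ 2 * (P : ℝ) ^ (-1 : ℝ) := by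
          rw [Real.rpow_neg_one, ← div_eq_mul_inv, div_div]
      _ = 16 * (P : ℝ) ^ (σ₁ - k + 2 * (3 * δ + σ₁) + -1) := by
          rw [hρ2, Real.rpow_add hP0, Real.rpow_add hP0 (σ₁ - k)]; ring
      _ ≤ _ := const_mul_rpow_le (κ := σ₁) hP1 (by linarith) (by linarith)

theorem eC_eq_one_iff (a : ℝ) : eC a = 1 ↔ ∃ n : ℤ, a = n := by
  constructor
  · intro h
    obtain ⟨n, hn⟩ := exists_int_abs_sub_le_norm_eC_sub_one a
    rw [h, sub_self, norm_zero] at hn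
    exact ⟨n, sub_eq_zero.1 (abs_eq_zero.1 (le_antisymm (by linarith) (abs_nonneg _)))⟩
  · rintro ⟨n, rfl⟩
    exact eC_intCast n

theorem sum_range_eC_div {q : ℕ} (hq : 0 < q) (n : ℤ) :
    ∑ u ∈ range q, eC (u * (n / q)) = if (q : ℤ) ∣ n then (q : ℂ) else 0 := by
  have hq' : (q : ℝ) ≠ 0 := by positivity
  simp_rw [eC_nat_mul]
  split_ifs with h
  · obtain ⟨m, rfl⟩ := h
    have : ((q * m : ℤ) : ℝ) / q = m := by push_cast; field_simp
    rw [this, eC_intCast]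
    simp
  · have hne : eC (n / q) ≠ 1 := by
      rw [Ne, eC_eq_one_iff]
      rintro ⟨m, hm⟩
      rw [div_eq_iff hq'] at hm
      exact h ⟨m, by rw [mul_comm]; exact_mod_cast hm⟩
    rw [geom_sum_eq hne, ← eC_nat_mul, mul_div_cancel₀ _ hq', eC_intCast, sub_self, zero_div]

theorem exists_norm_sum_mul_periodic_le {q : ℕ} (hq : 0 < q) (S : Finset ℕ) (g w : ℕ → ℂ)
    (hw : ∀ x, ‖w x‖ ≤ 1) (hper : ∀ x, w (x % q) = w x) :
    ∃ u : ℕ, ‖∑ x ∈ S, g x * w x‖ ≤ q * ‖∑ x ∈ S, g x * eC (u / q * x)‖ := by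
  have hq' : (q : ℂ) ≠ 0 := by exact_mod_cast hq.ne'
  obtain ⟨u, -, hu⟩ := Finset.exists_max_image (range q)
    (fun u => ‖∑ x ∈ S, g x * eC ((u : ℝ) / q * x)‖) ⟨0, by simpa using hq⟩
  refine ⟨u, ?_⟩
  have hexp : ∀ x, (q : ℂ) * w x = ∑ v ∈ range q, ∑ b ∈ range q,
      w b * eC (-(v / q * b)) * eC (v / q * x) := by
    intro x
    rw [Finset.sum_comm]
    have : ∀ b ∈ range q, ∑ v ∈ range q, w b * eC (-(v / q * b)) * eC ((v : ℝ) / q * x)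
        = if b = x % q then q * w x else 0 := by
      intro b hb
      have h1 : ∀ v : ℕ, w b * eC (-((v : ℝ) / q * b)) * eC ((v : ℝ) / q * x)
          = w b * eC (v * (((x - b : ℤ) : ℝ) / q)) := by
        intro v
        rw [mul_assoc, ← eC_add]
        congr 2
        push_cast
        ring
      simp_rw [h1]
      rw [← Finset.mul_sum, sum_range_eC_div hq]
      have hb' := Finset.mem_range.1 hb
      have h2 : (q : ℤ) ∣ (x - b : ℤ) ↔ b = x % q := by
        rw [← Int.modEq_iff_dvd, Int.natCast_modEq_iff, Nat.ModEq, Nat.mod_eq_of_lt hb']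
      simp only [h2]
      split_ifs with h
      · rw [h, hper, mul_comm]
      · simp
    rw [Finset.sum_congr rfl this, Finset.sum_ite_eq', if_pos (by simpa using Nat.mod_lt x hq)]
  have h3 : (q : ℂ) * ∑ x ∈ S, g x * w x = ∑ v ∈ range q, ∑ b ∈ range q,
      w b * eC (-(v / q * b)) * ∑ x ∈ S, g x * eC (v / q * x) := by
    rw [Finset.mul_sum]
    have h4 : ∀ x ∈ S, (q : ℂ) * (g x * w x) = ∑ v ∈ range q, ∑ b ∈ range q,
        w b * eC (-(v / q * b)) * (g x * eC (v / q * x)) := by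
      intro x _
      rw [mul_left_comm, hexp, Finset.mul_sum]
      refine Finset.sum_congr rfl fun v _ => ?_
      rw [Finset.mul_sum]
      exact Finset.sum_congr rfl fun b _ => by ring
    rw [Finset.sum_congr rfl h4, Finset.sum_comm]
    refine Finset.sum_congr rfl fun v _ => ?_
    rw [Finset.sum_comm]
    exact Finset.sum_congr rfl fun b _ => by rw [Finset.mul_sum]
  have h5 : (q : ℝ) * ‖∑ x ∈ S, g x * w x‖
      ≤ q * (q * ‖∑ x ∈ S, g x * eC ((u : ℝ) / q * x)‖) := by
    calc (q : ℝ) * ‖∑ x ∈ S, g x * w x‖ = ‖(q : ℂ) * ∑ x ∈ S, g x * w x‖ := by simp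
      _ ≤ ∑ v ∈ range q, ∑ b ∈ range q, ‖∑ x ∈ S, g x * eC ((u : ℝ) / q * x)‖ := by
          rw [h3]
          refine (norm_sum_le _ _).trans (Finset.sum_le_sum fun v hv => ?_)
          refine (norm_sum_le _ _).trans (Finset.sum_le_sum fun b _ => ?_)
          rw [norm_mul, norm_mul, norm_eC, mul_one]
          exact (mul_le_of_le_one_left (norm_nonneg _) (hw b)).trans (hu v hv)
      _ = _ := by simp
  exact le_of_mul_le_mul_left h5 (by exact_mod_cast hq)

theorem exists_norm_sum_mul_eC_pow_le (N m : ℕ) (β : ℝ) (g : ℕ → ℂ) :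
    ∃ N' ≤ N, ‖∑ x ∈ Icc 1 N, g x * eC (β * (x : ℝ) ^ m)‖
      ≤ (1 + 2 * Real.pi * |β| * (N : ℝ) ^ m) * ‖∑ x ∈ Icc 1 N', g x‖ := by
  obtain ⟨N', hN', hmax⟩ := Finset.exists_max_image (range (N + 1))
    (fun n => ‖∑ x ∈ Icc 1 n, g x‖) ⟨0, by simp⟩
  refine ⟨N', by simpa [Nat.lt_succ_iff] using hN', ?_⟩
  set M := ‖∑ x ∈ Icc 1 N', g x‖ with hM
  have key : ∀ n ≤ N, ‖∑ x ∈ Icc 1 n, g x * eC (β * (x : ℝ) ^ m)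
      - (∑ x ∈ Icc 1 n, g x) * eC (β * (n : ℝ) ^ m)‖ ≤ M * (2 * Real.pi * |β| * (n : ℝ) ^ m) := by
    intro n
    induction n with
    | zero => intro _; simp; positivity
    | succ n ih =>
      intro hn
      have e : ∑ x ∈ Icc 1 (n + 1), g x * eC (β * (x : ℝ) ^ m)
          - (∑ x ∈ Icc 1 (n + 1), g x) * eC (β * ((n + 1 : ℕ) : ℝ) ^ m)
          = (∑ x ∈ Icc 1 n, g x * eC (β * (x : ℝ) ^ m)
            - (∑ x ∈ Icc 1 n, g x) * eC (β * (n : ℝ) ^ m))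
            - (∑ x ∈ Icc 1 n, g x)
              * (eC (β * ((n + 1 : ℕ) : ℝ) ^ m) - eC (β * (n : ℝ) ^ m)) := by
        rw [Finset.sum_Icc_succ_top (by omega), Finset.sum_Icc_succ_top (by omega)]
        ring
      rw [e]
      refine (norm_sub_le _ _).trans ?_
      rw [norm_mul]
      have h1 := norm_eC_sub_le (β * ((n + 1 : ℕ) : ℝ) ^ m) (β * (n : ℝ) ^ m)
      have h2 : (n : ℝ) ^ m ≤ ((n + 1 : ℕ) : ℝ) ^ m := by gcongr; simp
      rw [← mul_sub, abs_mul, abs_of_nonneg (sub_nonneg.2 h2)] at h1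
      have h3 := mul_le_mul (hmax n (by simp; omega)) h1 (norm_nonneg _) (norm_nonneg _)
      have h4 := ih (by omega)
      calc _ ≤ M * (2 * Real.pi * |β| * (n : ℝ) ^ m)
            + M * (2 * Real.pi * (|β| * (((n + 1 : ℕ) : ℝ) ^ m - (n : ℝ) ^ m))) := add_le_add h4 h3
        _ = _ := by ring
  have h5 := key N le_rfl
  have h6 : ‖(∑ x ∈ Icc 1 N, g x) * eC (β * (N : ℝ) ^ m)‖ ≤ M := by
    rw [norm_mul, norm_eC, mul_one]; exact hmax N (by simp)
  calc _ ≤ _ := norm_le_norm_sub_add _ ((∑ x ∈ Icc 1 N, g x) * eC (β * (N : ℝ) ^ m))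
    _ ≤ M * (2 * Real.pi * |β| * (N : ℝ) ^ m) + M := add_le_add h5 h6
    _ = _ := by ring

theorem exists_norm_weylSum_succ_le {k : ℕ} (hk : 1 ≤ k) (N : ℕ) (α : ℕ → ℝ) {q : ℕ} (hq : 0 < q)
    (a : ℤ) : ∃ N' ≤ N, ∃ u : ℕ, ‖weylSum (k + 1) N α‖
      ≤ q * (1 + 2 * Real.pi * |α (k + 1) - a / q| * (N : ℝ) ^ (k + 1))
        * ‖weylSum k N' (Function.update α 1 (α 1 + u / q))‖ := by
  have hq' : (q : ℝ) ≠ 0 := by positivity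
  set β := α (k + 1) - a / q with hβ
  set g : ℕ → ℂ := fun x => eC (∑ i ∈ Icc 1 k, α i * (x : ℝ) ^ i) with hg
  obtain ⟨u, hu⟩ := exists_norm_sum_mul_periodic_le hq (Icc 1 N)
    (fun x => g x * eC (β * (x : ℝ) ^ (k + 1))) (fun x => eC (a / q * (x : ℝ) ^ (k + 1)))
    (fun x => (norm_eC _).le) (fun x => by
      have h1 : ((q : ℤ)) ∣ (x : ℤ) ^ (k + 1) - ((x % q : ℕ) : ℤ) ^ (k + 1) := by
        refine Int.ModEq.dvd (Int.ModEq.pow _ ?_)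
        push_cast
        exact Int.mod_modEq _ _
      obtain ⟨m, hm⟩ := h1
      have h2 : (a : ℝ) / q * (x : ℝ) ^ (k + 1)
          = a / q * ((x % q : ℕ) : ℝ) ^ (k + 1) + (a * m : ℤ) := by
        have : (x : ℝ) ^ (k + 1) - ((x % q : ℕ) : ℝ) ^ (k + 1) = q * m := by exact_mod_cast hm
        rw [eq_add_of_sub_eq this]
        push_cast
        field_simp
        ring
      rw [h2, eC_add_intCast])
  obtain ⟨N', hN', h⟩ := exists_norm_sum_mul_eC_pow_le N (k + 1) β
    (fun x => g x * eC ((u : ℝ) / q * x))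
  refine ⟨N', hN', u, ?_⟩
  have e1 : weylSum (k + 1) N α = ∑ x ∈ Icc 1 N,
      g x * eC (β * (x : ℝ) ^ (k + 1)) * eC (a / q * (x : ℝ) ^ (k + 1)) := by
    refine Finset.sum_congr rfl fun x _ => ?_
    rw [hg, ← eC_add, ← eC_add, Finset.sum_Icc_succ_top (by omega), hβ]
    congr 1
    ring
  have e2 : weylSum k N' (Function.update α 1 (α 1 + u / q))
      = ∑ x ∈ Icc 1 N', g x * eC ((u : ℝ) / q * x) := by
    refine Finset.sum_congr rfl fun x _ => ?_
    rw [hg, ← eC_add]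
    congr 1
    have h1k : 1 ∈ Icc 1 k := by simpa using hk
    rw [← Finset.add_sum_erase _ _ h1k, ← Finset.add_sum_erase _ _ h1k]
    have : ∀ i ∈ (Icc 1 k).erase 1, Function.update α 1 (α 1 + u / q) i * (x : ℝ) ^ i
        = α i * (x : ℝ) ^ i := fun i hi => by
      rw [Function.update_of_ne (Finset.mem_erase.1 hi).1]
    rw [Finset.sum_congr rfl this, Function.update_self]
    ring
  rw [e1, e2, mul_assoc]
  refine hu.trans ?_
  gcongr
  refine le_trans (le_of_eq ?_) h
  congr 1
  exact Finset.sum_congr rfl fun x _ => by ring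

theorem WeylProp.succ {k : ℕ} (hk : 1 ≤ k) (hW : WeylProp k) : WeylProp (k + 1) := by
  intro σ hσ
  obtain ⟨δ₀, hδ₀, hev⟩ := hW (σ / 2) (by positivity)
  obtain ⟨σ₂, hσ₂, hσ₂σ, hσ₂δ⟩ : ∃ σ₂ : ℝ, 0 < σ₂ ∧ 4 * σ₂ ≤ σ ∧ 4 * σ₂ ≤ δ₀ :=
    ⟨min σ δ₀ / 4, by positivity, by linarith [min_le_left σ δ₀], by linarith [min_le_right σ δ₀]⟩
  obtain ⟨δ₁, hδ₁, hlead⟩ := hW.leading_coeff hk hσ₂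
  refine ⟨min δ₁ σ₂, by positivity, ?_⟩
  filter_upwards [hev, hlead, eventually_ge_atTop 1, eventually_le_natCast_rpow 8 hσ₂]
    with P hWP hLP hP h8 N hNP α hα
  have hP1 : (1 : ℝ) ≤ P := by exact_mod_cast hP
  have hP0 : (0 : ℝ) < P := by linarith
  obtain ⟨q, hq1, hqσ, a, ha⟩ := hLP N hNP α
    ((Real.rpow_le_rpow_of_exponent_le hP1 (by linarith [min_le_left δ₁ σ₂])).trans hα)
  have hq0 : (0 : ℝ) < q := by exact_mod_cast hq1
  obtain ⟨N', hN', u, hu⟩ := exists_norm_weylSum_succ_le hk N α hq1 a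
  have hfac : (q : ℝ) * (1 + 2 * Real.pi * |α (k + 1) - a / q| * (N : ℝ) ^ (k + 1))
      ≤ 8 * (P : ℝ) ^ σ₂ := by
    have h1 : (q : ℝ) * |α (k + 1) - a / q| = |q * α (k + 1) - a| := by
      rw [← abs_of_pos hq0, ← abs_mul, abs_of_pos hq0]
      congr 1
      field_simp
    have h2 : (q : ℝ) * |α (k + 1) - a / q| * (N : ℝ) ^ (k + 1) ≤ (P : ℝ) ^ σ₂ := by
      rw [h1]
      calc _ ≤ (P : ℝ) ^ (σ₂ - (k + 1 : ℕ)) * (P : ℝ) ^ (k + 1) := by gcongr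
        _ = (P : ℝ) ^ σ₂ := by
          rw [← Real.rpow_natCast, ← Real.rpow_add hP0]; congr 1; ring
    have h3 := Real.pi_lt_d2
    have h4 : 0 ≤ (q : ℝ) * |α (k + 1) - a / q| * (N : ℝ) ^ (k + 1) := by positivity
    nlinarith [Real.pi_pos]
  have hα' : (P : ℝ) ^ (1 - δ₀) ≤ ‖weylSum k N' (Function.update α 1 (α 1 + u / q))‖ := by
    have h1 : 8 * (P : ℝ) ^ σ₂ * (P : ℝ) ^ (1 - δ₀) ≤ 8 * (P : ℝ) ^ σ₂
        * ‖weylSum k N' (Function.update α 1 (α 1 + u / q))‖ := by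
      calc 8 * (P : ℝ) ^ σ₂ * (P : ℝ) ^ (1 - δ₀) = 8 * (P : ℝ) ^ (σ₂ + (1 - δ₀)) := by
            rw [Real.rpow_add hP0]; ring
        _ ≤ (P : ℝ) ^ (1 - min δ₁ σ₂) :=
            const_mul_rpow_le hP1 h8 (by linarith [min_le_right δ₁ σ₂])
        _ ≤ _ := hα
        _ ≤ _ := hu
        _ ≤ _ := by gcongr
    exact le_of_mul_le_mul_left h1 (by positivity)
  obtain ⟨q', hq'1, hq'σ, hq'⟩ := hWP N' (hN'.trans hNP) _ hα'
  refine ⟨q * q', Nat.mul_pos hq1 hq'1, ?_, fun i hi => ?_⟩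
  · push_cast
    calc (q : ℝ) * q' ≤ (P : ℝ) ^ σ₂ * (P : ℝ) ^ (σ / 2) := by gcongr
      _ = (P : ℝ) ^ (σ₂ + σ / 2) := (Real.rpow_add hP0 _ _).symm
      _ ≤ _ := Real.rpow_le_rpow_of_exponent_le hP1 (by linarith)
  push_cast
  by_cases hik : i = k + 1
  · subst hik
    refine ⟨q' * a, ?_⟩
    have e : (q : ℝ) * q' * α (k + 1) - (q' * a : ℤ) = q' * (q * α (k + 1) - a) := by
      push_cast; ring
    rw [e, abs_mul, abs_of_nonneg (by positivity)]
    calc _ ≤ (P : ℝ) ^ (σ / 2) * (P : ℝ) ^ (σ₂ - (k + 1 : ℕ)) := by gcongr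
      _ = (P : ℝ) ^ (σ / 2 + (σ₂ - (k + 1 : ℕ))) := (Real.rpow_add hP0 _ _).symm
      _ ≤ _ := Real.rpow_le_rpow_of_exponent_le hP1 (by linarith)
  · have hik' : i ∈ Icc 1 k := by simp only [mem_Icc] at hi ⊢; omega
    obtain ⟨b, hb⟩ := hq' i hik'
    have hfin : (q : ℝ) * |q' * Function.update α 1 (α 1 + u / q) i - b|
        ≤ (P : ℝ) ^ (σ - i) := by
      calc _ ≤ (P : ℝ) ^ σ₂ * (P : ℝ) ^ (σ / 2 - i) := by gcongr
        _ = (P : ℝ) ^ (σ₂ + (σ / 2 - i)) := (Real.rpow_add hP0 _ _).symm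
        _ ≤ _ := Real.rpow_le_rpow_of_exponent_le hP1 (by linarith)
    obtain ⟨m, hm⟩ : ∃ m : ℤ, (q : ℝ) * q' * α i - m
        = q * (q' * Function.update α 1 (α 1 + u / q) i - b) := by
      by_cases hi1 : i = 1
      · subst hi1
        refine ⟨q * b - q' * u, ?_⟩
        rw [Function.update_self]
        push_cast
        field_simp
        ring
      · refine ⟨q * b, ?_⟩
        rw [Function.update_of_ne hi1]
        push_cast
        ring
    refine ⟨m, ?_⟩
    rwa [hm, abs_mul, abs_of_pos hq0]

theorem weylProp {k : ℕ} (hk : 1 ≤ k) : WeylProp k := by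
  induction k, hk using Nat.le_induction with
  | base => exact weylProp_one
  | succ k hk ih => exact ih.succ hk

section ExpSum

variable {I : Type*} [Fintype I] (d : I → ℕ)

/-- The phase polynomial `Σ γ_i x^{d_i}`. -/
def phase (γ : I → ℝ) (x : ℝ) : ℝ := ∑ i, γ i * x ^ d i

/-- The exponential sum `Σ_{1 ≤ x ≤ P} e(Σ γ_i x^{d_i})`. -/
def expSum (P : ℕ) (γ : I → ℝ) : ℂ := ∑ x ∈ Icc 1 P, eC (phase d γ x)

/-- The exponential sum normalised by its length. -/
def normSum (P : ℕ) (γ : I → ℝ) : ℂ := (P : ℂ)⁻¹ * expSum d P γ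

/-- The oscillatory integral `∫_0^1 e(Σ ξ_i u^{d_i}) du`. -/
def osc (ξ : I → ℝ) : ℂ := ∫ u in (0 : ℝ)..1, eC (phase d ξ u)

/-- The normalised complete exponential sum modulo `q`. -/
def smean (q : ℕ) (θ : I → ℝ) : ℂ := (q : ℂ)⁻¹ * ∑ x ∈ range q, eC (phase d θ x)

theorem sum_Icc_one_eq_sum_range {M : Type*} [AddCommMonoid M] (n : ℕ) (f : ℕ → M) :
    ∑ x ∈ Icc 1 n, f x = ∑ x ∈ range n, f (x + 1) := by
  induction n with
  | zero => simp
  | succ n ih => rw [Finset.sum_Icc_succ_top (by omega), Finset.sum_range_succ, ih]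

@[fun_prop] theorem continuous_phase (γ : I → ℝ) : Continuous (phase d γ) := by
  unfold phase; fun_prop

theorem continuous_expSum (P : ℕ) : Continuous (expSum d P) := by
  unfold expSum phase; fun_prop

theorem continuous_normSum (P : ℕ) : Continuous (normSum d P) := by
  unfold normSum
  exact continuous_const.mul (continuous_expSum d P)

theorem norm_normSum_le (P : ℕ) (γ : I → ℝ) : ‖normSum d P γ‖ ≤ 1 := by
  rw [normSum, norm_mul, norm_inv, Complex.norm_natCast]
  rcases Nat.eq_zero_or_pos P with rfl | hP
  · simp
  rw [inv_mul_le_iff₀ (by positivity), mul_one]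
  exact norm_sum_le_natCast fun x => (norm_eC _).le

theorem norm_smean_le (q : ℕ) (θ : I → ℝ) : ‖smean d q θ‖ ≤ 1 := by
  rw [smean, norm_mul, norm_inv, Complex.norm_natCast]
  rcases Nat.eq_zero_or_pos q with rfl | hq
  · simp
  rw [inv_mul_le_iff₀ (by positivity), mul_one]
  refine (norm_sum_le _ _).trans ?_
  simp

theorem norm_osc_le (ξ : I → ℝ) : ‖osc d ξ‖ ≤ 1 := by
  refine (intervalIntegral.norm_integral_le_of_norm_le_const (C := 1)
    fun u _ => (norm_eC _).le).trans ?_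
  simp

theorem continuous_osc : Continuous (osc d) := by
  unfold osc
  apply intervalIntegral.continuous_parametric_intervalIntegral_of_continuous'
  unfold phase
  fun_prop

theorem norm_sum_range_le_of_periodic {q : ℕ} (hq : 0 < q) {f : ℕ → ℂ} (hf : ∀ x, f (q + x) = f x)
    (h0 : ∑ x ∈ range q, f x = 0) {B : ℝ} (hB : ∀ x, ‖f x‖ ≤ B) (n : ℕ) :
    ‖∑ x ∈ range n, f x‖ ≤ q * B := by
  induction n using Nat.strong_induction_on with
  | _ n ih =>
    by_cases hn : n ≤ q
    · have hB0 : 0 ≤ B := (norm_nonneg _).trans (hB 0)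
      calc _ ≤ ∑ x ∈ range n, ‖f x‖ := norm_sum_le _ _
        _ ≤ ∑ x ∈ range n, B := Finset.sum_le_sum fun x _ => hB x
        _ = n * B := by simp
        _ ≤ _ := by gcongr
    · have e : n = q + (n - q) := by omega
      rw [e, Finset.sum_range_add, h0, zero_add]
      simp_rw [hf]
      exact ih _ (by omega)

theorem norm_sum_range_mul_le {N : ℕ} {f h : ℕ → ℂ} {M ε : ℝ}
    (hM : ∀ n, ‖∑ x ∈ range n, f x‖ ≤ M) (hh : ∀ x, ‖h x‖ ≤ 1)
    (hε : ∀ x < N, ‖h (x + 1) - h x‖ ≤ ε) :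
    ‖∑ x ∈ range N, f x * h x‖ ≤ M * (1 + N * ε) := by
  have hM0 : 0 ≤ M := (norm_nonneg _).trans (hM 0)
  have key : ∀ n ≤ N, ‖∑ x ∈ range n, f x * h x - (∑ x ∈ range n, f x) * h n‖ ≤ M * (n * ε) := by
    intro n
    induction n with
    | zero => intro _; simp
    | succ n ih =>
      intro hn
      have e : ∑ x ∈ range (n + 1), f x * h x - (∑ x ∈ range (n + 1), f x) * h (n + 1)
          = (∑ x ∈ range n, f x * h x - (∑ x ∈ range n, f x) * h n)
            - (∑ x ∈ range (n + 1), f x) * (h (n + 1) - h n) := by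
        simp only [Finset.sum_range_succ]; ring
      rw [e]
      refine (norm_sub_le _ _).trans ?_
      rw [norm_mul]
      have h1 := mul_le_mul (hM (n + 1)) (hε n (by omega)) (norm_nonneg _) hM0
      have h2 := ih (by omega)
      push_cast
      linarith
  have h1 : ‖(∑ x ∈ range N, f x) * h N‖ ≤ M := by
    rw [norm_mul]
    exact (mul_le_mul (hM N) (hh N) (norm_nonneg _) hM0).trans (mul_one M).le
  calc _ ≤ _ := norm_le_norm_sub_add _ ((∑ x ∈ range N, f x) * h N)
    _ ≤ M * (N * ε) + M := add_le_add (key N le_rfl) h1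
    _ = _ := by ring

theorem norm_eC_phase_sub_le (ξ : I → ℝ) {u v : ℝ} (hu : u ∈ Set.Icc (0 : ℝ) 1)
    (hv : v ∈ Set.Icc (0 : ℝ) 1) :
    ‖eC (phase d ξ u) - eC (phase d ξ v)‖ ≤ 2 * Real.pi * (∑ i, (d i : ℝ)) * (∑ i, |ξ i|) * |u - v| := by
  refine (norm_eC_sub_le _ _).trans ?_
  have h1 : |phase d ξ u - phase d ξ v| ≤ ∑ i, |ξ i| * ((∑ i, (d i : ℝ)) * |u - v|) := by
    unfold phase
    rw [← Finset.sum_sub_distrib]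
    refine (Finset.abs_sum_le_sum_abs _ _).trans (Finset.sum_le_sum fun i _ => ?_)
    rw [← mul_sub, abs_mul]
    gcongr
    refine (abs_pow_sub_pow_le _ _ _).trans ?_
    have h2 : max |u| |v| ≤ 1 := by
      rw [abs_of_nonneg hu.1, abs_of_nonneg hv.1]; exact max_le hu.2 hv.2
    have h3 : max |u| |v| ^ (d i - 1) ≤ 1 := pow_le_one₀ (by positivity) h2
    have h4 : (d i : ℝ) ≤ ∑ i, (d i : ℝ) :=
      Finset.single_le_sum (f := fun i => (d i : ℝ)) (fun _ _ => by positivity) (mem_univ i)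
    calc |u - v| * d i * max |u| |v| ^ (d i - 1) ≤ |u - v| * (∑ i, (d i : ℝ)) * 1 := by gcongr
      _ = _ := by ring
  rw [← Finset.sum_mul] at h1
  calc _ ≤ 2 * Real.pi * ((∑ i, |ξ i|) * ((∑ i, (d i : ℝ)) * |u - v|)) := by gcongr
    _ = _ := by ring

theorem norm_sum_sub_osc_le {P : ℕ} (hP : 0 < P) (ξ : I → ℝ) :
    ‖∑ x ∈ range P, eC (phase d ξ ((x + 1 : ℕ) / P)) - P * osc d ξ‖
      ≤ 2 * Real.pi * (∑ i, (d i : ℝ)) * (∑ i, |ξ i|) := by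
  set L := 2 * Real.pi * (∑ i, (d i : ℝ)) * (∑ i, |ξ i|) with hL
  have hP' : (P : ℝ) ≠ 0 := by positivity
  have h1 : (P : ℂ) * osc d ξ
      = ∑ x ∈ range P, ∫ t in (x : ℝ)..(x + 1 : ℕ), eC (phase d ξ (t / P)) := by
    rw [intervalIntegral.sum_integral_adjacent_intervals (a := fun n : ℕ => (n : ℝ))
      (fun k _ => Continuous.intervalIntegrable (by fun_prop) _ _)]
    rw [intervalIntegral.integral_comp_div (fun u => eC (phase d ξ u)) hP']
    simp [osc, hP', div_self]
  rw [h1, ← Finset.sum_sub_distrib]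
  have h2 : ∀ x ∈ range P, ‖eC (phase d ξ ((x + 1 : ℕ) / P))
      - ∫ t in (x : ℝ)..(x + 1 : ℕ), eC (phase d ξ (t / P))‖ ≤ L / P := by
    intro x hx
    have hx' : (x : ℝ) + 1 ≤ P := by exact_mod_cast Finset.mem_range.1 hx
    have e : eC (phase d ξ ((x + 1 : ℕ) / P))
        = ∫ t in (x : ℝ)..(x + 1 : ℕ), eC (phase d ξ ((x + 1 : ℕ) / P)) := by simp
    rw [e, ← intervalIntegral.integral_sub (by simp)
      (Continuous.intervalIntegrable (by fun_prop) _ _)]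
    refine (intervalIntegral.norm_integral_le_of_norm_le_const (C := L / P) fun t ht => ?_).trans
      (by simp)
    rw [Set.uIoc_of_le (by simp)] at ht
    have ht1 := ht.1
    have ht2 := ht.2
    push_cast at ht2 ⊢
    have hP0 : (0 : ℝ) < P := by positivity
    have hx0 : (0 : ℝ) ≤ x := by positivity
    refine (norm_eC_phase_sub_le d ξ (u := (x + 1) / P) (v := t / P)
      ⟨by positivity, by rw [div_le_one hP0]; linarith⟩
      ⟨div_nonneg (by linarith) hP0.le, by rw [div_le_one hP0]; linarith⟩).trans ?_
    rw [← sub_div, abs_div, abs_of_pos hP0, abs_of_nonneg (by linarith), mul_div_assoc']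
    have hL0 : 0 ≤ L := by positivity
    rw [← hL]
    gcongr
    exact mul_le_of_le_one_right hL0 (by linarith)
  refine (norm_sum_le _ _).trans ((Finset.sum_le_sum h2).trans (le_of_eq ?_))
  simp; field_simp

theorem eC_phase_add_of_int {q : ℕ} {θ : I → ℝ} (hθ : ∀ i, ∃ a : ℤ, q * θ i = a) (m x : ℕ) :
    eC (phase d θ ((q * m + x : ℕ) : ℝ)) = eC (phase d θ x) := by
  choose a ha using hθ
  have h : ∀ i, ∃ n : ℤ, θ i * ((q * m + x : ℕ) : ℝ) ^ d i = θ i * (x : ℝ) ^ d i + n := by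
    intro i
    have h1 : (q : ℤ) ∣ ((q * m + x : ℕ) : ℤ) ^ d i - (x : ℤ) ^ d i := by
      refine Int.ModEq.dvd (Int.ModEq.pow _ (Int.ModEq.symm ?_))
      push_cast
      simp [Int.ModEq]
    obtain ⟨n, hn⟩ := h1
    refine ⟨a i * n, ?_⟩
    have h2 : ((q * m + x : ℕ) : ℝ) ^ d i - (x : ℝ) ^ d i = q * n := by exact_mod_cast hn
    rw [eq_add_of_sub_eq h2]
    push_cast
    rw [← ha]
    ring
  choose n hn using h
  have : phase d θ ((q * m + x : ℕ) : ℝ) = phase d θ x + (∑ i, n i : ℤ) := by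
    unfold phase
    simp_rw [hn]
    rw [Finset.sum_add_distrib]
    push_cast
    rfl
  rw [this, eC_add_intCast]

theorem norm_normSum_sub_le {P q : ℕ} (hP : 0 < P) (hq : 0 < q) {θ : I → ℝ}
    (hθ : ∀ i, ∃ a : ℤ, q * θ i = a) (ξ : I → ℝ) :
    ‖normSum d P (fun i => θ i + ξ i / (P : ℝ) ^ d i) - smean d q θ * osc d ξ‖
      ≤ 3 * (1 + 2 * Real.pi * (∑ i, (d i : ℝ))) * (1 + ∑ i, |ξ i|) * q / P := by
  set L := 2 * Real.pi * (∑ i, (d i : ℝ)) * (∑ i, |ξ i|) with hL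
  have hL0 : 0 ≤ L := by positivity
  have hP0 : (0 : ℝ) < P := by positivity
  have hq1 : (1 : ℝ) ≤ q := by exact_mod_cast hq
  have hqC : (q : ℂ) ≠ 0 := by exact_mod_cast hq.ne'
  set f : ℕ → ℂ := fun x => eC (phase d θ ((x + 1 : ℕ) : ℝ)) - smean d q θ with hf
  set h : ℕ → ℂ := fun x => eC (phase d ξ (min ((x + 1 : ℕ) / P) 1)) with hh
  have hper : ∀ x : ℕ, eC (phase d θ ((q + x : ℕ) : ℝ)) = eC (phase d θ (x : ℝ)) := fun x => by
    simpa using eC_phase_add_of_int d hθ 1 x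
  have hfper : ∀ x, f (q + x) = f x := fun x => by
    simp only [hf, add_assoc, hper]
  have hf0 : ∑ x ∈ range q, f x = 0 := by
    have e : ∑ x ∈ range q, eC (phase d θ ((x + 1 : ℕ) : ℝ))
        = ∑ x ∈ range q, eC (phase d θ (x : ℝ)) := by
      have h1 := Finset.sum_range_succ' (fun x : ℕ => eC (phase d θ (x : ℝ))) q
      have h2 := Finset.sum_range_succ (fun x : ℕ => eC (phase d θ (x : ℝ))) q
      have h3 := hper 0
      rw [add_zero] at h3
      rw [h3] at h2
      exact add_right_cancel (h1.symm.trans h2)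
    simp only [hf]
    rw [Finset.sum_sub_distrib, e, smean]
    simp [hqC]
  have hfB : ∀ x, ‖f x‖ ≤ 2 := fun x => by
    refine (norm_sub_le _ _).trans ?_
    rw [norm_eC]
    linarith [norm_smean_le d q θ]
  have hA := norm_sum_range_mul_le (N := P) (h := h) (ε := L / P)
    (norm_sum_range_le_of_periodic hq hfper hf0 hfB) (fun x => (norm_eC _).le) (fun x hx => by
      have hx1 : ((x : ℝ) + 1) / P ≤ 1 := by
        rw [div_le_one hP0]; exact_mod_cast hx
      refine (norm_eC_phase_sub_le d ξ ⟨by positivity, min_le_right _ _⟩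
        ⟨by positivity, min_le_right _ _⟩).trans ?_
      rw [← hL, div_eq_mul_inv L]
      refine mul_le_mul_of_nonneg_left ?_ hL0
      push_cast
      rw [min_eq_left hx1, abs_of_nonneg]
      · have h1 : min (((x : ℝ) + 1 + 1) / P) 1 ≤ (x + 1 + 1) / P := min_le_left _ _
        have h2 : ((x : ℝ) + 1 + 1) / P = (x + 1) / P + (P : ℝ)⁻¹ := by field_simp
        linarith
      · refine sub_nonneg.2 (le_min ?_ hx1)
        gcongr
        linarith)
  rw [mul_div_cancel₀ _ hP0.ne'] at hA
  have hB := norm_sum_sub_osc_le d hP ξ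
  have hhx : ∀ x ∈ range P, h x = eC (phase d ξ ((x + 1 : ℕ) / P)) := fun x hx => by
    simp only [hh]
    rw [min_eq_left]
    rw [div_le_one hP0]; exact_mod_cast Finset.mem_range.1 hx
  have e1 : expSum d P (fun i => θ i + ξ i / (P : ℝ) ^ d i)
      = ∑ x ∈ range P, eC (phase d θ ((x + 1 : ℕ) : ℝ)) * h x := by
    rw [expSum, sum_Icc_one_eq_sum_range]
    refine Finset.sum_congr rfl fun x hx => ?_
    rw [hhx x hx, ← eC_add]
    congr 1
    unfold phase
    rw [← Finset.sum_add_distrib]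
    refine Finset.sum_congr rfl fun i _ => ?_
    rw [div_pow]
    ring
  have e2 : expSum d P (fun i => θ i + ξ i / (P : ℝ) ^ d i) - smean d q θ * (P * osc d ξ)
      = ∑ x ∈ range P, f x * h x + smean d q θ
        * (∑ x ∈ range P, eC (phase d ξ ((x + 1 : ℕ) / P)) - P * osc d ξ) := by
    rw [e1, ← Finset.sum_congr rfl hhx]
    simp only [hf, sub_mul, Finset.sum_sub_distrib, mul_sub, Finset.mul_sum]
    ring
  have e3 : normSum d P (fun i => θ i + ξ i / (P : ℝ) ^ d i) - smean d q θ * osc d ξ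
      = (P : ℂ)⁻¹ * (expSum d P (fun i => θ i + ξ i / (P : ℝ) ^ d i)
        - smean d q θ * (P * osc d ξ)) := by
    have : (P : ℂ) ≠ 0 := by exact_mod_cast hP.ne'
    rw [normSum]
    field_simp
  rw [e3, norm_mul, norm_inv, Complex.norm_natCast, div_eq_inv_mul]
  gcongr
  rw [e2]
  have hC : ‖smean d q θ * (∑ x ∈ range P, eC (phase d ξ ((x + 1 : ℕ) / P)) - P * osc d ξ)‖
      ≤ L := by
    rw [norm_mul]
    calc _ ≤ 1 * L := mul_le_mul (norm_smean_le d q θ) hB (norm_nonneg _) zero_le_one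
      _ = L := one_mul L
  refine (norm_add_le _ _).trans ((add_le_add hA hC).trans ?_)
  have hS : 0 ≤ ∑ i, |ξ i| := by positivity
  have hD : 0 ≤ 2 * Real.pi * (∑ i, (d i : ℝ)) := by positivity
  have h5 : 1 + L ≤ (1 + 2 * Real.pi * (∑ i, (d i : ℝ))) * (1 + ∑ i, |ξ i|) := by
    rw [hL]; nlinarith
  calc (q : ℝ) * 2 * (1 + L) + L ≤ q * 2 * (1 + L) + q * (1 + L) := by nlinarith
    _ = 3 * (1 + L) * q := by ring
    _ ≤ 3 * ((1 + 2 * Real.pi * (∑ i, (d i : ℝ))) * (1 + ∑ i, |ξ i|)) * q := by gcongr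
    _ = _ := by ring

theorem smean_mul {q m : ℕ} (hq : 0 < q) (hm : 0 < m) {θ : I → ℝ}
    (hθ : ∀ i, ∃ a : ℤ, q * θ i = a) : smean d (q * m) θ = smean d q θ := by
  have h : ∀ n, ∑ x ∈ range (q * n), eC (phase d θ (x : ℝ))
      = n * ∑ x ∈ range q, eC (phase d θ (x : ℝ)) := by
    intro n
    induction n with
    | zero => simp
    | succ n ih =>
      rw [mul_add, mul_one, Finset.sum_range_add, ih]
      simp_rw [eC_phase_add_of_int d hθ]
      push_cast
      ring
  have hq' : (q : ℂ) ≠ 0 := by exact_mod_cast hq.ne'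
  have hm' : (m : ℂ) ≠ 0 := by exact_mod_cast hm.ne'
  rw [smean, smean, h]
  push_cast
  field_simp

theorem smean_eq_smean {q q' : ℕ} (hq : 0 < q) (hq' : 0 < q') {θ : I → ℝ}
    (hθ : ∀ i, ∃ a : ℤ, q * θ i = a) (hθ' : ∀ i, ∃ a : ℤ, q' * θ i = a) :
    smean d q θ = smean d q' θ := by
  rw [← smean_mul d hq hq' hθ, mul_comm, smean_mul d hq' hq hθ']

end ExpSum

section MajorArcs

variable {I : Type*} [Fintype I]

/-- Vectors of rationals in `[0, 1)`. -/
abbrev FracVec (I : Type*) := {ρ : I → ℚ // ∀ i, 0 ≤ ρ i ∧ ρ i < 1}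

/-- The least common denominator of a rational vector. -/
def commonDen (ρ : I → ℚ) : ℕ := univ.lcm fun i => (ρ i).den

theorem commonDen_pos (ρ : I → ℚ) : 0 < commonDen ρ :=
  Nat.pos_of_ne_zero fun h => by
    obtain ⟨i, -, hi⟩ := Finset.lcm_eq_zero_iff.1 h
    exact (ρ i).den_nz hi

theorem exists_commonDen_mul_eq (ρ : I → ℚ) (i : I) : ∃ a : ℤ, (commonDen ρ : ℚ) * ρ i = a := by
  obtain ⟨m, hm⟩ := Finset.dvd_lcm (f := fun i => (ρ i).den) (mem_univ i)
  refine ⟨m * (ρ i).num, ?_⟩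
  rw [commonDen, hm]
  push_cast
  rw [mul_comm ((ρ i).den : ℚ), mul_assoc, Rat.den_mul_eq_num]

theorem commonDen_dvd {ρ : I → ℚ} {q : ℕ} (hq : 0 < q) (h : ∀ i, ∃ a : ℤ, (q : ℚ) * ρ i = a) :
    commonDen ρ ∣ q := by
  refine Finset.lcm_dvd fun i _ => ?_
  obtain ⟨a, ha⟩ := h i
  have hq' : (q : ℚ) ≠ 0 := by positivity
  have e : ρ i = (a : ℚ) / ((q : ℤ) : ℚ) := by
    rw [Int.cast_natCast, eq_div_iff hq', mul_comm, ha]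
  rw [e]
  exact_mod_cast Rat.den_dvd a q

theorem injOn_commonDen_num (I : Type*) [Fintype I] :
    Function.Injective fun ρ : FracVec I =>
      (commonDen ρ.1, fun i => (commonDen ρ.1 * ρ.1 i).num.toNat) := by
  intro ρ ρ' h
  simp only [Prod.mk.injEq] at h
  obtain ⟨h1, h2⟩ := h
  have key : ∀ (σ : FracVec I) i, (((commonDen σ.1 * σ.1 i).num.toNat : ℕ) : ℚ)
      = commonDen σ.1 * σ.1 i := by
    intro σ i
    obtain ⟨a, ha⟩ := exists_commonDen_mul_eq σ.1 i
    have h0 : (0 : ℚ) ≤ a := by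
      rw [← ha]; exact mul_nonneg (by positivity) (σ.2 i).1
    rw [ha, Rat.num_intCast]
    exact_mod_cast Int.toNat_of_nonneg (by exact_mod_cast h0)
  ext i
  have h3 := congrFun h2 i
  have h4 : (commonDen ρ.1 : ℚ) * ρ.1 i = commonDen ρ'.1 * ρ'.1 i := by
    rw [← key ρ, ← key ρ']; exact congrArg _ h3
  rw [← h1] at h4
  exact mul_left_cancel₀ (by exact_mod_cast (commonDen_pos ρ.1).ne') h4

theorem mapsTo_commonDen_num (Q : ℕ) (ρ : FracVec I) (hρ : commonDen ρ.1 ≤ Q) :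
    (commonDen ρ.1, fun i => (commonDen ρ.1 * ρ.1 i).num.toNat) ∈
      Icc 1 Q ×ˢ Fintype.piFinset fun _ : I => range Q := by
  simp only [mem_product, mem_Icc, Fintype.mem_piFinset, mem_range]
  refine ⟨⟨commonDen_pos _, hρ⟩, fun i => lt_of_lt_of_le ?_ hρ⟩
  obtain ⟨a, ha⟩ := exists_commonDen_mul_eq ρ.1 i
  rw [ha, Rat.num_intCast, Int.toNat_lt' (commonDen_pos ρ.1)]
  have : (a : ℚ) < commonDen ρ.1 := by
    rw [← ha]
    exact mul_lt_of_lt_one_right (by exact_mod_cast commonDen_pos ρ.1) (ρ.2 i).2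
  exact_mod_cast this

/-- The rational vectors in `[0,1)` with common denominator at most `Q`. -/
def fareyVec (I : Type*) [Fintype I] (Q : ℕ) : Finset (FracVec I) :=
  (Set.Finite.of_injOn (s := {ρ : FracVec I | commonDen ρ.1 ≤ Q})
    (mapsTo_commonDen_num Q) (injOn_commonDen_num I).injOn
    (Finset.finite_toSet _)).toFinset

theorem mem_fareyVec {Q : ℕ} {ρ : FracVec I} : ρ ∈ fareyVec I Q ↔ commonDen ρ.1 ≤ Q := by
  simp [fareyVec]

theorem fareyVec_mono {Q Q' : ℕ} (h : Q ≤ Q') : fareyVec I Q ⊆ fareyVec I Q' := fun _ hρ =>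
  mem_fareyVec.2 ((mem_fareyVec.1 hρ).trans h)

theorem tendsto_fareyVec : Tendsto (fareyVec I) atTop atTop :=
  tendsto_atTop_finset_of_monotone (fun _ _ => fareyVec_mono)
    fun ρ => ⟨commonDen ρ.1, mem_fareyVec.2 le_rfl⟩

theorem card_fareyVec_le (Q : ℕ) : #(fareyVec I Q) ≤ Q ^ (Fintype.card I + 1) := by
  refine (Finset.card_le_card_of_injOn _ (fun ρ hρ => mapsTo_commonDen_num Q ρ (mem_fareyVec.1 hρ))
    (injOn_commonDen_num I).injOn).trans (le_of_eq ?_)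
  simp [pow_succ, mul_comm]

theorem exists_le_abs_sub {Q : ℕ} {ρ ρ' : FracVec I} (hρ : ρ ∈ fareyVec I Q)
    (hρ' : ρ' ∈ fareyVec I Q) (h : ρ ≠ ρ') :
    ∃ i, 1 ≤ (Q : ℝ) ^ 2 * |(ρ.1 i : ℝ) - ρ'.1 i| := by
  obtain ⟨i, hi⟩ : ∃ i, ρ.1 i ≠ ρ'.1 i := by
    by_contra! hc
    exact h (Subtype.ext (funext hc))
  refine ⟨i, ?_⟩
  obtain ⟨a, ha⟩ := exists_commonDen_mul_eq ρ.1 i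
  obtain ⟨b, hb⟩ := exists_commonDen_mul_eq ρ'.1 i
  have hq := commonDen_pos ρ.1
  have hq' := commonDen_pos ρ'.1
  set q := commonDen ρ.1 with hqdef
  set q' := commonDen ρ'.1 with hqdef'
  have e : (q : ℚ) * q' * (ρ.1 i - ρ'.1 i) = (q' * a - q * b : ℤ) := by
    push_cast
    rw [← ha, ← hb]; ring
  have hne : (q' * a - q * b : ℤ) ≠ 0 := by
    intro h0
    rw [h0, Int.cast_zero] at e
    have : (q : ℚ) * q' ≠ 0 := by positivity
    exact hi (sub_eq_zero.1 ((mul_eq_zero.1 e).resolve_left this))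
  have h1 : (1 : ℚ) ≤ |(q : ℚ) * q' * (ρ.1 i - ρ'.1 i)| := by
    rw [e, ← Int.cast_abs]; exact_mod_cast Int.one_le_abs hne
  rw [abs_mul, abs_of_nonneg (by positivity)] at h1
  have h2 : (1 : ℝ) ≤ q * q' * |(ρ.1 i : ℝ) - ρ'.1 i| := by exact_mod_cast h1
  refine h2.trans ?_
  have h3 : (q : ℝ) ≤ Q := by exact_mod_cast mem_fareyVec.1 hρ
  have h4 : (q' : ℝ) ≤ Q := by exact_mod_cast mem_fareyVec.1 hρ'
  rw [sq]
  gcongr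

variable (d : I → ℕ)

/-- The box with half side lengths `Q / P^{d_i}` around `ρ`. -/
def majBox (P Q : ℕ) (ρ : I → ℚ) : Set (I → ℝ) :=
  Set.Icc (fun i => (ρ i : ℝ) - Q / (P : ℝ) ^ d i) fun i => (ρ i : ℝ) + Q / (P : ℝ) ^ d i

/-- The major arcs. -/
def majArcs (P Q : ℕ) : Set (I → ℝ) := ⋃ ρ ∈ fareyVec I Q, majBox d P Q ρ.1

/-- A translate of the unit cube containing the major arcs of level at most `2 Q`. -/
def arcCube (I : Type*) (Q : ℕ) : Set (I → ℝ) :=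
  Set.univ.pi fun _ => Set.Ico (-(1 / (4 * Q) : ℝ)) (-(1 / (4 * Q) : ℝ) + 1)

variable {d}

theorem mem_majBox {P Q : ℕ} {ρ : I → ℚ} {α : I → ℝ} :
    α ∈ majBox d P Q ρ ↔ ∀ i, |α i - ρ i| ≤ Q / (P : ℝ) ^ d i := by
  simp only [majBox, Set.mem_Icc, Pi.le_def, abs_le, ← forall_and]
  refine forall_congr' fun i => ?_
  constructor <;> rintro ⟨h1, h2⟩ <;> constructor <;> linarith

theorem div_pow_le_div {P Q : ℕ} (hd : ∀ i, 0 < d i) (hP : 0 < P) (i : I) :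
    (Q : ℝ) / (P : ℝ) ^ d i ≤ Q / P := by
  have hP1 : (1 : ℝ) ≤ P := by exact_mod_cast hP
  gcongr
  exact le_self_pow₀ hP1 (hd i).ne'

theorem disjoint_majBox (hd : ∀ i, 0 < d i) {P Q : ℕ} (hPQ : 2 * Q ^ 3 < P) {ρ ρ' : FracVec I}
    (hρ : ρ ∈ fareyVec I Q) (hρ' : ρ' ∈ fareyVec I Q) (h : ρ ≠ ρ') :
    Disjoint (majBox d P Q ρ.1) (majBox d P Q ρ'.1) := by
  rw [Set.disjoint_left]
  intro α h1 h2
  obtain ⟨i, hi⟩ := exists_le_abs_sub hρ hρ' h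
  have hP : 0 < P := by omega
  have hP0 : (0 : ℝ) < P := by exact_mod_cast hP
  have h3 := (mem_majBox.1 h1 i).trans (div_pow_le_div hd hP i)
  have h4 := (mem_majBox.1 h2 i).trans (div_pow_le_div hd hP i)
  have h5 : |(ρ.1 i : ℝ) - ρ'.1 i| ≤ 2 * (Q / P) := by
    rw [abs_le] at h3 h4 ⊢
    constructor <;> linarith [h3.1, h3.2, h4.1, h4.2]
  have h6 : (2 * Q ^ 3 : ℝ) < P := by exact_mod_cast hPQ
  have h7 : (1 : ℝ) ≤ Q ^ 2 * (2 * (Q / P)) := hi.trans (by gcongr)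
  have h8 : (Q : ℝ) ^ 2 * (2 * (Q / P)) = 2 * Q ^ 3 / P := by ring
  rw [h8, le_div_iff₀ hP0] at h7
  linarith

theorem majArcs_subset_arcCube (hd : ∀ i, 0 < d i) {P Q Q' : ℕ} (hQ : 0 < Q) (hQ' : Q' ≤ 2 * Q)
    (hPQ : 8 * Q ^ 2 < P) : majArcs d P Q' ⊆ arcCube I Q := by
  intro α hα
  simp only [majArcs, Set.mem_iUnion, exists_prop] at hα
  obtain ⟨ρ, hρ, hα⟩ := hα
  intro i _
  have hP : 0 < P := by omega
  have hP0 : (0 : ℝ) < P := by exact_mod_cast hP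
  have hQ0 : (0 : ℝ) < Q := by exact_mod_cast hQ
  have h1 := (mem_majBox.1 hα i).trans (div_pow_le_div hd hP i)
  have h2 : (Q' : ℝ) ≤ 2 * Q := by exact_mod_cast hQ'
  have h3 : (8 * Q ^ 2 : ℝ) < P := by exact_mod_cast hPQ
  have h4 : (Q' : ℝ) / P < 1 / (4 * Q) := by
    rw [div_lt_div_iff₀ hP0 (by positivity)]
    nlinarith
  have h5 : (ρ.1 i : ℝ) ≤ 1 - 1 / (2 * Q) := by
    obtain ⟨a, ha⟩ := exists_commonDen_mul_eq ρ.1 i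
    have hq : (0 : ℚ) < commonDen ρ.1 := by exact_mod_cast commonDen_pos ρ.1
    have hq2 : (commonDen ρ.1 : ℚ) ≤ 2 * Q := by exact_mod_cast (mem_fareyVec.1 hρ).trans hQ'
    have ha1 : (a : ℚ) < commonDen ρ.1 := by
      rw [← ha]; exact mul_lt_of_lt_one_right hq (ρ.2 i).2
    have ha2 : (a : ℚ) + 1 ≤ commonDen ρ.1 := by
      have : a + 1 ≤ (commonDen ρ.1 : ℤ) := by exact_mod_cast ha1
      exact_mod_cast this
    have h6 : ρ.1 i ≤ 1 - 1 / (2 * Q) := by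
      have h7 : (1 : ℚ) / (2 * Q) ≤ 1 / commonDen ρ.1 := by gcongr
      have h8 : ρ.1 i ≤ 1 - 1 / commonDen ρ.1 := by
        rw [le_sub_iff_add_le, ← mul_le_mul_iff_right₀ hq, mul_add, ha, mul_one_div_cancel hq.ne',
          mul_one]
        exact ha2
      linarith
    have h9 : ((ρ.1 i : ℚ) : ℝ) ≤ ((1 - 1 / (2 * Q) : ℚ) : ℝ) := Rat.cast_le.2 h6
    push_cast at h9
    exact h9
  have h6 : (0 : ℝ) ≤ ρ.1 i := by exact_mod_cast (ρ.2 i).1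
  have h7 : (1 : ℝ) / (2 * Q) = 2 * (1 / (4 * Q)) := by field_simp; norm_num
  rw [abs_le] at h1
  constructor <;> linarith [h1.1, h1.2]

theorem measurableSet_majArcs (P Q : ℕ) : MeasurableSet (majArcs d P Q) :=
  Finset.measurableSet_biUnion _ fun _ _ => measurableSet_Icc

theorem setIntegral_box {E : Type*} [NormedAddCommGroup E] [NormedSpace ℝ E] (F : (I → ℝ) → E)
    (ρ : I → ℝ) {D : I → ℝ} (hD : ∀ i, 0 < D i) (Q : ℝ) :
    ∫ α in Set.Icc (fun i => ρ i - Q / D i) (fun i => ρ i + Q / D i), F α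
      = (∏ i, D i)⁻¹ • ∫ ζ in Set.Icc (fun _ : I => -Q) (fun _ => Q),
        F (fun i => ρ i + ζ i / D i) := by
  set L : (I → ℝ) →L[ℝ] (I → ℝ) := LinearMap.toContinuousLinearMap
    (Matrix.toLin' (Matrix.diagonal fun i => (D i)⁻¹)) with hL
  have hLx : ∀ ζ i, L ζ i = (D i)⁻¹ * ζ i := fun ζ i => by
    simp [hL, Matrix.toLin'_apply, Matrix.mulVec_diagonal]
  have hdet : L.det = (∏ i, D i)⁻¹ := by
    rw [ContinuousLinearMap.det, hL, LinearMap.coe_toContinuousLinearMap, LinearMap.det_toLin',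
      Matrix.det_diagonal, Finset.prod_inv_distrib]
  have hfun : ∀ ζ : I → ℝ, (fun i => ρ i + ζ i / D i) = ρ + L ζ := fun ζ => by
    ext i; simp [hLx, div_eq_inv_mul]
  have himg : Set.Icc (fun i => ρ i - Q / D i) (fun i => ρ i + Q / D i)
      = (fun ζ => ρ + L ζ) '' Set.Icc (fun _ : I => -Q) (fun _ => Q) := by
    ext α
    simp only [Set.mem_Icc, Set.mem_image, Pi.le_def]
    constructor
    · rintro ⟨h1, h2⟩
      refine ⟨fun i => D i * (α i - ρ i), ⟨fun i => ?_, fun i => ?_⟩, ?_⟩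
      · have := h1 i
        rw [sub_le_comm, le_div_iff₀ (hD i)] at this
        linarith
      · have := h2 i
        rw [← sub_le_iff_le_add', le_div_iff₀ (hD i)] at this
        linarith
      · ext i
        have := (hD i).ne'
        simp only [Pi.add_apply, hLx]
        field_simp
        ring
    · rintro ⟨ζ, ⟨h1, h2⟩, rfl⟩
      refine ⟨fun i => ?_, fun i => ?_⟩
      · have := div_le_div_of_nonneg_right (h1 i) (hD i).le
        simp only [Pi.add_apply, hLx, ← div_eq_inv_mul]
        rw [neg_div] at this
        linarith
      · have := div_le_div_of_nonneg_right (h2 i) (hD i).le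
        simp only [Pi.add_apply, hLx, ← div_eq_inv_mul]
        linarith
  have hpos : 0 < ∏ i, D i := Finset.prod_pos fun i _ => hD i
  have hinj : Set.InjOn (fun ζ => ρ + L ζ) (Set.Icc (fun _ : I => -Q) (fun _ => Q)) := by
    intro ζ _ ζ' _ h
    ext i
    have := congrFun h i
    simp only [Pi.add_apply, hLx, add_right_inj] at this
    exact mul_left_cancel₀ (inv_ne_zero (hD i).ne') this
  rw [himg, integral_image_eq_integral_abs_det_fderiv_smul volume measurableSet_Icc
    (fun x _ => (L.hasFDerivAt.const_add ρ).hasFDerivWithinAt) hinj]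
  simp_rw [hfun, hdet, abs_of_pos (inv_pos.2 hpos)]
  rw [integral_smul]

end MajorArcs

theorem norm_prod_sub_prod_le_sum {ι : Type*} (S : Finset ι) {a b : ι → ℂ} (ha : ∀ i, ‖a i‖ ≤ 1)
    (hb : ∀ i, ‖b i‖ ≤ 1) : ‖∏ i ∈ S, a i - ∏ i ∈ S, b i‖ ≤ ∑ i ∈ S, ‖a i - b i‖ := by
  induction S using Finset.induction_on with
  | empty => simp
  | insert i S hi ih =>
    rw [Finset.prod_insert hi, Finset.prod_insert hi, Finset.sum_insert hi]
    have e : a i * ∏ x ∈ S, a x - b i * ∏ x ∈ S, b x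
        = (a i - b i) * ∏ x ∈ S, a x + b i * (∏ x ∈ S, a x - ∏ x ∈ S, b x) := by ring
    have h1 : ‖∏ x ∈ S, a x‖ ≤ 1 := by
      rw [norm_prod]; exact Finset.prod_le_one (fun _ _ => norm_nonneg _) fun x _ => ha x
    rw [e]
    refine (norm_add_le _ _).trans (add_le_add ?_ ?_)
    · rw [norm_mul]; exact mul_le_of_le_one_right (norm_nonneg _) h1
    · rw [norm_mul]; exact (mul_le_of_le_one_left (norm_nonneg _) (hb i)).trans ih

section Product

variable {I J : Type*} [Fintype I] [Fintype J] (d : I → ℕ) (c : I → J → ℤ)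

/-- The linear form `(c_{ij} γ_i)_i` attached to the variable `j`. -/
def linForm (j : J) (γ : I → ℝ) : I → ℝ := fun i => c i j * γ i

/-- The product of the normalised exponential sums over all variables. -/
def prodSum (P : ℕ) (α : I → ℝ) : ℂ := ∏ j, normSum d P (linForm c j α)

/-- The term of the singular series at the rational point `ρ`. -/
def singTerm (ρ : I → ℚ) : ℂ := ∏ j, smean d (commonDen ρ) (linForm c j fun i => (ρ i : ℝ))

/-- The integrand of the singular integral. -/
def singInt (ξ : I → ℝ) : ℂ := ∏ j, osc d (linForm c j ξ)

theorem continuous_linForm (j : J) : Continuous (linForm c j) := by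
  unfold linForm; fun_prop

theorem continuous_prodSum (P : ℕ) : Continuous (prodSum d c P) :=
  continuous_finsetProd _ fun j _ => (continuous_normSum d P).comp (continuous_linForm c j)

theorem continuous_singInt : Continuous (singInt d c) :=
  continuous_finsetProd _ fun j _ => (continuous_osc d).comp (continuous_linForm c j)

theorem exists_int_mul_linForm {q : ℕ} {ρ : I → ℚ} (h : ∀ i, ∃ a : ℤ, (q : ℚ) * ρ i = a) (j : J)
    (i : I) : ∃ a : ℤ, (q : ℝ) * linForm c j (fun i => (ρ i : ℝ)) i = a := by
  obtain ⟨a, ha⟩ := h i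
  refine ⟨c i j * a, ?_⟩
  have : (q : ℝ) * ρ i = a := by exact_mod_cast ha
  simp only [linForm]
  push_cast
  rw [← this]
  ring

theorem exists_norm_prodSum_sub_le : ∃ C : ℝ, 0 ≤ C ∧ ∀ P : ℕ, 0 < P → ∀ (ρ : I → ℚ) (ξ : I → ℝ),
    ‖prodSum d c P (fun i => ρ i + ξ i / (P : ℝ) ^ d i) - singTerm d c ρ * singInt d c ξ‖
      ≤ C * (1 + ∑ i, |ξ i|) * commonDen ρ / P := by
  set B : ℝ := 1 + ∑ i, ∑ j, |(c i j : ℝ)| with hB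
  have hB1 : 1 ≤ B := by rw [hB]; simp; positivity
  refine ⟨∑ _j : J, 3 * (1 + 2 * Real.pi * (∑ i, (d i : ℝ))) * B, by positivity,
    fun P hP ρ ξ => ?_⟩
  rw [singTerm, singInt, ← Finset.prod_mul_distrib, prodSum]
  refine (norm_prod_sub_prod_le_sum _ (fun j => norm_normSum_le _ _ _) fun j => ?_).trans ?_
  · rw [norm_mul]
    exact mul_le_one₀ (norm_smean_le _ _ _) (norm_nonneg _) (norm_osc_le _ _)
  rw [Finset.sum_mul, Finset.sum_mul, Finset.sum_div]
  refine Finset.sum_le_sum fun j _ => ?_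
  have e : linForm c j (fun i => (ρ i : ℝ) + ξ i / (P : ℝ) ^ d i)
      = fun i => linForm c j (fun i => (ρ i : ℝ)) i + linForm c j ξ i / (P : ℝ) ^ d i := by
    ext i; simp only [linForm]; ring
  rw [e]
  refine (norm_normSum_sub_le d hP (commonDen_pos ρ)
    (exists_int_mul_linForm c (exists_commonDen_mul_eq ρ) j) _).trans ?_
  have h1 : 1 + ∑ i, |linForm c j ξ i| ≤ B * (1 + ∑ i, |ξ i|) := by
    have h2 : ∀ i, |linForm c j ξ i| ≤ B * |ξ i| := fun i => by
      simp only [linForm]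
      rw [abs_mul]
      gcongr
      have h3 : |(c i j : ℝ)| ≤ ∑ j, |(c i j : ℝ)| :=
        Finset.single_le_sum (f := fun j => |(c i j : ℝ)|) (fun _ _ => abs_nonneg _) (mem_univ j)
      have h4 : ∑ j, |(c i j : ℝ)| ≤ ∑ i, ∑ j, |(c i j : ℝ)| :=
        Finset.single_le_sum (f := fun i => ∑ j, |(c i j : ℝ)|) (fun _ _ => by positivity)
          (mem_univ i)
      linarith
    rw [mul_add, mul_one, Finset.mul_sum]
    exact add_le_add hB1 (Finset.sum_le_sum fun i _ => h2 i)
  calc _ ≤ 3 * (1 + 2 * Real.pi * ∑ i, (d i : ℝ)) * (B * (1 + ∑ i, |ξ i|)) * commonDen ρ / P := by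
        gcongr
    _ = _ := by ring

theorem exists_majArcs_integral_approx (hd : ∀ i, 0 < d i) {u : ℂ → ℂ}
    (hu : ∀ z w, ‖u z - u w‖ ≤ ‖z - w‖) (hum : ∀ z w, u (z * w) = u z * u w) :
    ∃ C : ℝ, 0 ≤ C ∧ ∀ P Q : ℕ, 0 < Q → 2 * Q ^ 3 < P →
      ‖(P : ℂ) ^ (∑ i, d i) * (∫ α in majArcs d P Q, u (prodSum d c P α))
        - (∑ ρ ∈ fareyVec I Q, u (singTerm d c ρ.1))
          * ∫ ξ in Set.Icc (fun _ : I => -(Q : ℝ)) (fun _ => (Q : ℝ)), u (singInt d c ξ)‖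
        ≤ C * (Q : ℝ) ^ (2 * Fintype.card I + 3) / P := by
  obtain ⟨C, hC0, hC⟩ := exists_norm_prodSum_sub_le d c
  set r := Fintype.card I with hr
  refine ⟨C * (1 + r) * 2 ^ r, by positivity, fun P Q hQ hPQ => ?_⟩
  have hP : 0 < P := by omega
  have hP0 : (0 : ℝ) < P := by exact_mod_cast hP
  have hQ1 : (1 : ℝ) ≤ Q := by exact_mod_cast hQ
  have hucont : Continuous u := LipschitzWith.continuous (K := 1)
    (LipschitzWith.of_dist_le_mul fun z w => by simpa [dist_eq_norm] using hu z w)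
  have hcF : Continuous fun α => u (prodSum d c P α) := hucont.comp (continuous_prodSum d c P)
  have hcB : Continuous fun ξ => u (singInt d c ξ) := hucont.comp (continuous_singInt d c)
  set S := Set.Icc (fun _ : I => -(Q : ℝ)) (fun _ => (Q : ℝ)) with hS
  have h1 : (P : ℂ) ^ (∑ i, d i) * ∫ α in majArcs d P Q, u (prodSum d c P α)
      = ∑ ρ ∈ fareyVec I Q, ∫ ξ in S,
        u (prodSum d c P fun i => (ρ.1 i : ℝ) + ξ i / (P : ℝ) ^ d i) := by
    have hm : ∀ ρ ∈ fareyVec I Q, MeasurableSet (majBox d P Q ρ.1) := fun _ _ => measurableSet_Icc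
    have hi : ∀ ρ ∈ fareyVec I Q,
        IntegrableOn (fun α => u (prodSum d c P α)) (majBox d P Q ρ.1) := fun _ _ =>
      hcF.continuousOn.integrableOn_compact isCompact_Icc
    rw [majArcs, integral_biUnion_finset _ hm
      (fun ρ hρ ρ' hρ' h => disjoint_majBox hd hPQ hρ hρ' h) hi, Finset.mul_sum]
    refine Finset.sum_congr rfl fun ρ _ => ?_
    rw [majBox, setIntegral_box _ _ (fun i => by positivity), Complex.real_smul,
      Finset.prod_pow_eq_pow_sum]
    push_cast
    rw [mul_inv_cancel_left₀]
    exact pow_ne_zero _ (by exact_mod_cast hP.ne')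
  rw [h1, Finset.sum_mul, ← Finset.sum_sub_distrib]
  have h2 : ∀ ρ ∈ fareyVec I Q,
      ‖(∫ ξ in S, u (prodSum d c P fun i => (ρ.1 i : ℝ) + ξ i / (P : ℝ) ^ d i))
        - u (singTerm d c ρ.1) * ∫ ξ in S, u (singInt d c ξ)‖
        ≤ C * (1 + r) * Q * Q / P * (2 * Q) ^ r := by
    intro ρ hρ
    have hc1 : Continuous fun ξ : I → ℝ =>
        u (prodSum d c P fun i => (ρ.1 i : ℝ) + ξ i / (P : ℝ) ^ d i) :=
      hcF.comp (by fun_prop)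
    have hc2 : Continuous fun ξ : I → ℝ => u (singTerm d c ρ.1) * u (singInt d c ξ) :=
      continuous_const.mul hcB
    rw [← integral_const_mul, ← integral_sub
      (hc1.continuousOn.integrableOn_compact isCompact_Icc)
      (hc2.continuousOn.integrableOn_compact isCompact_Icc)]
    have hvol : volume.real S = (2 * Q : ℝ) ^ r := by
      rw [Measure.real, hS, Real.volume_Icc_pi_toReal (by intro i; simp)]
      simp [two_mul, hr]
    rw [← hvol]
    refine norm_setIntegral_le_of_norm_le_const isCompact_Icc.measure_lt_top fun ξ hξ => ?_
    rw [← hum]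
    refine (hu _ _).trans ((hC P hP ρ.1 ξ).trans ?_)
    have h3 : 1 + ∑ i, |ξ i| ≤ (1 + r) * Q := by
      have : ∑ i, |ξ i| ≤ ∑ _i : I, (Q : ℝ) :=
        Finset.sum_le_sum fun i _ => abs_le.2 ⟨hξ.1 i, hξ.2 i⟩
      rw [Finset.sum_const, nsmul_eq_mul, Finset.card_univ] at this
      nlinarith
    have h4 : (commonDen ρ.1 : ℝ) ≤ Q := by exact_mod_cast mem_fareyVec.1 hρ
    calc _ ≤ C * ((1 + r) * Q) * Q / P := by gcongr
      _ = _ := by ring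
  refine (norm_sum_le _ _).trans ((Finset.sum_le_sum h2).trans ?_)
  rw [Finset.sum_const, nsmul_eq_mul]
  have h5 : (#(fareyVec I Q) : ℝ) ≤ (Q : ℝ) ^ (r + 1) := by exact_mod_cast card_fareyVec_le Q
  calc _ ≤ (Q : ℝ) ^ (r + 1) * (C * (1 + r) * Q * Q / P * (2 * Q) ^ r) := by gcongr
    _ = _ := by
      rw [mul_pow]
      have : (Q : ℝ) ^ (2 * r + 3) = Q ^ (r + 1) * Q * Q * Q ^ r := by ring
      rw [this]
      ring

end Product

section Circle

variable {I J : Type*} [Fintype I] [Fintype J] (d : I → ℕ) (c : I → J → ℤ)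

/-- The number of solutions with coordinates in `[1, P]` of the system of diagonal equations. -/
def solCount (P : ℕ) : ℕ :=
  #{x ∈ Fintype.piFinset fun _ : J => Icc 1 P | ∀ i, ∑ j, c i j * (x j : ℤ) ^ d i = 0}

/-- The bound required of the minor arcs: a power saving in `Q` as soon as `P` is of size about
`Q ^ (2 r + 4)`. -/
def MinorArcBound : Prop :=
  ∃ τ : ℝ, 0 < τ ∧ ∃ C : ℝ, ∃ Q₀ : ℕ, ∀ Q, Q₀ ≤ Q → ∀ P : ℕ, Q ^ (2 * Fintype.card I + 4) ≤ P →
    P < (2 * Q) ^ (2 * Fintype.card I + 4) →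
    (P : ℝ) ^ (∑ i, d i) * (∫ α in arcCube I Q \ majArcs d P Q, ‖prodSum d c P α‖)
      ≤ C * (Q : ℝ) ^ (-τ)

/-- The cube `[-Q, Q]^I`. -/
def symmCube (I : Type*) (Q : ℕ) : Set (I → ℝ) :=
  Set.Icc (fun _ : I => -(Q : ℝ)) (fun _ => (Q : ℝ))

theorem aecover_symmCube : AECover (volume : Measure (I → ℝ)) atTop (symmCube I) where
  ae_eventually_mem := by
    refine Eventually.of_forall fun x => ?_
    obtain ⟨n, hn⟩ := exists_nat_ge ‖x‖
    filter_upwards [eventually_ge_atTop n] with m hm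
    have : ∀ i, |x i| ≤ m := fun i =>
      (norm_le_pi_norm x i).trans (hn.trans (by exact_mod_cast hm))
    exact ⟨fun i => (abs_le.1 (this i)).1, fun i => (abs_le.1 (this i)).2⟩
  measurableSet _ := measurableSet_Icc

theorem integral_arcCube_prodSum (P Q : ℕ) :
    ∫ α in arcCube I Q, prodSum d c P α
      = ((P : ℂ) ^ Fintype.card J)⁻¹ * (solCount d c P : ℂ) := by
  have h1 : ∀ α, prodSum d c P α = ((P : ℂ) ^ Fintype.card J)⁻¹ *
      ∑ x ∈ Fintype.piFinset fun _ : J => Icc 1 P,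
        eC (∑ i, α i * ((∑ j, c i j * (x j : ℤ) ^ d i : ℤ) : ℝ)) := by
    intro α
    simp only [prodSum, normSum, expSum]
    rw [Finset.prod_mul_distrib, Finset.prod_const, Finset.card_univ, inv_pow,
      Finset.prod_univ_sum]
    congr 1
    refine Finset.sum_congr rfl fun x _ => ?_
    rw [← eC_sum]
    congr 1
    simp only [phase, linForm]
    rw [Finset.sum_comm]
    refine Finset.sum_congr rfl fun i _ => ?_
    push_cast
    rw [Finset.mul_sum]
    exact Finset.sum_congr rfl fun j _ => by ring
  simp_rw [h1]
  rw [integral_const_mul, arcCube, integral_cube_sum_eC _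
    (fun (x : J → ℕ) i => ∑ j, c i j * (x j : ℤ) ^ d i), solCount]
  simp only [funext_iff, Pi.zero_apply]

theorem exists_majArcs_integral_norm_approx (hd : ∀ i, 0 < d i) :
    ∃ C : ℝ, 0 ≤ C ∧ ∀ P Q : ℕ, 0 < Q → 2 * Q ^ 3 < P →
      |(P : ℝ) ^ (∑ i, d i) * (∫ α in majArcs d P Q, ‖prodSum d c P α‖)
        - (∑ ρ ∈ fareyVec I Q, ‖singTerm d c ρ.1‖) * ∫ ξ in symmCube I Q, ‖singInt d c ξ‖|
        ≤ C * (Q : ℝ) ^ (2 * Fintype.card I + 3) / P := by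
  obtain ⟨C, hC0, hC⟩ := exists_majArcs_integral_approx d c hd (u := fun z => ((‖z‖ : ℝ) : ℂ))
    (fun z w => by
      rw [← Complex.ofReal_sub, Complex.norm_real]; exact abs_norm_sub_norm_le z w)
    (fun z w => by simp)
  refine ⟨C, hC0, fun P Q hQ hPQ => ?_⟩
  have := hC P Q hQ hPQ
  rw [integral_complex_ofReal, integral_complex_ofReal] at this
  rw [← Real.norm_eq_abs, ← Complex.norm_real]
  push_cast
  exact this

theorem singTerm_zero : singTerm d c (fun _ => 0) = 1 := by
  rw [singTerm]
  refine Finset.prod_eq_one fun j _ => ?_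
  have h0 : (linForm c j fun _ : I => (((0 : ℚ)) : ℝ)) = fun _ => 0 := by
    ext; simp [linForm]
  have hq : (commonDen (fun _ : I => (0 : ℚ)) : ℂ) ≠ 0 := by
    exact_mod_cast (commonDen_pos _).ne'
  rw [h0]
  simp [smean, phase, inv_mul_cancel₀ hq]

theorem singInt_zero : singInt d c 0 = 1 := by
  rw [singInt]
  refine Finset.prod_eq_one fun j _ => ?_
  have h0 : linForm c j (0 : I → ℝ) = fun _ => 0 := by
    ext; simp [linForm]
  rw [h0]
  simp [osc, phase]

theorem one_le_sum_norm_singTerm {Q : ℕ} (hQ : 0 < Q) :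
    1 ≤ ∑ ρ ∈ fareyVec I Q, ‖singTerm d c ρ.1‖ := by
  have h0 : commonDen (fun _ : I => (0 : ℚ)) ∣ 1 :=
    commonDen_dvd one_pos fun i => ⟨0, by simp⟩
  have hmem : (⟨fun _ => 0, fun _ => by norm_num⟩ : FracVec I) ∈ fareyVec I Q :=
    mem_fareyVec.2 ((Nat.le_of_dvd one_pos h0).trans hQ)
  refine le_trans ?_ (Finset.single_le_sum (f := fun ρ : FracVec I => ‖singTerm d c ρ.1‖)
    (fun _ _ => norm_nonneg _) hmem)
  simp [singTerm_zero]

theorem integrableOn_norm_singInt (Q : ℕ) :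
    IntegrableOn (fun ξ => ‖singInt d c ξ‖) (symmCube I Q) :=
  (continuous_singInt d c).norm.continuousOn.integrableOn_compact isCompact_Icc

theorem monotone_integral_norm_singInt :
    Monotone fun Q : ℕ => ∫ ξ in symmCube I Q, ‖singInt d c ξ‖ := by
  intro Q Q' h
  refine setIntegral_mono_set (integrableOn_norm_singInt d c Q')
    (Eventually.of_forall fun _ => norm_nonneg _) (Eventually.of_forall ?_)
  have h' : (Q : ℝ) ≤ Q' := by exact_mod_cast h
  exact Set.Icc_subset_Icc (fun i => neg_le_neg h') fun i => h'

theorem integral_norm_singInt_pos : 0 < ∫ ξ in symmCube I 1, ‖singInt d c ξ‖ := by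
  rw [setIntegral_pos_iff_support_of_nonneg_ae (Eventually.of_forall fun _ => norm_nonneg _)
    (integrableOn_norm_singInt d c 1)]
  set U : Set (I → ℝ) := (Function.support fun ξ => ‖singInt d c ξ‖) ∩
    Set.univ.pi fun _ => Set.Ioo (-1) 1 with hU
  have hUo : IsOpen U := (continuous_singInt d c).norm.isOpen_support.inter
    (isOpen_set_pi Set.finite_univ fun _ _ => isOpen_Ioo)
  have hU0 : (0 : I → ℝ) ∈ U := ⟨by simp [singInt_zero], fun i _ => by simp⟩
  refine (hUo.measure_pos volume ⟨0, hU0⟩).trans_le (measure_mono ?_)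
  refine Set.inter_subset_inter_right _ fun x hx => ?_
  simp only [symmCube, Nat.cast_one]
  exact ⟨fun i => (hx i trivial).1.le, fun i => (hx i trivial).2.le⟩

variable {d c}

theorem MinorArcBound.exists_sum_mul_integral_le (hd : ∀ i, 0 < d i) (h : MinorArcBound d c) :
    ∃ B : ℝ, ∃ n₀ : ℕ, ∀ n, n₀ ≤ n → (∑ ρ ∈ fareyVec I (2 ^ n), ‖singTerm d c ρ.1‖) *
      (∫ ξ in symmCube I (2 ^ n), ‖singInt d c ξ‖) ≤ B := by
  obtain ⟨τ, hτ, C, Q₀, hM⟩ := h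
  obtain ⟨C₁, hC₁, happ⟩ := exists_majArcs_integral_norm_approx d c hd
  set A := 2 * Fintype.card I + 4 with hA
  set W : ℕ → ℝ := fun Q => (∑ ρ ∈ fareyVec I Q, ‖singTerm d c ρ.1‖) *
      (∫ ξ in symmCube I Q, ‖singInt d c ξ‖) with hW
  obtain ⟨n₀, hn₀⟩ : ∃ n₀ : ℕ, Q₀ + 17 ≤ 2 ^ n₀ := ⟨Q₀ + 17, Nat.lt_two_pow_self.le⟩
  set C₂ : ℝ := |C| + C₁ * (1 + 2 ^ (2 * Fintype.card I + 3)) with hC₂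
  have hC₂0 : 0 ≤ C₂ := by positivity
  set τ' := min τ 1 with hτ'
  have hτ'0 : 0 < τ' := lt_min hτ one_pos
  have step : ∀ n, n₀ ≤ n → W (2 ^ (n + 1)) ≤ W (2 ^ n) + C₂ * ((2 : ℝ) ^ (-τ')) ^ n := by
    intro n hn
    have hQ : Q₀ + 17 ≤ 2 ^ n := hn₀.trans (Nat.pow_le_pow_right two_pos hn)
    set Q := 2 ^ n with hQdef
    have hQ1 : (1 : ℝ) ≤ (Q : ℝ) := by exact_mod_cast (by omega : 1 ≤ Q)
    have hQ0 : (0 : ℝ) < Q := by linarith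
    set P := Q ^ A with hP
    have hP4 : Q ^ 4 ≤ P := Nat.pow_le_pow_right (by omega) (by omega)
    have hQ3 : 17 * Q ^ 3 ≤ Q ^ 4 := by
      rw [pow_succ Q 3, mul_comm]; exact Nat.mul_le_mul_left _ (by omega)
    have hQ2 : 17 * Q ^ 2 ≤ Q ^ 3 := by
      rw [pow_succ Q 2, mul_comm]; exact Nat.mul_le_mul_left _ (by omega)
    have hQ2pos : 0 < Q ^ 2 := by positivity
    have b1 := happ P Q (by omega) (by omega)
    have b2 := happ P (2 * Q) (by omega) (by rw [mul_pow]; omega)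
    have b3 := hM Q (by omega) P le_rfl
      (Nat.pow_lt_pow_left (by omega) (by omega))
    have hPR : (P : ℝ) = Q ^ A := by rw [hP]; push_cast; rfl
    have e1 : C₁ * (Q : ℝ) ^ (2 * Fintype.card I + 3) / P = C₁ * (Q : ℝ)⁻¹ := by
      rw [hPR, hA, pow_succ (Q : ℝ) (2 * Fintype.card I + 3)]
      field_simp
    have e2 : C₁ * ((2 * Q : ℕ) : ℝ) ^ (2 * Fintype.card I + 3) / P
        = C₁ * 2 ^ (2 * Fintype.card I + 3) * (Q : ℝ)⁻¹ := by
      rw [hPR, hA, pow_succ (Q : ℝ) (2 * Fintype.card I + 3)]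
      push_cast
      rw [mul_pow]
      field_simp
    rw [e1] at b1
    rw [e2] at b2
    have hcont := (continuous_prodSum d c P).norm
    have hint : IntegrableOn (fun α => ‖prodSum d c P α‖) (arcCube I Q) :=
      integrableOn_cube_of_bounded hcont subset_rfl
    have hmono : (∫ α in majArcs d P (2 * Q), ‖prodSum d c P α‖)
        ≤ (∫ α in majArcs d P Q, ‖prodSum d c P α‖)
          + ∫ α in arcCube I Q \ majArcs d P Q, ‖prodSum d c P α‖ := by
      have hsub : majArcs d P Q ⊆ arcCube I Q :=
        majArcs_subset_arcCube hd (by omega) (by omega) (by omega)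
      rw [setIntegral_sdiff (measurableSet_majArcs P Q) hint hsub, add_sub_cancel]
      refine setIntegral_mono_set hint
        (Eventually.of_forall fun _ => norm_nonneg _) (Eventually.of_forall ?_)
      exact majArcs_subset_arcCube hd (by omega) le_rfl (by omega)
    have hmono' := mul_le_mul_of_nonneg_left hmono
      (by positivity : (0 : ℝ) ≤ (P : ℝ) ^ (∑ i, d i))
    rw [mul_add] at hmono'
    have hτ1 : (Q : ℝ) ^ (-τ) ≤ (Q : ℝ) ^ (-τ') :=
      Real.rpow_le_rpow_of_exponent_le hQ1 (neg_le_neg (min_le_left _ _))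
    have hτ2 : (Q : ℝ)⁻¹ ≤ (Q : ℝ) ^ (-τ') := by
      rw [← Real.rpow_neg_one]
      exact Real.rpow_le_rpow_of_exponent_le hQ1 (neg_le_neg (min_le_right _ _))
    have hQn : (Q : ℝ) ^ (-τ') = ((2 : ℝ) ^ (-τ')) ^ n := by
      rw [hQdef]
      push_cast
      rw [← Real.rpow_natCast, ← Real.rpow_natCast, ← Real.rpow_mul two_pos.le,
        ← Real.rpow_mul two_pos.le, mul_comm]
    rw [← hQn, pow_succ, mul_comm (2 ^ n) 2]
    have f1 := (abs_le.1 b1).2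
    have f2 := (abs_le.1 b2).1
    have f3 : C * (Q : ℝ) ^ (-τ) ≤ |C| * (Q : ℝ) ^ (-τ') :=
      (mul_le_mul_of_nonneg_right (le_abs_self C) (by positivity)).trans
        (mul_le_mul_of_nonneg_left hτ1 (abs_nonneg C))
    have f4 : C₁ * (1 + 2 ^ (2 * Fintype.card I + 3)) * (Q : ℝ)⁻¹
        ≤ C₁ * (1 + 2 ^ (2 * Fintype.card I + 3)) * (Q : ℝ) ^ (-τ') := by gcongr
    simp only [hW, hC₂]
    linarith
  set q : ℝ := (2 : ℝ) ^ (-τ') with hq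
  have hq0 : 0 ≤ q := by positivity
  have hq1 : q < 1 := Real.rpow_lt_one_of_one_lt_of_neg one_lt_two (by linarith)
  have hs := summable_geometric_of_lt_one hq0 hq1
  refine ⟨W (2 ^ n₀) + C₂ * ∑' n, q ^ n, n₀, fun n hn => ?_⟩
  have key : ∀ m, W (2 ^ (n₀ + m)) ≤ W (2 ^ n₀) + C₂ * ∑ i ∈ range (n₀ + m), q ^ i := by
    intro m
    induction m with
    | zero =>
      have : 0 ≤ C₂ * ∑ i ∈ range n₀, q ^ i := by positivity
      simpa using this
    | succ m ih =>
      have := step (n₀ + m) (by omega)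
      rw [← add_assoc, Finset.sum_range_succ, mul_add]
      linarith
  obtain ⟨m, rfl⟩ := Nat.exists_eq_add_of_le hn
  refine (key m).trans ?_
  gcongr
  exact hs.sum_le_tsum _ fun _ _ => by positivity

theorem MinorArcBound.summable_singTerm (hd : ∀ i, 0 < d i) (h : MinorArcBound d c) :
    Summable fun ρ : FracVec I => ‖singTerm d c ρ.1‖ := by
  obtain ⟨B, n₀, hB⟩ := h.exists_sum_mul_integral_le hd
  have hV := integral_norm_singInt_pos d c
  refine summable_of_sum_le (c := B / ∫ ξ in symmCube I 1, ‖singInt d c ξ‖)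
    (fun _ => norm_nonneg _) fun S => ?_
  have hev := (tendsto_fareyVec (I := I)).eventually_ge_atTop S
  obtain ⟨N, hN⟩ := eventually_atTop.1 hev
  set n := n₀ + N with hn
  have hS := hN (2 ^ n) ((Nat.le_add_left N n₀).trans Nat.lt_two_pow_self.le)
  rw [le_div_iff₀ hV]
  refine le_trans ?_ (hB n (Nat.le_add_right _ _))
  have h1 : ∑ ρ ∈ S, ‖singTerm d c ρ.1‖ ≤ ∑ ρ ∈ fareyVec I (2 ^ n), ‖singTerm d c ρ.1‖ :=
    Finset.sum_le_sum_of_subset_of_nonneg hS fun _ _ _ => norm_nonneg _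
  exact mul_le_mul h1 (monotone_integral_norm_singInt d c Nat.one_le_two_pow) hV.le
    (Finset.sum_nonneg fun _ _ => norm_nonneg _)

theorem MinorArcBound.integrable_singInt (hd : ∀ i, 0 < d i) (h : MinorArcBound d c) :
    Integrable (singInt d c) := by
  obtain ⟨B, n₀, hB⟩ := h.exists_sum_mul_integral_le hd
  refine aecover_symmCube.integrable_of_integral_norm_bounded B
    (fun Q => (continuous_singInt d c).continuousOn.integrableOn_compact isCompact_Icc) ?_
  filter_upwards with Q
  set n := n₀ + Q with hn
  refine (monotone_integral_norm_singInt d c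
    ((Nat.le_add_left Q n₀).trans (Nat.lt_two_pow_self (n := n)).le)).trans ?_
  refine le_trans ?_ (hB n (Nat.le_add_right _ _))
  exact le_mul_of_one_le_left (setIntegral_nonneg measurableSet_Icc fun _ _ => norm_nonneg _)
    (one_le_sum_norm_singTerm d c (by positivity))

/-- The asymptotic formula, given an acceptable bound on the minor arcs. -/
theorem MinorArcBound.tendsto_solCount (hd : ∀ i, 0 < d i) (h : MinorArcBound d c) :
    Tendsto (fun P : ℕ => (P : ℂ) ^ (∑ i, d i) *
        (((P : ℂ) ^ Fintype.card J)⁻¹ * (solCount d c P : ℂ))) atTop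
      (nhds ((∑' ρ : FracVec I, singTerm d c ρ.1) * ∫ ξ, singInt d c ξ)) := by
  obtain ⟨C₁, hC₁, happ⟩ := exists_majArcs_integral_approx d c hd (u := id)
    (fun _ _ => le_rfl) (fun _ _ => rfl)
  have hS := (h.summable_singTerm hd).of_norm.hasSum.comp tendsto_fareyVec
  have hI := aecover_symmCube.integral_tendsto_of_countably_generated (h.integrable_singInt hd)
  obtain ⟨τ, hτ, C, Q₀, hM⟩ := h
  set A := 2 * Fintype.card I + 4 with hA
  have hroot : ∀ P : ℕ, ∃ Q : ℕ, Q ^ A ≤ P ∧ P < (Q + 1) ^ A := fun P => by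
    refine ⟨Nat.findGreatest (fun Q => Q ^ A ≤ P) P, ?_, ?_⟩
    · exact Nat.findGreatest_spec (P := fun Q => Q ^ A ≤ P) (Nat.zero_le P)
        (by rw [zero_pow (by omega)]; exact Nat.zero_le _)
    · by_contra! h'
      have hle : Nat.findGreatest (fun Q => Q ^ A ≤ P) P + 1 ≤ P :=
        (Nat.le_self_pow (by omega) _).trans h'
      have := Nat.le_findGreatest (P := fun Q => Q ^ A ≤ P) hle h'
      omega
  choose Q hQ1 hQ2 using hroot
  have hQt : Tendsto Q atTop atTop := by
    refine tendsto_atTop.2 fun b => ?_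
    filter_upwards [eventually_ge_atTop (b ^ A)] with P hP
    by_contra! h'
    exact absurd (hP.trans_lt (hQ2 P)) (not_lt.2 (Nat.pow_le_pow_left h' A))
  have hlim : Tendsto (fun P => (∑ ρ ∈ fareyVec I (Q P), singTerm d c ρ.1) *
      ∫ ξ in symmCube I (Q P), singInt d c ξ) atTop
      (nhds ((∑' ρ : FracVec I, singTerm d c ρ.1) * ∫ ξ, singInt d c ξ)) :=
    (hS.mul hI).comp hQt
  refine hlim.congr_dist ?_
  have hQR : Tendsto (fun P => (Q P : ℝ)) atTop atTop := tendsto_natCast_atTop_atTop.comp hQt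
  have hbound : Tendsto (fun P => C₁ * (Q P : ℝ)⁻¹ + C * (Q P : ℝ) ^ (-τ)) atTop (nhds 0) := by
    have h1 := (tendsto_inv_atTop_zero.comp hQR).const_mul C₁
    have h2 := ((tendsto_rpow_neg_atTop hτ).comp hQR).const_mul C
    simpa using h1.add h2
  refine squeeze_zero' (Eventually.of_forall fun _ => dist_nonneg) ?_ hbound
  filter_upwards [hQt.eventually_ge_atTop (Q₀ + 17)] with P hP
  have hQP1 := hQ1 P
  have hQP2 := hQ2 P
  set q := Q P with hq
  have hq0 : (0 : ℝ) < q := by exact_mod_cast (by omega : 0 < q)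
  have hP4 : q ^ 4 ≤ P := (Nat.pow_le_pow_right (by omega) (by omega)).trans hQP1
  have hQ3 : 17 * q ^ 3 ≤ q ^ 4 := by
    rw [pow_succ q 3, mul_comm]; exact Nat.mul_le_mul_left _ (by omega)
  have hQ2' : 17 * q ^ 2 ≤ q ^ 3 := by
    rw [pow_succ q 2, mul_comm]; exact Nat.mul_le_mul_left _ (by omega)
  have hq2pos : 0 < q ^ 2 := by have : 0 < q := by omega
                                positivity
  have b1 := happ P q (by omega) (by omega)
  have b2 := hM q (by omega) P hQP1 (hQP2.trans_le (Nat.pow_le_pow_left (by omega) A))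
  have hsub : majArcs d P q ⊆ arcCube I q :=
    majArcs_subset_arcCube hd (by omega) (by omega) (by omega)
  have hcont := continuous_prodSum d c P
  have hint : IntegrableOn (prodSum d c P) (arcCube I q) :=
    integrableOn_cube_of_bounded hcont subset_rfl
  have hdec := setIntegral_sdiff (measurableSet_majArcs (d := d) P q) hint hsub
  have hPq : C₁ * (q : ℝ) ^ (2 * Fintype.card I + 3) / P ≤ C₁ * (q : ℝ)⁻¹ := by
    have hPR : (q : ℝ) ^ A ≤ P := by exact_mod_cast hQP1
    rw [hA, pow_succ (q : ℝ) (2 * Fintype.card I + 3)] at hPR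
    have hP0 : (0 : ℝ) < P := lt_of_lt_of_le (by positivity) hPR
    rw [div_le_iff₀ hP0, mul_assoc]
    refine mul_le_mul_of_nonneg_left ?_ hC₁
    rw [inv_mul_eq_div, le_div_iff₀ hq0]
    exact hPR
  have hminor : ‖(P : ℂ) ^ (∑ i, d i) * ∫ α in arcCube I q \ majArcs d P q, prodSum d c P α‖
      ≤ C * (q : ℝ) ^ (-τ) := by
    rw [norm_mul, norm_pow, Complex.norm_natCast]
    exact (mul_le_mul_of_nonneg_left (norm_integral_le_integral_norm _) (by positivity)).trans b2
  rw [← integral_arcCube_prodSum d c P q, dist_comm, dist_eq_norm]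
  simp only [id] at b1
  have e : (P : ℂ) ^ (∑ i, d i) * (∫ α in arcCube I q, prodSum d c P α)
      - (∑ ρ ∈ fareyVec I q, singTerm d c ρ.1) * ∫ ξ in symmCube I q, singInt d c ξ
      = ((P : ℂ) ^ (∑ i, d i) * (∫ α in majArcs d P q, prodSum d c P α)
        - (∑ ρ ∈ fareyVec I q, singTerm d c ρ.1) * ∫ ξ in symmCube I q, singInt d c ξ)
        + (P : ℂ) ^ (∑ i, d i) * ∫ α in arcCube I q \ majArcs d P q, prodSum d c P α := by
    rw [hdec]; ring
  rw [e]
  exact (norm_add_le _ _).trans (add_le_add (b1.trans hPq) hminor)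

end Circle

section Minor

variable {I J : Type*} [Fintype I] [Fintype J] {d : I → ℕ} {c : I → J → ℤ}

/-- The coefficients can be solved for: for each `i` some combination of the columns of `c`
isolates the row `i` among all rows of the same degree. -/
def RowsSeparated (d : I → ℕ) (c : I → J → ℤ) : Prop :=
  ∃ D : ℕ, 0 < D ∧ ∃ B : I → J → ℤ,
    ∀ i i', d i' = d i → ∑ j, B i j * c i' j = if i' = i then (D : ℤ) else 0

theorem expSum_eq_weylSum {k : ℕ} (hk : ∀ i, d i ∈ Icc 1 k) (P : ℕ) (γ : I → ℝ) :
    expSum d P γ = weylSum k P fun n => ∑ i with d i = n, γ i := by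
  refine Finset.sum_congr rfl fun x _ => ?_
  congr 1
  rw [phase, ← Finset.sum_fiberwise_of_maps_to (s := univ) (fun i _ => hk i)]
  refine Finset.sum_congr rfl fun n _ => ?_
  rw [Finset.sum_mul]
  exact Finset.sum_congr rfl fun i hi => by rw [(mem_filter.1 hi).2]

theorem RowsSeparated.exists_normSum_lt (hd : ∀ i, 0 < d i) (hc : RowsSeparated d c) :
    ∃ δ : ℝ, 0 < δ ∧ ∀ᶠ P : ℕ in atTop, ∀ Q : ℕ, Q ^ (2 * Fintype.card I + 4) ≤ P →
      P < (2 * Q) ^ (2 * Fintype.card I + 4) → ∀ α ∈ arcCube I Q \ majArcs d P Q,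
        ∃ j, ‖normSum d P (linForm c j α)‖ < (P : ℝ) ^ (-δ) := by
  obtain ⟨D, hD, B, hB⟩ := hc
  set A := 2 * Fintype.card I + 4 with hA
  set s := Fintype.card J with hs
  set k := ∑ i, d i + 1 with hk
  have hdk : ∀ i, d i ∈ Icc 1 k := fun i => mem_Icc.2 ⟨hd i, by
    have := Finset.single_le_sum (f := d) (fun _ _ => Nat.zero_le _) (mem_univ i)
    omega⟩
  set σ : ℝ := 1 / (2 * A * (s + 1)) with hσ
  have hA0 : (0 : ℝ) < A := by positivity
  have hσ0 : 0 < σ := by positivity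
  obtain ⟨δ, hδ, hW⟩ := weylProp (k := k) (by omega) σ hσ0
  set M : ℝ := 2 * (D + ∑ i, ∑ j, |(B i j : ℝ)|) with hM
  have hsσ : s * σ + 1 / (2 * A) ≤ (1 : ℝ) / A := by
    have : (s : ℝ) * σ ≤ 1 / (2 * A) := by
      rw [hσ, mul_one_div, div_le_div_iff₀ (by positivity) (by positivity)]
      nlinarith
    have e : (1 : ℝ) / A = 1 / (2 * A) + 1 / (2 * A) := by field_simp; norm_num
    linarith
  refine ⟨δ, hδ, ?_⟩
  filter_upwards [hW, eventually_le_natCast_rpow M (δ := 1 / (2 * A)) (by positivity),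
    eventually_ge_atTop (17 ^ A)] with P hWP hMP hP17 Q hQP hPQ α hα
  by_contra! hlarge
  have hP1 : (1 : ℝ) ≤ P := by exact_mod_cast (Nat.one_le_pow _ _ (by norm_num)).trans hP17
  have hP0 : (0 : ℝ) < P := by linarith
  have hQ9 : 9 ≤ Q := by
    have := lt_of_pow_lt_pow_left₀ A (by omega) (hP17.trans_lt hPQ)
    omega
  have hQR : (9 : ℝ) ≤ Q := by exact_mod_cast hQ9
  have hMQ : M * (P : ℝ) ^ (s * σ) ≤ 2 * Q := by
    refine (const_mul_rpow_le (κ := 1 / (2 * A)) (b := 1 / A) hP1 hMP hsσ).trans ?_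
    have h1 : (P : ℝ) ≤ ((2 * Q : ℝ)) ^ A := by exact_mod_cast hPQ.le
    calc (P : ℝ) ^ ((1 : ℝ) / A) ≤ ((2 * Q : ℝ) ^ A) ^ ((1 : ℝ) / A) :=
          Real.rpow_le_rpow hP0.le h1 (by positivity)
      _ = 2 * Q := by
        rw [one_div, Real.pow_rpow_inv_natCast (by positivity) (by omega)]
  have hQ8 : 8 * (Q : ℝ) ^ 2 < P := by
    have h1 : Q ^ 4 ≤ P := (Nat.pow_le_pow_right (by omega) (by omega)).trans hQP
    have h2 : (Q : ℝ) ^ 4 ≤ P := by exact_mod_cast h1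
    nlinarith [sq_nonneg (Q : ℝ), mul_le_mul hQR hQR (by norm_num) (by linarith)]
  have hweyl : ∀ j, ∃ q : ℕ, 1 ≤ q ∧ (q : ℝ) ≤ (P : ℝ) ^ σ ∧ ∀ n ∈ Icc 1 k, ∃ a : ℤ,
      |q * (∑ i with d i = n, linForm c j α i) - a| ≤ (P : ℝ) ^ (σ - n) := fun j => by
    refine hWP P le_rfl _ ?_
    have h1 := hlarge j
    rw [← expSum_eq_weylSum hdk]
    rw [normSum, norm_mul, norm_inv, Complex.norm_natCast, inv_mul_eq_div,
      le_div_iff₀ hP0] at h1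
    rwa [sub_eq_neg_add, Real.rpow_add_one hP0.ne']
  choose q hq1 hqP a ha using hweyl
  set q' := ∏ j, q j with hq'
  have hq'1 : 1 ≤ q' := Finset.one_le_prod' fun j _ => hq1 j
  have hq'P : (q' : ℝ) ≤ (P : ℝ) ^ (s * σ) := by
    rw [hq', mul_comm, Real.rpow_mul hP0.le, Real.rpow_natCast]
    push_cast
    calc ∏ j, (q j : ℝ) ≤ ∏ _j : J, (P : ℝ) ^ σ :=
          Finset.prod_le_prod (fun _ _ => by positivity) fun j _ => hqP j
      _ = _ := by rw [Finset.prod_const, Finset.card_univ]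
  have hcommon : ∀ i j, ∃ b : ℤ,
      |q' * (∑ i' with d i' = d i, linForm c j α i') - b| ≤ (P : ℝ) ^ (s * σ - d i) := by
    intro i j
    have hqj : q' = (∏ j' ∈ univ.erase j, q j') * q j := by
      rw [hq', Finset.prod_erase_mul _ _ (mem_univ j)]
    have hrest : ((∏ j' ∈ univ.erase j, q j' : ℕ) : ℝ) ≤ (P : ℝ) ^ ((s - 1) * σ) := by
      have hs1 : 1 ≤ s := Fintype.card_pos_iff.2 ⟨j⟩
      have e : ((s : ℝ) - 1) = ((s - 1 : ℕ) : ℝ) := by rw [Nat.cast_sub hs1]; simp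
      rw [e, mul_comm, Real.rpow_mul hP0.le, Real.rpow_natCast]
      push_cast
      calc ∏ j' ∈ univ.erase j, (q j' : ℝ) ≤ ∏ _j ∈ univ.erase j, (P : ℝ) ^ σ :=
            Finset.prod_le_prod (fun _ _ => by positivity) fun j _ => hqP j
        _ = _ := by rw [Finset.prod_const, Finset.card_erase_of_mem (mem_univ j),
                      Finset.card_univ]
    refine ⟨(∏ j' ∈ univ.erase j, q j' : ℕ) * a j (d i) (hdk i), ?_⟩
    have h1 := ha j (d i) (hdk i)
    rw [hqj]
    push_cast at hrest ⊢
    rw [mul_assoc, ← mul_sub, abs_mul, abs_of_nonneg (by positivity)]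
    calc _ ≤ (P : ℝ) ^ ((s - 1) * σ) * (P : ℝ) ^ (σ - d i) := by gcongr
      _ = _ := by rw [← Real.rpow_add hP0]; congr 1; ring
  choose b hb using hcommon
  have hsolve : ∀ i, (D : ℝ) * α i
      = ∑ j, (B i j : ℝ) * ∑ i' with d i' = d i, linForm c j α i' := by
    intro i
    simp_rw [Finset.mul_sum]
    rw [Finset.sum_comm]
    have h1 : ∀ i' ∈ univ.filter (fun i' => d i' = d i),
        ∑ j, (B i j : ℝ) * linForm c j α i' = if i' = i then (D : ℝ) * α i' else 0 := by
      intro i' hi'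
      have h2 := hB i i' (mem_filter.1 hi').2
      have h3 : ∑ j, (B i j : ℝ) * c i' j = if i' = i then (D : ℝ) else 0 := by
        exact_mod_cast h2
      simp only [linForm, ← mul_assoc]
      rw [← Finset.sum_mul, h3, ite_mul, zero_mul]
    rw [Finset.sum_congr rfl h1, Finset.sum_ite_eq' , if_pos (by simp)]
  set β : I → ℤ := fun i => ∑ j, B i j * b i j with hβ
  have hBM : ∀ i, ∑ j, |(B i j : ℝ)| ≤ M / 2 := fun i => by
    have := Finset.single_le_sum (f := fun i => ∑ j, |(B i j : ℝ)|)
      (fun _ _ => by positivity) (mem_univ i)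
    rw [hM]
    have : (0 : ℝ) ≤ D := by positivity
    linarith
  have hclose : ∀ i, |D * q' * α i - β i| ≤ Q / (P : ℝ) ^ d i := by
    intro i
    have e : D * q' * α i - β i = ∑ j, (B i j : ℝ) *
        (q' * (∑ i' with d i' = d i, linForm c j α i') - b i j) := by
      rw [mul_right_comm, hsolve, hβ]
      push_cast
      rw [Finset.sum_mul, ← Finset.sum_sub_distrib]
      exact Finset.sum_congr rfl fun j _ => by ring
    rw [e]
    calc _ ≤ ∑ j, |(B i j : ℝ)| * (P : ℝ) ^ (s * σ - d i) := by
          refine (Finset.abs_sum_le_sum_abs _ _).trans (Finset.sum_le_sum fun j _ => ?_)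
          rw [abs_mul]
          exact mul_le_mul_of_nonneg_left (hb i j) (abs_nonneg _)
      _ ≤ M / 2 * (P : ℝ) ^ (s * σ - d i) := by
          rw [← Finset.sum_mul]; gcongr; exact hBM i
      _ = (M * (P : ℝ) ^ (s * σ)) / 2 / (P : ℝ) ^ d i := by
          rw [Real.rpow_sub hP0, Real.rpow_natCast]; ring
      _ ≤ _ := by gcongr; linarith
  have hDq : (1 : ℝ) ≤ D * q' := by exact_mod_cast Nat.mul_pos hD hq'1
  have hDqQ : (D * q' : ℝ) ≤ Q := by
    have h1 : (2 * D : ℝ) ≤ M := by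
      rw [hM]; have : 0 ≤ ∑ i, ∑ j, |(B i j : ℝ)| := by positivity
      linarith
    have h2 : 2 * D * q' ≤ M * (P : ℝ) ^ (s * σ) :=
      mul_le_mul h1 hq'P (by positivity) (by positivity)
    linarith
  have hdiff : ∀ i, |α i - β i / (D * q')| ≤ Q / (P : ℝ) ^ d i := fun i => by
    have e : α i - β i / (D * q') = (D * q' * α i - β i) / (D * q') := by field_simp
    rw [e, abs_div, abs_of_nonneg (by linarith : (0 : ℝ) ≤ D * q')]
    exact (div_le_self (abs_nonneg _) hDq).trans (hclose i)
  have hsmall : ∀ i, (Q : ℝ) / (P : ℝ) ^ d i < 1 / (8 * Q) := fun i => by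
    refine (div_pow_le_div hd (by exact_mod_cast hP0) i).trans_lt ?_
    rw [div_lt_div_iff₀ hP0 (by positivity)]
    linarith
  have h4Q : (1 : ℝ) / (4 * Q) = 2 * (1 / (8 * Q)) := by field_simp; norm_num
  have h8Q : (0 : ℝ) < 1 / (8 * Q) := by positivity
  have hlow : ∀ i, 0 ≤ β i := fun i => by
    have h1 := (hα.1 i trivial).1
    have h2 := (abs_le.1 (hdiff i)).2
    have h3 : -(1 / (Q : ℝ)) < β i / (D * q') := by
      have : (1 : ℝ) / Q = 8 * (1 / (8 * Q)) := by field_simp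
      have := hsmall i
      linarith
    have h4 : -(1 : ℝ) < β i := by
      rw [lt_div_iff₀ (by linarith)] at h3
      refine lt_of_le_of_lt ?_ h3
      rw [neg_mul, neg_le_neg_iff, one_div_mul_eq_div]
      exact div_le_one_of_le₀ hDqQ (by positivity)
    have h5 : (-1 : ℤ) < β i := by exact_mod_cast h4
    omega
  have hupp : ∀ i, (β i : ℝ) < D * q' := fun i => by
    have h1 := (hα.1 i trivial).2
    have h2 := (abs_le.1 (hdiff i)).1
    have h3 : β i / (D * q') < (1 : ℝ) := by have := hsmall i; linarith
    rwa [div_lt_one (by linarith)] at h3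
  refine hα.2 ?_
  set ρ : FracVec I := ⟨fun i => β i / ((D * q' : ℕ) : ℚ), fun i => by
    have hpos : (0 : ℚ) < ((D * q' : ℕ) : ℚ) := by exact_mod_cast Nat.mul_pos hD hq'1
    refine ⟨div_nonneg (by exact_mod_cast hlow i) hpos.le, ?_⟩
    rw [div_lt_one hpos]
    have := hupp i
    exact_mod_cast this⟩ with hρ
  have hpos : (((D * q' : ℕ) : ℚ)) ≠ 0 := by exact_mod_cast (Nat.mul_pos hD hq'1).ne'
  refine Set.mem_biUnion (x := ρ) (mem_fareyVec.2 ?_) (mem_majBox.2 fun i => ?_)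
  · refine (Nat.le_of_dvd (Nat.mul_pos hD hq'1) (commonDen_dvd (Nat.mul_pos hD hq'1)
      fun i => ⟨β i, mul_div_cancel₀ _ hpos⟩)).trans ?_
    exact_mod_cast hDqQ
  · have := hdiff i
    simp only [hρ]
    push_cast
    exact this

end Minor

section Counting

theorem card_le_prod_of_fibers {M : ℕ} : ∀ {X : Fin M → Type} [∀ b, DecidableEq (X b)]
    (T : Finset (∀ b, X b)) (N : Fin M → ℕ), (∀ b, ∀ z ∈ T,
      #((T.filter fun z' => ∀ b', b < b' → z' b' = z b').image fun z' => z' b) ≤ N b) →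
    #T ≤ ∏ b, N b := by
  induction M with
  | zero =>
    intro X _ T N _
    simpa using Finset.card_le_one_of_subsingleton T
  | succ M ih =>
    intro X _ T N h
    rw [Fin.prod_univ_succ]
    have h1 : #(T.image Fin.tail) ≤ ∏ b : Fin M, N b.succ := by
      refine ih (X := fun b => X b.succ) (T.image Fin.tail) _ fun b z hz => ?_
      obtain ⟨w, hw, rfl⟩ := mem_image.1 hz
      refine (Finset.card_le_card fun y hy => ?_).trans (h b.succ w hw)
      obtain ⟨z', hz', rfl⟩ := mem_image.1 hy
      obtain ⟨hz1, hz2⟩ := mem_filter.1 hz'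
      obtain ⟨w', hw', rfl⟩ := mem_image.1 hz1
      refine mem_image.2 ⟨w', mem_filter.2 ⟨hw', fun b' hb' => ?_⟩, rfl⟩
      obtain ⟨b'', rfl⟩ := Fin.exists_succ_eq.2 (Fin.ne_zero_of_lt hb')
      exact hz2 b'' (Fin.succ_lt_succ_iff.1 hb')
    refine (Finset.card_le_mul_card_image (f := Fin.tail) T (N 0) fun τ hτ => ?_).trans
      (Nat.mul_le_mul_left _ h1)
    obtain ⟨w, hw, rfl⟩ := mem_image.1 hτ
    refine le_trans (le_of_eq (Finset.card_image_of_injOn (f := fun z' => z' 0) ?_).symm)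
      ((Finset.card_le_card (Finset.image_subset_image fun z hz => ?_)).trans (h 0 w hw))
    · intro z hz z' hz' hzz
      have e : Fin.tail z = Fin.tail z' := by
        rw [(mem_filter.1 hz).2, (mem_filter.1 hz').2]
      rw [← Fin.cons_self_tail z, ← Fin.cons_self_tail z', e]
      exact congrArg (fun a => Fin.cons a (Fin.tail z')) hzz
    · obtain ⟨h2, h3⟩ := mem_filter.1 hz
      refine mem_filter.2 ⟨h2, fun b' hb' => ?_⟩
      obtain ⟨b'', rfl⟩ := Fin.exists_succ_eq.2 (Fin.ne_zero_of_lt hb')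
      exact congrFun h3 b''

theorem card_sub_eq_le {X G : Type*} [AddCommGroup G] (S : Finset X) (g : X → G) (w : G) :
    #{p ∈ S ×ˢ S | g p.1 - g p.2 = w} ≤ #{p ∈ S ×ˢ S | g p.1 = g p.2} := by
  set r : G → ℕ := fun a => #{x ∈ S | g x = a} with hr
  have hfib : ∀ (φ : G → G), #{p ∈ S ×ˢ S | g p.2 = φ (g p.1)}
      = ∑ a ∈ S.image g, r a * r (φ a) := by
    intro φ
    rw [Finset.card_eq_sum_card_fiberwise (f := fun p => g p.1) (t := S.image g)
      fun p hp => mem_image_of_mem _ (mem_product.1 (mem_filter.1 hp).1).1]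
    refine Finset.sum_congr rfl fun a _ => ?_
    rw [hr, ← Finset.card_product]
    congr 1
    ext ⟨x, y⟩
    simp only [mem_filter, mem_product]
    constructor
    · rintro ⟨⟨⟨hx, hy⟩, h⟩, rfl⟩
      exact ⟨⟨hx, rfl⟩, hy, h⟩
    · rintro ⟨⟨hx, rfl⟩, hy, h⟩
      exact ⟨⟨⟨hx, hy⟩, h⟩, rfl⟩
  have e1 : #{p ∈ S ×ˢ S | g p.1 - g p.2 = w} = ∑ a ∈ S.image g, r a * r (a - w) := by
    rw [← hfib fun a => a - w]
    congr 1
    refine Finset.filter_congr fun p _ => ?_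
    rw [sub_eq_iff_eq_add, eq_sub_iff_add_eq, add_comm, eq_comm]
  have e2 : #{p ∈ S ×ˢ S | g p.1 = g p.2} = ∑ a ∈ S.image g, r a * r a := by
    rw [← hfib fun a => a]
    congr 1
    exact Finset.filter_congr fun p _ => eq_comm
  have e3 : ∑ a ∈ S.image g, r (a - w) * r (a - w) ≤ ∑ a ∈ S.image g, r a * r a := by
    rw [← Finset.sum_image (f := fun a => r a * r a) (g := fun a => a - w)
      fun a _ b _ h => sub_left_injective h]
    refine Finset.sum_le_sum_of_ne_zero fun a _ ha => ?_
    have : r a ≠ 0 := fun h => ha (by rw [h, mul_zero])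
    obtain ⟨x, hx⟩ := Finset.card_pos.1 (Nat.pos_of_ne_zero this)
    exact mem_image.2 ⟨x, (mem_filter.1 hx).1, (mem_filter.1 hx).2⟩
  rw [e1, e2]
  have e4 : 2 * ∑ a ∈ S.image g, r a * r (a - w)
      ≤ ∑ a ∈ S.image g, r a * r a + ∑ a ∈ S.image g, r (a - w) * r (a - w) := by
    rw [Finset.mul_sum, ← Finset.sum_add_distrib]
    refine Finset.sum_le_sum fun a _ => ?_
    zify
    nlinarith [sq_nonneg ((r a : ℤ) - r (a - w))]
  omega

/-- The number of pairs of `v`-tuples from `A` with equal power sums for all exponents in `E`. -/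
def energy (A : Finset ℕ) (v : ℕ) (E : Finset ℕ) : ℕ :=
  #{w ∈ (Fintype.piFinset fun _ : Fin v => A) ×ˢ (Fintype.piFinset fun _ : Fin v => A) |
    ∀ e ∈ E, ∑ m, (w.1 m : ℤ) ^ e = ∑ m, (w.2 m : ℤ) ^ e}

theorem card_powerSum_sub_eq_le (A : Finset ℕ) (v : ℕ) (E : Finset ℕ) (u : ℕ → ℤ) :
    #{w ∈ (Fintype.piFinset fun _ : Fin v => A) ×ˢ (Fintype.piFinset fun _ : Fin v => A) |
      ∀ e ∈ E, ∑ m, (w.1 m : ℤ) ^ e - ∑ m, (w.2 m : ℤ) ^ e = u e} ≤ energy A v E := by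
  have := card_sub_eq_le (Fintype.piFinset fun _ : Fin v => A)
    (fun x (e : E) => ∑ m, (x m : ℤ) ^ (e : ℕ)) fun e => u e
  simpa only [funext_iff, Subtype.forall, Pi.sub_apply, energy] using this

variable {I : Type*} [Fintype I]

theorem norm_sum_eC_pow (A : Finset ℕ) (φ : ℕ → I → ℤ) (v : ℕ) (α : I → ℝ) :
    ((‖∑ x ∈ A, eC (∑ i, α i * φ x i)‖ ^ (2 * v) : ℝ) : ℂ)
      = ∑ w ∈ (Fintype.piFinset fun _ : Fin v => A) ×ˢ (Fintype.piFinset fun _ : Fin v => A),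
        eC (∑ i, α i * ((∑ m, φ (w.1 m) i - ∑ m, φ (w.2 m) i : ℤ) : ℝ)) := by
  have h1 : ∀ ψ : ℕ → I → ℤ, (∑ x ∈ A, eC (∑ i, α i * ψ x i)) ^ v
      = ∑ w ∈ Fintype.piFinset fun _ : Fin v => A, eC (∑ i, α i * ((∑ m, ψ (w m) i : ℤ) : ℝ)) := by
    intro ψ
    have : (∑ x ∈ A, eC (∑ i, α i * ψ x i)) ^ v
        = ∏ _m : Fin v, ∑ x ∈ A, eC (∑ i, α i * ψ x i) := by simp
    rw [this, Finset.prod_univ_sum]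
    refine Finset.sum_congr rfl fun w _ => ?_
    rw [← eC_sum, Finset.sum_comm]
    congr 1
    refine Finset.sum_congr rfl fun i _ => ?_
    rw [← Finset.mul_sum]
    push_cast
    rfl
  have h2 : (starRingEnd ℂ) (∑ x ∈ A, eC (∑ i, α i * φ x i))
      = ∑ x ∈ A, eC (∑ i, α i * ((fun x i => -φ x i) x i : ℤ)) := by
    rw [map_sum]
    refine Finset.sum_congr rfl fun x _ => ?_
    rw [← eC_neg, ← Finset.sum_neg_distrib]
    push_cast
    simp
  rw [pow_mul]
  push_cast
  rw [← Complex.mul_conj', mul_pow, h2, h1, h1, Finset.sum_mul_sum, Finset.sum_product]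
  refine Finset.sum_congr rfl fun w _ => Finset.sum_congr rfl fun w' _ => ?_
  rw [← eC_add, ← Finset.sum_add_distrib]
  congr 1
  refine Finset.sum_congr rfl fun i _ => ?_
  push_cast
  rw [Finset.sum_neg_distrib]
  ring

theorem integral_prod_norm_sum_eC_pow {β : Type*} [Fintype β] [DecidableEq β] (A : Finset ℕ)
    (φ : β → ℕ → I → ℤ) (v : β → ℕ) (δ : I → ℝ) :
    ∫ α in Set.univ.pi fun i => Set.Ico (δ i) (δ i + 1),
      ∏ b, ‖∑ x ∈ A, eC (∑ i, α i * φ b x i)‖ ^ (2 * v b)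
      = #{z ∈ Fintype.piFinset fun b => (Fintype.piFinset fun _ : Fin (v b) => A) ×ˢ
          (Fintype.piFinset fun _ : Fin (v b) => A) |
          ∀ i, ∑ b, (∑ m, φ b ((z b).1 m) i - ∑ m, φ b ((z b).2 m) i) = 0} := by
  have key := integral_cube_sum_eC (Fintype.piFinset fun b =>
    (Fintype.piFinset fun _ : Fin (v b) => A) ×ˢ (Fintype.piFinset fun _ : Fin (v b) => A))
    (fun z i => ∑ b, (∑ m, φ b ((z b).1 m) i - ∑ m, φ b ((z b).2 m) i)) δ
  rw [← Complex.ofReal_inj, ← integral_complex_ofReal]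
  simp only [funext_iff, Pi.zero_apply] at key
  rw [Complex.ofReal_natCast, ← key]
  congr 1
  ext α
  push_cast
  simp_rw [← Complex.ofReal_pow, norm_sum_eC_pow]
  rw [Finset.prod_univ_sum]
  refine Finset.sum_congr rfl fun z _ => ?_
  rw [← eC_sum, Finset.sum_comm]
  congr 1
  refine Finset.sum_congr rfl fun i _ => ?_
  rw [← Finset.mul_sum]
  push_cast
  rfl

end Counting

theorem prod_le_sum_pow {n : ℕ} (hn : 0 < n) {a : Fin n → ℝ} (ha : ∀ m, 0 ≤ a m) :
    ∏ m, a m ≤ ∑ m, a m ^ n := by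
  have : Nonempty (Fin n) := ⟨⟨0, hn⟩⟩
  obtain ⟨m₀, -, h⟩ := Finset.exists_max_image univ a univ_nonempty
  calc ∏ m, a m ≤ ∏ _m : Fin n, a m₀ := Finset.prod_le_prod (fun m _ => ha m) h
    _ = a m₀ ^ n := by simp
    _ ≤ _ := Finset.single_le_sum (f := fun m => a m ^ n) (fun m _ => pow_nonneg (ha m) n)
        (mem_univ m₀)

section MeanValue

variable {I J : Type*} [Fintype I] [Fintype J] {d : I → ℕ} {c : I → J → ℤ} {M : ℕ}

theorem prod_le_mul_sum_injective {v : Fin M → ℕ} (hv : ∀ b, 0 < v b)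
    (hs : 2 * ∑ b, v b < Fintype.card J) {F : J → ℝ} (hF0 : ∀ j, 0 ≤ F j) (hF1 : ∀ j, F j ≤ 1)
    (j₀ : J) : ∏ j, F j ≤ F j₀ * ∑ j : Fin M → J with Function.Injective j,
      ∏ b, F (j b) ^ (2 * v b) := by
  have hcard : Fintype.card (Σ b, Fin (2 * v b)) ≤ Fintype.card {j : J // j ≠ j₀} := by
    rw [Fintype.card_subtype_compl, Fintype.card_sigma]
    simp only [Fintype.card_fin, Fintype.card_subtype_eq, ← Finset.mul_sum]
    omega
  obtain ⟨e⟩ := Function.Embedding.nonempty_of_card_le hcard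
  rw [← Finset.mul_prod_erase univ F (mem_univ j₀)]
  refine mul_le_mul_of_nonneg_left ?_ (hF0 j₀)
  have hsub : univ.map (e.trans (Function.Embedding.subtype _)) ⊆ univ.erase j₀ := by
    intro j hj
    obtain ⟨σ, -, rfl⟩ := mem_map.1 hj
    exact mem_erase.2 ⟨(e σ).2, mem_univ _⟩
  rw [← Finset.prod_sdiff hsub, Finset.prod_map]
  refine (mul_le_of_le_one_left (Finset.prod_nonneg fun _ _ => hF0 _)
    (Finset.prod_le_one (fun _ _ => hF0 _) fun _ _ => hF1 _)).trans ?_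
  rw [Fintype.prod_sigma]
  refine (Finset.prod_le_prod (fun b _ => Finset.prod_nonneg fun _ _ => hF0 _) fun b _ =>
    prod_le_sum_pow (Nat.mul_pos two_pos (hv b)) fun m => hF0 _).trans ?_
  rw [Finset.prod_univ_sum]
  have hinj : Function.Injective fun (m : ∀ b, Fin (2 * v b)) (b : Fin M) =>
      ((e ⟨b, m b⟩ : {j : J // j ≠ j₀}) : J) := by
    intro m m' h
    ext b
    have := e.injective (Subtype.ext (congrFun h b))
    simp only [Sigma.mk.injEq, heq_eq_eq, true_and] at this
    rw [this]
  have himg := Finset.sum_image (s := Fintype.piFinset fun b : Fin M =>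
    (univ : Finset (Fin (2 * v b)))) (f := fun j : Fin M → J => ∏ b, F (j b) ^ (2 * v b))
    hinj.injOn
  refine (le_of_eq himg.symm).trans (Finset.sum_le_sum_of_subset_of_nonneg (fun j hj => ?_)
    fun _ _ _ => Finset.prod_nonneg fun _ _ => pow_nonneg (hF0 _) _)
  obtain ⟨m, -, rfl⟩ := mem_image.1 hj
  refine mem_filter.2 ⟨mem_univ _, fun b b' h => ?_⟩
  exact congrArg Sigma.fst (e.injective (Subtype.ext h))

/-- The rows of degree in `E b` determine the contribution of the `b`-th of `M` distinct
variables from those of the later ones. -/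
def TriangularRows (d : I → ℕ) (c : I → J → ℤ) (E : Fin M → Finset ℕ) : Prop :=
  ∀ j : Fin M → J, Function.Injective j → ∀ b, ∀ e ∈ E b, ∀ u : Fin M → ℤ,
    (∀ i, d i = e → ∑ b', c i (j b') * u b' = 0) → (∀ b', b < b' → u b' = 0) → u b = 0

theorem TriangularRows.integral_le {E : Fin M → Finset ℕ} (hT : TriangularRows d c E)
    (v : Fin M → ℕ) {j : Fin M → J} (hj : Function.Injective j) (P Q : ℕ) :
    ∫ α in arcCube I Q, ∏ b, ‖normSum d P (linForm c (j b) α)‖ ^ (2 * v b)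
      ≤ ∏ b, ((P : ℝ)⁻¹ ^ (2 * v b) * energy (Icc 1 P) (v b) (E b)) := by
  have h1 : ∀ α, ∏ b, ‖normSum d P (linForm c (j b) α)‖ ^ (2 * v b)
      = (∏ b, (P : ℝ)⁻¹ ^ (2 * v b)) * ∏ b, ‖∑ x ∈ Icc 1 P,
        eC (∑ i, α i * ((fun b (x : ℕ) i => c i (j b) * (x : ℤ) ^ d i) b x i : ℤ))‖ ^ (2 * v b) := by
    intro α
    rw [← Finset.prod_mul_distrib]
    refine Finset.prod_congr rfl fun b _ => ?_
    rw [normSum, norm_mul, norm_inv, Complex.norm_natCast, mul_pow, expSum]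
    congr 3
    refine Finset.sum_congr rfl fun x _ => ?_
    congr 1
    refine Finset.sum_congr rfl fun i _ => ?_
    simp only [linForm]
    push_cast
    ring
  simp_rw [h1]
  rw [integral_const_mul, arcCube, integral_prod_norm_sum_eC_pow, Finset.prod_mul_distrib]
  refine mul_le_mul_of_nonneg_left ?_ (Finset.prod_nonneg fun _ _ => by positivity)
  rw [← Nat.cast_prod]
  refine Nat.cast_le.2 (card_le_prod_of_fibers _ _ fun b z hz => ?_)
  refine (Finset.card_le_card fun w hw => ?_).trans (card_powerSum_sub_eq_le (Icc 1 P) (v b) (E b)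
    fun e => ∑ m, ((z b).1 m : ℤ) ^ e - ∑ m, ((z b).2 m : ℤ) ^ e)
  obtain ⟨z', hz', rfl⟩ := mem_image.1 hw
  obtain ⟨hz1, hz2⟩ := mem_filter.1 hz'
  obtain ⟨hz3, hz4⟩ := mem_filter.1 hz1
  refine mem_filter.2 ⟨Fintype.mem_piFinset.1 hz3 b, fun e he => ?_⟩
  rw [← sub_eq_zero]
  refine hT j hj b e he (fun b' => (∑ m, ((z' b').1 m : ℤ) ^ e - ∑ m, ((z' b').2 m : ℤ) ^ e)
    - (∑ m, ((z b').1 m : ℤ) ^ e - ∑ m, ((z b').2 m : ℤ) ^ e)) (fun i hi => ?_)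
    fun b' hb' => by rw [hz2 b' hb', sub_self]
  have e1 := hz4 i
  have e2 := (mem_filter.1 hz).2 i
  simp only [← Finset.mul_sum, ← mul_sub, hi] at e1 e2
  simp only [mul_sub, Finset.sum_sub_distrib] at e1 e2 ⊢
  rw [e1, e2, sub_zero]

/-- Mean value bounds yield a power saving on the minor arcs. -/
theorem minorArcBound_of_energy (hd : ∀ i, 0 < d i) (hc : RowsSeparated d c) {v : Fin M → ℕ}
    (hv : ∀ b, 0 < v b) (hs : 2 * ∑ b, v b < Fintype.card J) {E : Fin M → Finset ℕ}
    (hT : TriangularRows d c E) (hK : ∑ b, ∑ e ∈ E b, e = ∑ i, d i)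
    (hE : ∀ b, ∀ ε : ℝ, 0 < ε → ∃ C : ℝ, ∀ P : ℕ, 1 ≤ P → (energy (Icc 1 P) (v b) (E b) : ℝ)
      ≤ C * (P : ℝ) ^ ((2 * v b : ℝ) - ((∑ e ∈ E b, e : ℕ) : ℝ) + ε)) :
    MinorArcBound d c := by
  obtain ⟨δ, hδ, hev⟩ := hc.exists_normSum_lt hd
  obtain ⟨P₀, hP₀⟩ := eventually_atTop.1 hev
  set ε : ℝ := δ / (2 * (M + 1)) with hε
  have hε0 : 0 < ε := by positivity
  choose C hC using fun b => hE b ε hε0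
  set S : Finset (Fin M → J) := univ.filter Function.Injective with hS
  refine ⟨δ / 2, by positivity, #S * ∏ b, |C b|, max P₀ 1, fun Q hQ P hQP hPQ => ?_⟩
  have hQ1 : 1 ≤ Q := (le_max_right _ _).trans hQ
  have hQP' : Q ≤ P := (Nat.le_self_pow (by omega) Q).trans hQP
  have hP1 : (1 : ℝ) ≤ P := by exact_mod_cast hQ1.trans hQP'
  have hP0 : (0 : ℝ) < P := by linarith
  have hminor := hP₀ P ((le_max_left _ _).trans (hQ.trans hQP')) Q hQP hPQ
  have hcontF : ∀ j, Continuous fun α => ‖normSum d P (linForm c j α)‖ := fun j =>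
    ((continuous_normSum d P).comp (continuous_linForm c j)).norm
  have hcontG : ∀ j : Fin M → J, Continuous fun α =>
      ∏ b, ‖normSum d P (linForm c (j b) α)‖ ^ (2 * v b) := fun j =>
    continuous_finsetProd _ fun b _ => (hcontF (j b)).pow _
  have hpt : ∀ α ∈ arcCube I Q \ majArcs d P Q, ‖prodSum d c P α‖ ≤ (P : ℝ) ^ (-δ) *
      ∑ j ∈ S, ∏ b, ‖normSum d P (linForm c (j b) α)‖ ^ (2 * v b) := fun α hα => by
    obtain ⟨j₀, hj₀⟩ := hminor α hα
    rw [prodSum, norm_prod]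
    refine (prod_le_mul_sum_injective hv hs (fun j => norm_nonneg _)
      (fun j => norm_normSum_le _ _ _) j₀).trans ?_
    exact mul_le_mul_of_nonneg_right hj₀.le
      (Finset.sum_nonneg fun _ _ => Finset.prod_nonneg fun _ _ => by positivity)
  have hmean : ∀ j ∈ S, ∫ α in arcCube I Q, ∏ b, ‖normSum d P (linForm c (j b) α)‖ ^ (2 * v b)
      ≤ (∏ b, |C b|) * (P : ℝ) ^ (M * ε - ((∑ i, d i : ℕ) : ℝ)) := fun j hj => by
    refine (hT.integral_le v (mem_filter.1 hj).2 P Q).trans ?_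
    have hb : ∀ b, (P : ℝ)⁻¹ ^ (2 * v b) * energy (Icc 1 P) (v b) (E b)
        ≤ |C b| * (P : ℝ) ^ (ε - ((∑ e ∈ E b, e : ℕ) : ℝ)) := fun b => by
      have h1 := (hC b P (by exact_mod_cast hP1)).trans
        (mul_le_mul_of_nonneg_right (le_abs_self _) (by positivity))
      refine (mul_le_mul_of_nonneg_left h1 (by positivity)).trans (le_of_eq ?_)
      have e1 : (P : ℝ)⁻¹ ^ (2 * v b) = (P : ℝ) ^ (-(2 * v b : ℝ)) := by
        rw [Real.rpow_neg hP0.le, inv_pow, ← Real.rpow_natCast]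
        push_cast
        rfl
      rw [e1, mul_left_comm, ← Real.rpow_add hP0]
      congr 2
      ring
    refine (Finset.prod_le_prod (fun b _ => by positivity) fun b _ => hb b).trans (le_of_eq ?_)
    rw [Finset.prod_mul_distrib, ← Real.rpow_sum_of_pos hP0, Finset.sum_sub_distrib,
      ← Nat.cast_sum, hK]
    simp
  have hint : ∀ j : Fin M → J, IntegrableOn
      (fun α => ∏ b, ‖normSum d P (linForm c (j b) α)‖ ^ (2 * v b)) (arcCube I Q) := fun j =>
    integrableOn_cube_of_bounded (hcontG j) subset_rfl
  have hcontS : Continuous fun α => (P : ℝ) ^ (-δ) *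
      ∑ j ∈ S, ∏ b, ‖normSum d P (linForm c (j b) α)‖ ^ (2 * v b) :=
    continuous_const.mul (continuous_finsetSum _ fun j _ => hcontG j)
  have hmeas : MeasurableSet (arcCube I Q \ majArcs d P Q) :=
    (measurableSet_cube _ _).diff (measurableSet_majArcs P Q)
  have hI : (∫ α in arcCube I Q \ majArcs d P Q, ‖prodSum d c P α‖)
      ≤ (P : ℝ) ^ (-δ) * (#S * ((∏ b, |C b|) * (P : ℝ) ^ (M * ε - ((∑ i, d i : ℕ) : ℝ)))) := by
    calc _ ≤ ∫ α in arcCube I Q \ majArcs d P Q, (P : ℝ) ^ (-δ) *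
          ∑ j ∈ S, ∏ b, ‖normSum d P (linForm c (j b) α)‖ ^ (2 * v b) :=
          setIntegral_mono_on
            (integrableOn_cube_of_bounded (continuous_prodSum d c P).norm Set.sdiff_subset)
            (integrableOn_cube_of_bounded hcontS Set.sdiff_subset) hmeas hpt
      _ ≤ ∫ α in arcCube I Q, (P : ℝ) ^ (-δ) *
          ∑ j ∈ S, ∏ b, ‖normSum d P (linForm c (j b) α)‖ ^ (2 * v b) :=
          setIntegral_mono_set (integrableOn_cube_of_bounded hcontS subset_rfl)
            (Eventually.of_forall fun α => mul_nonneg (by positivity)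
              (Finset.sum_nonneg fun _ _ => Finset.prod_nonneg fun _ _ => by positivity))
            (Eventually.of_forall Set.sdiff_subset)
      _ ≤ _ := by
        rw [integral_const_mul, integral_finsetSum _ fun j _ => hint j]
        refine mul_le_mul_of_nonneg_left ?_ (by positivity)
        refine (Finset.sum_le_sum hmean).trans (le_of_eq ?_)
        rw [Finset.sum_const, nsmul_eq_mul]
  refine (mul_le_mul_of_nonneg_left hI (by positivity)).trans ?_
  have e : (P : ℝ) ^ (∑ i, d i) * ((P : ℝ) ^ (-δ) *
      (#S * ((∏ b, |C b|) * (P : ℝ) ^ (M * ε - ((∑ i, d i : ℕ) : ℝ)))))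
      = #S * (∏ b, |C b|) * (P : ℝ) ^ (M * ε - δ) := by
    have : (P : ℝ) ^ (M * ε - δ) = (P : ℝ) ^ (∑ i, d i) * (P : ℝ) ^ (-δ)
        * (P : ℝ) ^ (M * ε - ((∑ i, d i : ℕ) : ℝ)) := by
      rw [← Real.rpow_natCast, ← Real.rpow_add hP0, ← Real.rpow_add hP0]
      congr 1
      ring
    rw [this]
    ring
  rw [e]
  refine mul_le_mul_of_nonneg_left ?_ (by positivity)
  have hMε : M * ε - δ ≤ -(δ / 2) := by
    have : (M : ℝ) * ε ≤ δ / 2 := by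
      rw [hε, mul_div_assoc', div_le_div_iff₀ (by positivity) (by positivity)]
      nlinarith
    linarith
  calc (P : ℝ) ^ (M * ε - δ) ≤ (P : ℝ) ^ (-(δ / 2)) :=
        Real.rpow_le_rpow_of_exponent_le hP1 hMε
    _ ≤ (Q : ℝ) ^ (-(δ / 2)) := by
      have hQR : (0 : ℝ) < Q := by exact_mod_cast hQ1
      exact Real.rpow_le_rpow_of_nonpos hQR (by exact_mod_cast hQP') (by linarith)

end MeanValue

section MeanValue

theorem norm_normSum_neg {I : Type*} [Fintype I] (d : I → ℕ) (P : ℕ) (γ : I → ℝ) :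
    ‖normSum d P (-γ)‖ = ‖normSum d P γ‖ := by
  have : expSum d P (-γ) = (starRingEnd ℂ) (expSum d P γ) := by
    rw [expSum, expSum, map_sum]
    refine Finset.sum_congr rfl fun x _ => ?_
    rw [← eC_neg]
    congr 1
    simp [phase]
  rw [normSum, normSum, norm_mul, norm_mul, this, RCLike.norm_conj]

theorem solCount_eq_energy (E : Finset ℕ) (v P : ℕ) :
    solCount (fun e : E => (e : ℕ)) (fun _ : E => Sum.elim (fun _ : Fin v => 1) fun _ : Fin v => -1)
      P = energy (Icc 1 P) v E := by
  refine Finset.card_equiv (Equiv.sumArrowEquivProdArrow (Fin v) (Fin v) ℕ) fun x => ?_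
  simp only [mem_filter, Fintype.mem_piFinset, Finset.mem_product, Sum.forall, Subtype.forall,
    Fintype.sum_sum_type, Sum.elim_inl, Sum.elim_inr, one_mul, neg_mul, Finset.sum_neg_distrib,
    add_neg_eq_zero]
  rfl

theorem exists_energy_le (E : Finset ℕ) (hE : ∀ e ∈ E, 0 < e) :
    ∃ v, ∑ e ∈ E, e ≤ 2 * v ∧ ∃ C : ℝ, ∀ P : ℕ, 1 ≤ P →
      (energy (Icc 1 P) v E : ℝ) ≤ C * (P : ℝ) ^ ((2 * v : ℝ) - ((∑ e ∈ E, e : ℕ) : ℝ)) := by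
  set d : E → ℕ := fun e => e with hd
  have hd0 : ∀ e, 0 < d e := fun e => hE e e.2
  have hdK : ∑ e, d e = ∑ e ∈ E, e := Finset.sum_coe_sort E fun e => e
  set K := ∑ e ∈ E, e with hK
  have hsep : RowsSeparated d fun (_ : E) (_ : Unit) => 1 :=
    ⟨1, one_pos, fun _ _ => 1, fun i i' h => by simp [Subtype.ext h]⟩
  obtain ⟨δ, hδ, hev⟩ := hsep.exists_normSum_lt hd0
  obtain ⟨P₀, hP₀⟩ := eventually_atTop.1 hev
  obtain ⟨v₀, hv₀⟩ := exists_nat_ge ((K + 1) / δ)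
  set v := v₀ + K with hv
  have hvδ : (K + 1 : ℝ) ≤ δ * (2 * v : ℕ) := by
    rw [div_le_iff₀ hδ] at hv₀
    have : (v₀ : ℝ) ≤ (2 * v : ℕ) := by exact_mod_cast (by omega : v₀ ≤ 2 * v)
    nlinarith
  set c : E → Fin v ⊕ Fin v → ℤ := fun _ => Sum.elim (fun _ => 1) fun _ => -1 with hc
  have hmin : MinorArcBound d c := by
    refine ⟨1, one_pos, 1, max P₀ 1, fun Q hQ P hQP hPQ => ?_⟩
    have hQ1 : 1 ≤ Q := (le_max_right _ _).trans hQ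
    have hQP' : Q ≤ P := (Nat.le_self_pow (by omega) Q).trans hQP
    have hP1 : (1 : ℝ) ≤ P := by exact_mod_cast hQ1.trans hQP'
    have hP0 : (0 : ℝ) < P := by linarith
    have hminor := hP₀ P ((le_max_left _ _).trans (hQ.trans hQP')) Q hQP hPQ
    have hpt : ∀ α ∈ arcCube E Q \ majArcs d P Q, ‖prodSum d c P α‖ ≤ (P : ℝ) ^ (-(K + 1 : ℝ)) := by
      intro α hα
      obtain ⟨j, hj⟩ := hminor α hα
      have e1 : linForm (fun (_ : E) (_ : Unit) => 1) j α = α := by ext; simp [linForm]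
      rw [e1] at hj
      have e2 : ∀ j, linForm c (Sum.inl j) α = α := fun j => by ext; simp [linForm, hc]
      have e3 : ∀ j, linForm c (Sum.inr j) α = -α := fun j => by ext; simp [linForm, hc]
      have e4 : ‖prodSum d c P α‖ = ‖normSum d P α‖ ^ (2 * v) := by
        rw [prodSum, norm_prod, Fintype.prod_sum_type]
        simp_rw [e2, e3, norm_normSum_neg]
        simp [two_mul, pow_add]
      rw [e4]
      calc ‖normSum d P α‖ ^ (2 * v) ≤ ((P : ℝ) ^ (-δ)) ^ (2 * v) := by gcongr
        _ = (P : ℝ) ^ (-(δ * (2 * v : ℕ))) := by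
          rw [← Real.rpow_natCast, ← Real.rpow_mul hP0.le, neg_mul]
        _ ≤ _ := Real.rpow_le_rpow_of_exponent_le hP1 (by linarith)
    have hvol : volume (arcCube E Q \ majArcs d P Q) ≤ 1 := by
      refine (measure_mono Set.sdiff_subset).trans ?_
      rw [arcCube, volume_pi_pi]
      simp
    have hI : (∫ α in arcCube E Q \ majArcs d P Q, ‖prodSum d c P α‖)
        ≤ (P : ℝ) ^ (-(K + 1 : ℝ)) := by
      have := norm_setIntegral_le_of_norm_le_const (f := fun α => ‖prodSum d c P α‖)
        (hvol.trans_lt ENNReal.one_lt_top) fun α hα => by rw [norm_norm]; exact hpt α hα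
      refine (le_abs_self _).trans (this.trans ?_)
      refine mul_le_of_le_one_right (by positivity) ?_
      exact ENNReal.toReal_le_of_le_ofReal zero_le_one (by simpa using hvol)
    refine (mul_le_mul_of_nonneg_left hI (by positivity)).trans ?_
    rw [hdK, ← Real.rpow_natCast, ← Real.rpow_add hP0, one_mul,
      show (K : ℝ) + -(K + 1) = -1 by ring, Real.rpow_neg_one, Real.rpow_neg_one]
    have : (0 : ℝ) < Q := by exact_mod_cast hQ1
    gcongr
  refine ⟨v, by omega, ?_⟩
  obtain ⟨C, hC⟩ := (Metric.isBounded_range_of_tendsto _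
    (hmin.tendsto_solCount hd0)).exists_norm_le
  refine ⟨C, fun P hP => ?_⟩
  have hP0 : (0 : ℝ) < P := by exact_mod_cast hP
  have := hC _ ⟨P, rfl⟩
  simp only [hd, hc, solCount_eq_energy] at this
  rw [norm_mul, norm_mul, norm_inv, norm_pow, norm_pow, Complex.norm_natCast,
    Complex.norm_natCast] at this
  have hpow : (P : ℝ) ^ ((2 * v : ℝ) - (K : ℝ))
      = (P : ℝ) ^ Fintype.card (Fin v ⊕ Fin v) / (P : ℝ) ^ (∑ e : E, (e : ℕ)) := by
    rw [Real.rpow_sub hP0, hdK, Real.rpow_natCast]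
    congr 1
    rw [← Real.rpow_natCast]
    congr 1
    simp [two_mul]
  rw [hpow]
  have h1 : (0 : ℝ) < (P : ℝ) ^ Fintype.card (Fin v ⊕ Fin v) := by positivity
  have h2 : (0 : ℝ) < (P : ℝ) ^ (∑ e : E, (e : ℕ)) := by positivity
  rw [mul_div_assoc', le_div_iff₀ h2]
  rw [← mul_assoc, mul_comm, ← mul_assoc, mul_inv_le_iff₀ h1] at this
  exact this

theorem pos_of_energy_le {E : Finset ℕ} {v : ℕ} (hK : 0 < ∑ e ∈ E, e)
    (h : ∀ ε : ℝ, 0 < ε → ∃ C : ℝ, ∀ P : ℕ, 1 ≤ P → (energy (Icc 1 P) v E : ℝ)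
      ≤ C * (P : ℝ) ^ ((2 * v : ℝ) - ((∑ e ∈ E, e : ℕ) : ℝ) + ε)) : 0 < v := by
  rcases Nat.eq_zero_or_pos v with rfl | hv
  · exfalso
    obtain ⟨C, hC⟩ := h (1 / 2) (by norm_num)
    have h1 : ∀ P : ℕ, 1 ≤ P → (1 : ℝ) ≤ |C| * (P : ℝ) ^ (-(1 / 2 : ℝ)) := fun P hP => by
      have hP1 : (1 : ℝ) ≤ P := by exact_mod_cast hP
      have hK' : (1 : ℝ) ≤ ((∑ e ∈ E, e : ℕ) : ℝ) := by exact_mod_cast hK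
      have := hC P hP
      have he : energy (Icc 1 P) 0 E = 1 := by
        rw [energy, Finset.filter_true_of_mem fun w _ e _ => by simp]
        simp
      rw [he, Nat.cast_one] at this
      refine this.trans (mul_le_mul (le_abs_self _) ?_ (by positivity) (abs_nonneg _))
      refine Real.rpow_le_rpow_of_exponent_le hP1 ?_
      push_cast at hK' ⊢
      linarith
    have h2 : Tendsto (fun P : ℕ => |C| * (P : ℝ) ^ (-(1 / 2 : ℝ))) atTop (nhds (|C| * 0)) :=
      ((tendsto_rpow_neg_atTop (by norm_num)).comp tendsto_natCast_atTop_atTop).const_mul _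
    have := ge_of_tendsto h2 ((eventually_ge_atTop 1).mono h1)
    norm_num at this
  · exact hv

variable {t : ℕ} {ν : Fin t → ℕ} {k : (l : Fin t) → Fin (ν l) → ℕ}

/-- The exponents occurring in the first `h` groups. -/
def expSet (t : ℕ) (ν : Fin t → ℕ) (k : (l : Fin t) → Fin (ν l) → ℕ) (h : ℕ) : Finset ℕ :=
  ({p : KIdx t ν | (p.1 : ℕ) < h} : Finset (KIdx t ν)).image fun p => k p.1 p.2

theorem sum_expSet (hinj : Function.Injective fun p : KIdx t ν => k p.1 p.2) (h : ℕ) :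
    ∑ e ∈ expSet t ν k h, e = Ksum t ν k h := by
  rw [expSet, Finset.sum_image fun _ _ _ _ h => hinj h, Ksum, Finset.sum_filter]

theorem JA_eq_energy (A : Finset ℕ) (v h : ℕ) :
    JA t ν k A v h = energy A v (expSet t ν k h) := by
  have key := integral_prod_norm_sum_eC_pow (β := Unit) (I := KIdx t ν) A
    (fun _ x p => if (p.1 : ℕ) < h then (x : ℤ) ^ k p.1 p.2 else 0) (fun _ => v) 0
  have hf : ∀ γ : KIdx t ν → ℝ, fA t ν k A h γ = ∑ x ∈ A, eC (∑ p : KIdx t ν, γ p *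
      ((if (p.1 : ℕ) < h then (x : ℤ) ^ k p.1 p.2 else 0 : ℤ) : ℝ)) := fun γ => by
    refine Finset.sum_congr rfl fun x _ => ?_
    congr 1
    refine Finset.sum_congr rfl fun p _ => ?_
    split_ifs <;> simp
  simp only [univ_unique, Finset.prod_singleton, Pi.zero_apply, zero_add, Finset.sum_singleton]
    at key
  rw [JA]
  simp_rw [hf]
  rw [key, Nat.cast_inj]
  refine Finset.card_equiv (Equiv.funUnique Unit _) fun z => ?_
  simp only [mem_filter, Fintype.mem_piFinset, Equiv.funUnique_apply, expSet,
    Finset.forall_mem_image, mem_univ, true_and, sub_eq_zero]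
  refine and_congr ?_ ?_
  · exact ⟨fun h => h _, fun h _ => h⟩
  · refine forall_congr' fun p => ?_
    by_cases hp : (p.1 : ℕ) < h
    · simp only [hp, if_true, forall_const]
    · simp [hp]

theorem v0_spec (hinj : Function.Injective fun p : KIdx t ν => k p.1 p.2)
    (hk : ∀ l n, 0 < k l n) (h : ℕ) (ε : ℝ) (hε : 0 < ε) :
    ∃ C : ℝ, ∀ P : ℕ, 1 ≤ P → (energy (Icc 1 P) (v0 t ν k h) (expSet t ν k h) : ℝ)
      ≤ C * (P : ℝ) ^ ((2 * v0 t ν k h : ℝ) - ((∑ e ∈ expSet t ν k h, e : ℕ) : ℝ) + ε) := by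
  have hne : {v : ℕ | ∀ ε : ℝ, 0 < ε → ∃ C : ℝ, ∀ P : ℝ, 1 ≤ P →
      JA t ν k (completeFS P) v h ≤ C * P ^ ((2 * v : ℝ) - (Ksum t ν k h : ℝ) + ε)}.Nonempty := by
    obtain ⟨v, hv, C, hC⟩ := exists_energy_le (expSet t ν k h) fun e he => by
      obtain ⟨p, -, rfl⟩ := Finset.mem_image.1 he
      exact hk _ _
    refine ⟨v, fun ε hε => ⟨|C|, fun P hP => ?_⟩⟩
    rw [JA_eq_energy, completeFS]
    have hN : 1 ≤ ⌊P⌋₊ := Nat.le_floor (by exact_mod_cast hP)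
    have hN1 : (1 : ℝ) ≤ ⌊P⌋₊ := by exact_mod_cast hN
    have hv' : (0 : ℝ) ≤ (2 * v : ℝ) - ((∑ e ∈ expSet t ν k h, e : ℕ) : ℝ) := by
      have : ((∑ e ∈ expSet t ν k h, e : ℕ) : ℝ) ≤ (2 * v : ℕ) := by exact_mod_cast hv
      push_cast at this ⊢
      linarith
    refine (hC _ hN).trans (mul_le_mul (le_abs_self _) ?_ (by positivity) (abs_nonneg _))
    rw [← sum_expSet hinj]
    exact (Real.rpow_le_rpow (by positivity) (Nat.floor_le (by linarith)) hv').trans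
      (Real.rpow_le_rpow_of_exponent_le hP (by linarith))
  have hmem := Nat.sInf_mem hne
  rw [← v0] at hmem
  obtain ⟨C, hC⟩ := hmem ε hε
  refine ⟨C, fun P hP => ?_⟩
  have := hC P (by exact_mod_cast hP)
  rwa [JA_eq_energy, completeFS, Nat.floor_natCast, ← sum_expSet hinj] at this

theorem v0_pos {μ : Fin t → ℕ} (hG : GroupedDegrees t ν μ k) {h : ℕ} (hh : 0 < h) : 0 < v0 t ν k h := by
  obtain ⟨ht, hν, -, -, hk, hinj⟩ := hG
  refine pos_of_energy_le (E := expSet t ν k h) ?_ (v0_spec hinj hk h)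
  set p : KIdx t ν := ⟨⟨0, ht⟩, ⟨0, hν _⟩⟩ with hp
  refine (hk p.1 p.2).trans_le (Finset.single_le_sum (f := fun e => e) (fun _ _ => Nat.zero_le _)
    (Finset.mem_image.2 ⟨p, ?_, rfl⟩))
  simp [hp, hh]

end MeanValue

section System

variable {t : ℕ} {ν μ : Fin t → ℕ} {k : (l : Fin t) → Fin (ν l) → ℕ} {s : ℕ}
  {c : EqIdx t ν μ → Fin s → ℤ}

/-- The number of groups of multiplicity greater than `b`. -/
def groupCount (μ : Fin t → ℕ) (b : ℕ) : ℕ := #{l | b < μ l}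

theorem lt_groupCount (hμ : StrictAnti μ) (b : ℕ) (l : Fin t) :
    (l : ℕ) < groupCount μ b ↔ b < μ l := by
  constructor
  · intro h
    by_contra hb
    have : ({l | b < μ l} : Finset (Fin t)) ⊆ Finset.Iio l := fun l' hl' => by
      rw [mem_filter] at hl'
      rw [Finset.mem_Iio]
      by_contra hlt
      exact hb (hl'.2.trans_le (hμ.antitone (not_lt.1 hlt)))
    have := Finset.card_le_card this
    rw [Fin.card_Iio] at this
    exact absurd h (not_lt.2 this)
  · intro h
    have : Finset.Iic l ⊆ ({l | b < μ l} : Finset (Fin t)) := fun l' hl' => by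
      rw [mem_filter]
      exact ⟨mem_univ _, h.trans_le (hμ.antitone (Finset.mem_Iic.1 hl'))⟩
    have := Finset.card_le_card this
    rw [Fin.card_Iic] at this
    exact this

theorem le_groupCount (hμ : StrictAnti μ) (b : ℕ) {h : ℕ} (hh : 1 ≤ h) :
    h ≤ groupCount μ b ↔ b < mu1 t μ h := by
  rw [mu1]
  split_ifs with ht
  · rw [← lt_groupCount hμ]
    simp only
    omega
  · have : groupCount μ b ≤ t := (Finset.card_le_univ _).trans (by simp)
    omega

theorem le_mu1_one (hμ : StrictAnti μ) (l : Fin t) : μ l ≤ mu1 t μ 1 := by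
  have ht : 0 < t := l.pos
  rw [mu1, dif_pos ⟨le_rfl, ht⟩]
  exact hμ.antitone (Fin.mk_le_of_le_val (Nat.zero_le _))

theorem mu1_succ_le (hμ : StrictAnti μ) {h : ℕ} (hh : 1 ≤ h) : mu1 t μ (h + 1) ≤ mu1 t μ h := by
  by_contra! hlt
  have h1 := (le_groupCount hμ (mu1 t μ h) (h := h + 1) (by omega)).2 hlt
  exact lt_irrefl _ ((le_groupCount hμ (mu1 t μ h) hh).1 (by omega))

theorem sum_groupCount (hμ : StrictAnti μ) (f : ℕ → ℝ) :
    ∑ b : Fin (mu1 t μ 1), f (groupCount μ b)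
      = ∑ h ∈ Icc 1 t, ((mu1 t μ h : ℝ) - mu1 t μ (h + 1)) * f h := by
  rw [← Finset.sum_fiberwise_of_maps_to (s := univ) (t := Icc 1 t)
    (g := fun b : Fin (mu1 t μ 1) => groupCount μ b) fun b _ => mem_Icc.2
      ⟨(le_groupCount hμ b le_rfl).2 b.2, (Finset.card_le_univ _).trans (by simp)⟩]
  refine Finset.sum_congr rfl fun h hh => ?_
  have h1 := (mem_Icc.1 hh).1
  rw [Finset.sum_congr rfl fun b hb => by rw [(mem_filter.1 hb).2], Finset.sum_const, nsmul_eq_mul,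
    ← Nat.cast_sub (mu1_succ_le hμ h1)]
  congr 2
  rw [← Nat.card_Ico, ← Finset.card_map Fin.valEmbedding]
  congr 1
  ext b
  simp only [Finset.mem_map, mem_filter, mem_univ, true_and, Fin.valEmbedding_apply, mem_Ico]
  have e1 := le_groupCount hμ b h1
  have e2 := le_groupCount hμ b (h := h + 1) (by omega)
  have e3 := le_groupCount hμ b (h := 1) le_rfl
  constructor
  · rintro ⟨b', hb', rfl⟩
    omega
  · intro hb
    exact ⟨⟨b, by omega⟩, by simp only; omega, rfl⟩

theorem sum_sum_expSet (hG : GroupedDegrees t ν μ k) :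
    ∑ b : Fin (mu1 t μ 1), ∑ e ∈ expSet t ν k (groupCount μ b), e
      = ∑ i, deg t ν μ k i := by
  obtain ⟨-, -, -, hμ, -, hinj⟩ := hG
  simp_rw [sum_expSet hinj, Ksum, lt_groupCount hμ]
  rw [Finset.sum_comm, Fintype.sum_sigma, Fintype.sum_sigma]
  refine Finset.sum_congr rfl fun l _ => ?_
  rw [Fintype.sum_prod_type]
  refine Finset.sum_congr rfl fun n _ => ?_
  simp only [deg, Finset.sum_const, ← Finset.sum_filter, smul_eq_mul]
  congr 1
  have hM := le_mu1_one hμ l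
  rw [Finset.card_univ, Fintype.card_fin, ← Finset.card_map Fin.valEmbedding]
  conv_rhs => rw [← Finset.card_range (μ l)]
  congr 1
  ext b
  simp only [Finset.mem_map, mem_filter, mem_univ, true_and, Fin.valEmbedding_apply, mem_range]
  constructor
  · rintro ⟨b', hb', rfl⟩
    exact hb'
  · intro hb
    exact ⟨⟨b, by omega⟩, hb, rfl⟩

theorem HighlyNonSingular.rowsSeparated (hns : HighlyNonSingular t ν μ s c)
    (hinj : Function.Injective fun p : KIdx t ν => k p.1 p.2) (hs : ∀ l, μ l ≤ s) :
    RowsSeparated (deg t ν μ k) c := by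
  set A : (p : KIdx t ν) → Matrix (Fin (μ p.1)) (Fin (μ p.1)) ℤ := fun p =>
    Matrix.of fun m m' => c ⟨p.1, (p.2, m)⟩ (Fin.castLE (hs p.1) m') with hA
  have hdet : ∀ p, (A p).det ≠ 0 := fun p => hns.2 p.1 p.2 _ (Fin.castLE_injective _)
  set D : ℕ := ∏ p, (A p).det.natAbs with hD
  have hdvd : ∀ p, ∃ q : ℤ, (D : ℤ) = (A p).det * q := fun p =>
    Int.natAbs_dvd.1 (Int.natCast_dvd_natCast.2 (Finset.dvd_prod_of_mem _ (mem_univ p)))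
  choose q hq using hdvd
  refine ⟨D, Finset.prod_pos fun p _ => Int.natAbs_pos.2 (hdet p), fun i j =>
    q ⟨i.1, i.2.1⟩ * ∑ m', if Fin.castLE (hs i.1) m' = j then
      (A ⟨i.1, i.2.1⟩).adjugate m' i.2.2 else 0, ?_⟩
  rintro ⟨l, n, m⟩ ⟨l', n', m'⟩ h
  obtain ⟨rfl, hn⟩ := Sigma.mk.inj_iff.1 (@hinj ⟨l', n'⟩ ⟨l, n⟩ h)
  obtain rfl := eq_of_heq hn
  have key : ∑ m'', A ⟨l', n'⟩ m' m'' * (A ⟨l', n'⟩).adjugate m'' m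
      = if m' = m then (A ⟨l', n'⟩).det else 0 := by
    rw [← Matrix.mul_apply, Matrix.mul_adjugate, Matrix.smul_apply, Matrix.one_apply]
    simp
  simp only [mul_assoc, Finset.sum_mul, ← Finset.mul_sum, ite_mul, zero_mul]
  rw [Finset.sum_comm]
  simp only [Finset.sum_ite_eq, mem_univ, if_true]
  have e : ∑ m'', (A ⟨l', n'⟩).adjugate m'' m * c ⟨l', n', m'⟩ (Fin.castLE (hs l') m'')
      = if m' = m then (A ⟨l', n'⟩).det else 0 := by
    rw [← key]
    exact Finset.sum_congr rfl fun _ _ => mul_comm _ _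
  rw [e]
  by_cases hm : m' = m
  · subst hm
    simp [hq ⟨l', n'⟩, mul_comm]
  · simp [hm]

theorem HighlyNonSingular.triangularRows (hns : HighlyNonSingular t ν μ s c)
    (hG : GroupedDegrees t ν μ k) :
    TriangularRows (deg t ν μ k) c
      fun b : Fin (mu1 t μ 1) => expSet t ν k (groupCount μ b) := by
  obtain ⟨-, -, -, hμ, -, -⟩ := hG
  intro j hj b e he u hu hb
  obtain ⟨⟨l, n⟩, hp, rfl⟩ := Finset.mem_image.1 he
  simp only [mem_filter, mem_univ, true_and, lt_groupCount hμ] at hp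
  have hM := le_mu1_one hμ l
  have h0 : (Matrix.of fun m m' : Fin (μ l) => c ⟨l, (n, m)⟩ (j (Fin.castLE hM m'))).mulVec
      (fun m' => u (Fin.castLE hM m')) = 0 := by
    ext m
    rw [Matrix.mulVec, dotProduct, Pi.zero_apply, ← hu ⟨l, (n, m)⟩ rfl]
    refine Finset.sum_of_injOn (Fin.castLE hM) (Fin.castLE_injective _).injOn
      (fun _ _ => Finset.mem_coe.2 (mem_univ _)) ?_
      fun _ _ => rfl
    intro b' _ hb'
    rw [hb b', mul_zero]
    by_contra hlt
    refine hb' ⟨⟨b', ?_⟩, by simp, rfl⟩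
    have : (b' : ℕ) ≤ b := not_lt.1 hlt
    omega
  exact congrFun (Matrix.eq_zero_of_mulVec_eq_zero
    (hns.2 l n _ (hj.comp (Fin.castLE_injective _))) h0) ⟨b, hp⟩

theorem HighlyNonSingular.minorArcBound (hns : HighlyNonSingular t ν μ s c)
    (hG : GroupedDegrees t ν μ k) {w : ℕ → ℝ} (hw : ∀ h, (v0 t ν k h : ℝ) ≤ w h)
    (hs : 2 * (∑ h ∈ Icc 1 t, ((mu1 t μ h : ℝ) - mu1 t μ (h + 1)) * w h) + 1 ≤ (s : ℝ)) :
    MinorArcBound (deg t ν μ k) c := by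
  have hG' := hG
  obtain ⟨-, -, -, hμ, hk, hinj⟩ := hG'
  have hpos : ∀ b : Fin (mu1 t μ 1), 0 < v0 t ν k (groupCount μ b) := fun b =>
    v0_pos hG ((le_groupCount hμ b le_rfl).2 b.2)
  have hsum : 2 * ∑ b : Fin (mu1 t μ 1), v0 t ν k (groupCount μ b) < s := by
    have h1 : ((∑ b : Fin (mu1 t μ 1), v0 t ν k (groupCount μ b) : ℕ) : ℝ)
        ≤ ∑ h ∈ Icc 1 t, ((mu1 t μ h : ℝ) - mu1 t μ (h + 1)) * w h := by
      rw [Nat.cast_sum, sum_groupCount hμ fun h => (v0 t ν k h : ℝ)]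
      refine Finset.sum_le_sum fun h hh => mul_le_mul_of_nonneg_left (hw h) (sub_nonneg.2 ?_)
      exact_mod_cast mu1_succ_le hμ (mem_Icc.1 hh).1
    have h2 : ((2 * ∑ b : Fin (mu1 t μ 1), v0 t ν k (groupCount μ b) + 1 : ℕ) : ℝ) ≤ s := by
      push_cast at h1 ⊢
      linarith
    exact_mod_cast h2
  have hle : ∀ l, μ l ≤ s := fun l => by
    have h1 : ∑ b : Fin (mu1 t μ 1), 1 ≤ ∑ b : Fin (mu1 t μ 1), v0 t ν k (groupCount μ b) :=
      Finset.sum_le_sum fun b _ => hpos b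
    have hM := le_mu1_one hμ l
    simp only [Finset.sum_const, Finset.card_univ, Fintype.card_fin, smul_eq_mul, mul_one] at h1
    omega
  exact minorArcBound_of_energy (fun i => hk _ _) (hns.rowsSeparated hinj hle) hpos (by simpa)
    (hns.triangularRows hG) (sum_sum_expSet hG) fun b => v0_spec hinj hk _

end System

section Jacobian

variable {I J : Type*} [Fintype J] (d : I → ℕ) (c : I → J → ℤ)

/-- The diagonal forms `Σ_j c_{ij} x_j^{d_i}`. -/
def diagForm {R : Type*} [CommRing R] (x : J → R) (i : I) : R := ∑ j, (c i j : R) * x j ^ d i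

/-- The Jacobian matrix of the diagonal forms. -/
def diagJac {R : Type*} [CommRing R] (x : J → R) : Matrix I J R :=
  Matrix.of fun i j => (d i : R) * (c i j : R) * x j ^ (d i - 1)

theorem diagForm_smul {R : Type*} [CommRing R] (a : R) (x : J → R) (i : I) :
    diagForm d c (a • x) i = a ^ d i * diagForm d c x i := by
  simp only [diagForm, Finset.mul_sum, Pi.smul_apply, smul_eq_mul, mul_pow]
  exact Finset.sum_congr rfl fun j _ => by ring

theorem map_diagForm {R S : Type*} [CommRing R] [CommRing S] (f : R →+* S) (x : J → R) (i : I) :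
    f (diagForm d c x i) = diagForm d c (fun j => f (x j)) i := by
  simp [diagForm]

/-- Independent columns of a matrix of full row rank, indexed by the rows. -/
theorem exists_injective_columns [Fintype I] {K : Type*} [Field K] (A : Matrix I J K)
    (hA : A.rank = Fintype.card I) :
    ∃ e : I → J, Function.Injective e ∧ LinearIndependent K fun i => A.col (e i) := by
  obtain ⟨f, hf, -, hli⟩ := Submodule.exists_fun_fin_finrank_span_eq K (Set.range A.col)
  choose g hg using hf
  have hcard := hA.symm.trans A.rank_eq_finrank_span_cols
  have hli' : LinearIndependent K fun i => A.col (g (Fintype.equivFinOfCardEq hcard i)) := by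
    simp only [hg]
    exact hli.comp _ (Fintype.equivFinOfCardEq hcard).injective
  exact ⟨_, fun i i' h => hli'.injective (congrArg A.col h), hli'⟩

/-- The map whose components in `range e` are the diagonal forms, the others being unchanged. -/
def chart (e : I → J) {R : Type*} [CommRing R] (x : J → R) : J → R := fun j =>
  Function.extend e (fun i x => diagForm d c x i) (fun j (x : J → R) => x j) j x

theorem chart_apply {e : I → J} (he : Function.Injective e) {R : Type*} [CommRing R] (x : J → R)
    (i : I) : chart d c e x (e i) = diagForm d c x i := by
  rw [chart, he.extend_apply]

theorem chart_apply_of_notMem {e : I → J} {R : Type*} [CommRing R] (x : J → R) {j : J}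
    (hj : ¬ ∃ i, e i = j) : chart d c e x j = x j := by
  rw [chart, Function.extend_apply' _ _ _ hj]

theorem hasStrictFDerivAt_diagForm {𝕜 : Type*} [NontriviallyNormedField 𝕜] (x : J → 𝕜) (i : I) :
    HasStrictFDerivAt (fun x => diagForm d c x i)
      (∑ j, diagJac d c x i j • ContinuousLinearMap.proj (R := 𝕜) (φ := fun _ : J => 𝕜) j) x := by
  refine HasStrictFDerivAt.fun_sum fun j _ => ?_
  have h1 := ((hasStrictFDerivAt_apply (𝕜 := 𝕜) j x).pow (d i)).const_mul (c i j : 𝕜)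
  refine h1.congr_fderiv ?_
  ext v
  simp [diagJac]
  ring

theorem exists_hasStrictFDerivAt_chart [Fintype I] {𝕜 : Type*} [NontriviallyNormedField 𝕜]
    [CompleteSpace 𝕜] {x : J → 𝕜} {e : I → J} (he : Function.Injective e)
    (hli : LinearIndependent 𝕜 fun i => (diagJac d c x).col (e i)) :
    ∃ f' : (J → 𝕜) →L[𝕜] (J → 𝕜), HasStrictFDerivAt (chart d c e) f' x ∧ f'.range = ⊤ := by
  set L : J → (J → 𝕜) →L[𝕜] 𝕜 := Function.extend e
    (fun i => ∑ j, diagJac d c x i j • ContinuousLinearMap.proj (R := 𝕜) (φ := fun _ : J => 𝕜) j)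
    fun j => ContinuousLinearMap.proj j with hL
  have hL1 : ∀ i, L (e i) = ∑ j, diagJac d c x i j •
      ContinuousLinearMap.proj (R := 𝕜) (φ := fun _ : J => 𝕜) j := fun i => he.extend_apply _ _ i
  have hL2 : ∀ j, (¬ ∃ i, e i = j) → L j = ContinuousLinearMap.proj j := fun j hj =>
    Function.extend_apply' _ _ _ hj
  have hder : HasStrictFDerivAt (chart d c e) (ContinuousLinearMap.pi L) x := by
    rw [hasStrictFDerivAt_pi']
    intro j
    by_cases hj : ∃ i, e i = j
    · obtain ⟨i, rfl⟩ := hj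
      have h := hasStrictFDerivAt_diagForm d c x i
      simp_rw [chart_apply d c he]
      refine h.congr_fderiv ?_
      ext v
      simp [hL1]
    · simp_rw [chart_apply_of_notMem d c _ hj]
      refine (hasStrictFDerivAt_apply (𝕜 := 𝕜) j x).congr_fderiv ?_
      ext v
      simp [hL2 j hj]
  refine ⟨_, hder, ?_⟩
  have hinj : Function.Injective (ContinuousLinearMap.pi L : (J → 𝕜) →ₗ[𝕜] (J → 𝕜)) := by
    rw [← LinearMap.ker_eq_bot, LinearMap.ker_eq_bot']
    intro v hv
    have hv' : ∀ j, L j v = 0 := fun j => congrFun hv j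
    have h0 : ∀ j, (¬ ∃ i, e i = j) → v j = 0 := fun j hj => by
      simpa [hL2 j hj] using hv' j
    have h1 : ∑ i, v (e i) • (diagJac d c x).col (e i) = 0 := by
      ext i
      have := hv' (e i)
      rw [hL1] at this
      simp only [_root_.sum_apply, _root_.smul_apply,
        ContinuousLinearMap.proj_apply, smul_eq_mul] at this
      rw [Pi.zero_apply, ← this, Finset.sum_apply]
      refine Finset.sum_of_injOn e he.injOn (fun _ _ => Finset.mem_coe.2 (mem_univ _))
        (fun j _ hj => ?_) fun i' _ => by simp [mul_comm]
      rw [h0 j fun ⟨i, hi⟩ => hj ⟨i, by simp, hi⟩, mul_zero]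
    have h2 := Fintype.linearIndependent_iff.1 hli _ h1
    ext j
    by_cases hj : ∃ i, e i = j
    · obtain ⟨i, rfl⟩ := hj
      exact h2 i
    · exact h0 j hj
  exact LinearMap.range_eq_top.2 (LinearMap.injective_iff_surjective.1 hinj)

end Jacobian

section RealDensity

variable {I J : Type*} [Fintype I] [Fintype J] {d : I → ℕ} {c : I → J → ℤ}

theorem prod_ite_mem_range {e : I → J} (he : Function.Injective e) (a b : ℝ) :
    ∏ j, (if ∃ i, e i = j then a else b)
      = a ^ Fintype.card I * b ^ (Fintype.card J - Fintype.card I) := by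
  have h : ({j | ∃ i, e i = j} : Finset J) = univ.image e := by ext; simp
  rw [Finset.prod_ite, Finset.prod_const, Finset.prod_const, Finset.filter_not,
    Finset.card_sdiff_of_subset (Finset.filter_subset _ _), h,
    Finset.card_image_of_injective _ he, Finset.card_univ, Finset.card_univ]

/-- The points of the unit cube at which all the forms are at most `η`. -/
def smallSet (d : I → ℕ) (c : I → J → ℤ) (η : ℝ) : Set (J → ℝ) :=
  {u | u ∈ (Set.univ.pi fun _ => Set.Icc 0 1) ∧ ∀ i, |diagForm d c u i| ≤ η}

open scoped Pointwise in
theorem exists_le_volume_smallSet {x : J → ℝ} (hx : ∀ j, 0 < x j)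
    (h0 : ∀ i, diagForm d c x i = 0) (hrank : (diagJac d c x).rank = Fintype.card I) :
    ∃ κ : ℝ, 0 < κ ∧ ∃ ε : ℝ, 0 < ε ∧ ∀ η : ℝ, 0 < η → η ≤ ε →
      κ * η ^ Fintype.card I ≤ volume.real (smallSet d c η) := by
  obtain ⟨e, he, hli⟩ := exists_injective_columns _ hrank
  obtain ⟨f', hf', hsurj⟩ := exists_hasStrictFDerivAt_chart d c he hli
  obtain ⟨L₀, S, hS, hL₀⟩ := hf'.exists_lipschitzOnWith
  set L := L₀ + 1 with hL
  set B : ℝ := 1 + ‖x‖ + 1 with hB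
  have hB1 : 1 ≤ B := by have := norm_nonneg x; linarith
  have hB0 : 0 < B := by linarith
  set U : Set (J → ℝ) := S ∩ ({u | ∀ j, 0 < u j} ∩ Metric.ball x 1) with hU
  have hUx : U ∈ nhds x := by
    refine inter_mem hS (inter_mem ?_ (Metric.ball_mem_nhds _ one_pos))
    have : IsOpen {u : J → ℝ | ∀ j, 0 < u j} := by
      simp only [Set.ofPred_forall]
      exact isOpen_iInter_of_finite fun j => isOpen_lt continuous_const (continuous_apply j)
    exact this.mem_nhds hx
  have hUB : ∀ u ∈ U, ∀ j, 0 < u j ∧ u j ≤ B := fun u hu j => by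
    refine ⟨hu.2.1 j, ?_⟩
    have h1 : ‖u - x‖ < 1 := by simpa [dist_eq_norm] using hu.2.2
    have h2 := norm_le_pi_norm u j
    have h3 := norm_le_norm_add_norm_sub' u x
    rw [Real.norm_eq_abs] at h2
    have h4 := le_abs_self (u j)
    linarith
  have himg : chart d c e '' U ∈ nhds (chart d c e x) := by
    rw [← hf'.map_nhds_eq_of_surj hsurj]
    exact Filter.image_mem_map hUx
  obtain ⟨ε, hε, hball⟩ := Metric.nhds_basis_closedBall.mem_iff.1 himg
  set s := Fintype.card J with hs
  refine ⟨(B⁻¹) ^ s * ((L : ℝ) ^ s)⁻¹ * (2 ^ Fintype.card I *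
    (2 * ε) ^ (s - Fintype.card I)), ?_, ε, hε, fun η hη hηε => ?_⟩
  · have : (0 : ℝ) < L := by rw [hL]; positivity
    positivity
  set T : Set (J → ℝ) := {u | u ∈ U ∧ ∀ i, |diagForm d c u i| ≤ η} with hT
  set w : J → ℝ := fun j => if ∃ i, e i = j then η else ε with hw
  have hw0 : ∀ j, 0 ≤ w j := fun j => by simp only [hw]; split_ifs <;> positivity
  have hwε : ∀ j, w j ≤ ε := fun j => by simp only [hw]; split_ifs <;> linarith
  have hbox : Set.Icc (fun j => chart d c e x j - w j) (fun j => chart d c e x j + w j)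
      ⊆ chart d c e '' T := by
    intro y hy
    have hy' : ∀ j, |y j - chart d c e x j| ≤ w j := fun j =>
      abs_le.2 ⟨by linarith [hy.1 j], by linarith [hy.2 j]⟩
    obtain ⟨u, hu, rfl⟩ := hball (show y ∈ Metric.closedBall (chart d c e x) ε by
      rw [Metric.mem_closedBall, dist_pi_le_iff hε.le]
      exact fun j => (hy' j).trans (hwε j))
    refine ⟨u, ⟨hu, fun i => ?_⟩, rfl⟩
    have := hy' (e i)
    rw [chart_apply d c he, chart_apply d c he, h0, sub_zero] at this
    simpa [hw] using this
  have hTU : T ⊆ U := fun u hu => hu.1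
  have hTfin : volume T ≠ ⊤ := ((measure_mono (hTU.trans fun u hu => hu.2.2)).trans_lt
    Metric.isBounded_ball.measure_lt_top).ne
  have hLip : LipschitzOnWith L (chart d c e) T :=
    (hL₀.mono fun u hu => hu.1.1).weaken (by simp [hL])
  have h1 : volume (Set.Icc (fun j => chart d c e x j - w j) fun j => chart d c e x j + w j)
      ≤ (L : ENNReal) ^ s * volume T := by
    refine (measure_mono hbox).trans ?_
    have := hLip.hausdorffMeasure_image_le (d := (s : ℝ)) (by positivity)
    rwa [hs, hausdorffMeasure_pi_real, ENNReal.rpow_natCast] at this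
  have h2 : (2 * η) ^ Fintype.card I * (2 * ε) ^ (s - Fintype.card I)
      ≤ (L : ℝ) ^ s * volume.real T := by
    have := ENNReal.toReal_mono (ENNReal.mul_ne_top (by simp) hTfin) h1
    rw [Real.volume_Icc_pi_toReal fun j => by simp only; linarith [hw0 j], ENNReal.toReal_mul,
      ENNReal.toReal_pow, ENNReal.coe_toReal] at this
    refine le_trans (le_of_eq ?_) this
    rw [← prod_ite_mem_range he]
    refine Finset.prod_congr rfl fun j _ => ?_
    simp only [hw]
    split_ifs <;> ring
  have hsub : B⁻¹ • T ⊆ smallSet d c η := by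
    rintro _ ⟨u, hu, rfl⟩
    have hBi : B⁻¹ ≤ 1 := inv_le_one_of_one_le₀ hB1
    refine ⟨fun j _ => ?_, fun i => ?_⟩
    · obtain ⟨h3, h4⟩ := hUB u hu.1 j
      simp only [Pi.smul_apply, smul_eq_mul]
      exact ⟨by positivity, by rw [inv_mul_le_iff₀ hB0]; simpa using h4⟩
    · simp only [diagForm_smul, abs_mul]
      refine (mul_le_of_le_one_left (abs_nonneg _) ?_).trans (hu.2 i)
      rw [abs_of_nonneg (by positivity)]
      exact pow_le_one₀ (by positivity) hBi
  have hfin : volume (smallSet d c η) ≠ ⊤ :=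
    ((measure_mono fun u hu => hu.1).trans_lt
      (isCompact_univ_pi fun _ => isCompact_Icc).measure_lt_top).ne
  have h3 : (B⁻¹) ^ s * volume.real T ≤ volume.real (smallSet d c η) := by
    have h := ENNReal.toReal_mono hfin (measure_mono hsub)
    rw [Measure.addHaar_smul, Module.finrank_pi, ENNReal.toReal_mul, ENNReal.toReal_ofReal
      (abs_nonneg _), abs_of_nonneg (by positivity)] at h
    exact h
  refine le_trans ?_ h3
  have hL0 : (0 : ℝ) < L := by rw [hL]; positivity
  rw [mul_assoc, mul_assoc]
  refine mul_le_mul_of_nonneg_left ?_ (by positivity)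
  rw [inv_mul_le_iff₀ (by positivity)]
  refine le_trans (le_of_eq ?_) h2
  rw [mul_pow]
  ring

end RealDensity

section SingularIntegral

variable {I J : Type*} [Fintype I] [Fintype J] {d : I → ℕ} {c : I → J → ℤ}

theorem sum_phase_linForm (ξ : I → ℝ) (u : J → ℝ) :
    ∑ j, phase d (linForm c j ξ) (u j) = ∑ i, ξ i * diagForm d c u i := by
  simp only [phase, linForm, diagForm, Finset.mul_sum]
  rw [Finset.sum_comm]
  exact Finset.sum_congr rfl fun i _ => Finset.sum_congr rfl fun j _ => by ring

theorem singInt_eq_integral (ξ : I → ℝ) :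
    singInt d c ξ = ∫ u in Set.univ.pi fun _ : J => Set.Icc (0 : ℝ) 1,
      eC (∑ i, ξ i * diagForm d c u i) := by
  rw [volume_restrict_pi]
  simp_rw [← sum_phase_linForm, eC_sum]
  rw [integral_fintype_prod_eq_prod (𝕜 := ℂ) fun j (x : ℝ) => eC (phase d (linForm c j ξ) x),
    singInt]
  refine Finset.prod_congr rfl fun j _ => ?_
  rw [osc, intervalIntegral.integral_of_le zero_le_one, integral_Icc_eq_integral_Ioc]

theorem continuous_diagForm (i : I) : Continuous fun u : J → ℝ => diagForm d c u i := by
  unfold diagForm; fun_prop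

/-- The Gaussian weight of width `1 / η`. -/
def gaussWeight (η : ℝ) (ξ : I → ℝ) : ℂ :=
  Complex.exp (-((Real.pi * η ^ 2 : ℝ) : ℂ) * ∑ i, (ξ i : ℂ) ^ 2)

theorem norm_gaussWeight (η : ℝ) (ξ : I → ℝ) : ‖gaussWeight η ξ‖ ≤ 1 := by
  have : -((Real.pi * η ^ 2 : ℝ) : ℂ) * ∑ i, (ξ i : ℂ) ^ 2
      = ((-(Real.pi * η ^ 2 * ∑ i, ξ i ^ 2) : ℝ) : ℂ) := by push_cast; ring
  rw [gaussWeight, this, Complex.norm_exp, Complex.ofReal_re, Real.exp_le_one_iff, neg_nonpos]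
  have := Finset.sum_nonneg fun i (_ : i ∈ univ) => sq_nonneg (ξ i)
  have := Real.pi_pos
  positivity

theorem continuous_gaussWeight : Continuous fun p : ℝ × (I → ℝ) => gaussWeight p.1 p.2 := by
  unfold gaussWeight; fun_prop

theorem integrable_gaussWeight {η : ℝ} (hη : 0 < η) :
    Integrable (gaussWeight η : (I → ℝ) → ℂ) := by
  have h := GaussianFourier.integrable_cexp_neg_mul_sum_add (ι := I)
    (b := ((Real.pi * η ^ 2 : ℝ) : ℂ)) (by
      rw [Complex.ofReal_re]; have := Real.pi_pos; positivity) 0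
  simp only [Pi.zero_apply, zero_mul, Finset.sum_const_zero, add_zero] at h
  exact h

theorem integral_gaussWeight_mul_eC {η : ℝ} (hη : 0 < η) (F : I → ℝ) :
    ∫ ξ : I → ℝ, gaussWeight η ξ * eC (∑ i, ξ i * F i)
      = (((η ^ Fintype.card I)⁻¹ * Real.exp (-(Real.pi / η ^ 2 * ∑ i, F i ^ 2)) : ℝ) : ℂ) := by
  have hb : (0 : ℝ) < Real.pi * η ^ 2 := by have := Real.pi_pos; positivity
  have h := GaussianFourier.integral_cexp_neg_mul_sum_add (ι := I)
    (b := ((Real.pi * η ^ 2 : ℝ) : ℂ)) (by rwa [Complex.ofReal_re])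
    fun i => 2 * Real.pi * Complex.I * F i
  convert h using 1
  · congr 1
    ext ξ
    rw [gaussWeight, eC, ← Complex.exp_add]
    congr 2
    push_cast
    rw [Finset.mul_sum]
    exact Finset.sum_congr rfl fun i _ => by ring
  · have h1 : (Real.pi : ℂ) / ((Real.pi * η ^ 2 : ℝ) : ℂ) = (((η⁻¹) ^ 2 : ℝ) : ℂ) := by
      have := Real.pi_pos.ne'
      rw [← Complex.ofReal_div]
      congr 1
      field_simp
    have h2 : ((Fintype.card I : ℂ) / 2) = (((Fintype.card I : ℝ) / 2 : ℝ) : ℂ) := by push_cast; rfl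
    rw [h1, h2, ← Complex.ofReal_cpow (by positivity), ← Real.rpow_natCast (η⁻¹) 2,
      ← Real.rpow_mul (by positivity), Nat.cast_ofNat, mul_div_cancel₀ _ two_ne_zero,
      Real.rpow_natCast, inv_pow, Complex.ofReal_mul, Complex.ofReal_exp]
    congr 2
    push_cast
    simp only [mul_pow, Complex.I_sq, ← Finset.mul_sum]
    have := Complex.ofReal_ne_zero.2 Real.pi_pos.ne'
    have := Complex.ofReal_ne_zero.2 hη.ne'
    field_simp
    ring

theorem integral_gaussWeight_mul_singInt {η : ℝ} (hη : 0 < η) :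
    ∫ ξ : I → ℝ, gaussWeight η ξ * singInt d c ξ
      = ((∫ u in Set.univ.pi fun _ : J => Set.Icc (0 : ℝ) 1, (η ^ Fintype.card I)⁻¹
          * Real.exp (-(Real.pi / η ^ 2 * ∑ i, diagForm d c u i ^ 2)) : ℝ) : ℂ) := by
  set μ : Measure (J → ℝ) := volume.restrict (Set.univ.pi fun _ : J => Set.Icc (0 : ℝ) 1) with hμ
  have : IsFiniteMeasure μ := ⟨by
    rw [hμ, Measure.restrict_apply_univ]
    exact (isCompact_univ_pi fun _ => isCompact_Icc).measure_lt_top⟩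
  have hint : Integrable (Function.uncurry fun (ξ : I → ℝ) (u : J → ℝ) =>
      gaussWeight η ξ * eC (∑ i, ξ i * diagForm d c u i)) (volume.prod μ) := by
    refine ((integrable_gaussWeight hη).comp_fst μ).mono ?_ (Eventually.of_forall fun p => ?_)
    · refine Continuous.aestronglyMeasurable ?_
      have h1 : Continuous fun p : (I → ℝ) × (J → ℝ) => gaussWeight η p.1 :=
        continuous_gaussWeight.comp (by fun_prop : Continuous fun p : (I → ℝ) × (J → ℝ) => (η, p.1))
      refine h1.mul (continuous_eC.comp (continuous_finsetSum _ fun i _ => ?_))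
      exact ((continuous_apply i).comp continuous_fst).mul
        ((continuous_diagForm i).comp continuous_snd)
    · simp [Function.uncurry, norm_eC]
  rw [← integral_complex_ofReal]
  simp_rw [← integral_gaussWeight_mul_eC hη]
  rw [← integral_integral_swap hint]
  simp_rw [integral_const_mul, singInt_eq_integral]
  rfl

theorem le_integral_gaussWeight {κ η : ℝ} (hη : 0 < η)
    (h : κ * η ^ Fintype.card I ≤ volume.real (smallSet d c η)) :
    Real.exp (-(Real.pi * Fintype.card I)) * κ
      ≤ ∫ u in Set.univ.pi fun _ : J => Set.Icc (0 : ℝ) 1, (η ^ Fintype.card I)⁻¹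
          * Real.exp (-(Real.pi / η ^ 2 * ∑ i, diagForm d c u i ^ 2)) := by
  set f : (J → ℝ) → ℝ := fun u => (η ^ Fintype.card I)⁻¹
    * Real.exp (-(Real.pi / η ^ 2 * ∑ i, diagForm d c u i ^ 2)) with hf
  have hK : IsCompact (Set.univ.pi fun _ : J => Set.Icc (0 : ℝ) 1) :=
    isCompact_univ_pi fun _ => isCompact_Icc
  have hcont : Continuous f := by
    have := fun i => continuous_diagForm (d := d) (c := c) i
    simp only [hf]
    fun_prop
  have hsub : smallSet d c η ⊆ Set.univ.pi fun _ : J => Set.Icc (0 : ℝ) 1 := fun u hu => hu.1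
  have hclosed : IsClosed (smallSet d c η) := by
    have h2 : IsClosed {u : J → ℝ | ∀ i, |diagForm d c u i| ≤ η} := by
      simp only [Set.ofPred_forall]
      exact isClosed_iInter fun i => isClosed_le (continuous_diagForm i).abs continuous_const
    exact hK.isClosed.inter h2
  have hfin : volume (smallSet d c η) ≠ ⊤ := ((measure_mono hsub).trans_lt hK.measure_lt_top).ne
  calc Real.exp (-(Real.pi * Fintype.card I)) * κ
      = (η ^ Fintype.card I)⁻¹ * Real.exp (-(Real.pi * Fintype.card I))
          * (κ * η ^ Fintype.card I) := by field_simp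
    _ ≤ (η ^ Fintype.card I)⁻¹ * Real.exp (-(Real.pi * Fintype.card I))
          * volume.real (smallSet d c η) := by gcongr
    _ = ∫ _ in smallSet d c η, (η ^ Fintype.card I)⁻¹ * Real.exp (-(Real.pi * Fintype.card I)) := by
        rw [setIntegral_const, smul_eq_mul, mul_comm]
    _ ≤ ∫ u in smallSet d c η, f u := by
        refine setIntegral_mono_on (integrableOn_const hfin)
          ((hcont.continuousOn.integrableOn_compact hK).mono_set hsub) hclosed.measurableSet
          fun u hu => ?_
        simp only [hf]
        refine mul_le_mul_of_nonneg_left (Real.exp_le_exp.2 (neg_le_neg ?_)) (by positivity)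
        have h3 : ∑ i, diagForm d c u i ^ 2 ≤ Fintype.card I * η ^ 2 := by
          refine (Finset.sum_le_card_nsmul _ _ (η ^ 2) fun i _ => ?_).trans_eq
            (by rw [nsmul_eq_mul, Finset.card_univ])
          exact sq_le_sq' (by linarith [(abs_le.1 (hu.2 i)).1]) (abs_le.1 (hu.2 i)).2
        rw [div_mul_eq_mul_div, div_le_iff₀ (by positivity), mul_assoc]
        exact mul_le_mul_of_nonneg_left h3 Real.pi_pos.le
    _ ≤ _ := setIntegral_mono_set (hcont.continuousOn.integrableOn_compact hK)
        (Eventually.of_forall fun u => by simp only [hf, Pi.zero_apply]; positivity)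
        hsub.eventuallyLE

/-- The singular integral is positive as soon as there is a non-singular positive real zero. -/
theorem exists_integral_singInt_eq_ofReal (hint : Integrable (singInt d c)) {x : J → ℝ}
    (hx : ∀ j, 0 < x j) (h0 : ∀ i, diagForm d c x i = 0)
    (hrank : (diagJac d c x).rank = Fintype.card I) :
    ∃ a : ℝ, 0 < a ∧ ∫ ξ, singInt d c ξ = a := by
  obtain ⟨κ, hκ, ε, hε, hvol⟩ := exists_le_volume_smallSet hx h0 hrank
  have hlim : Tendsto (fun η : ℝ => ∫ ξ : I → ℝ, gaussWeight η ξ * singInt d c ξ)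
      (nhdsWithin 0 (Set.Ioi 0)) (nhds (∫ ξ, singInt d c ξ)) := by
    refine tendsto_integral_filter_of_dominated_convergence (fun ξ => ‖singInt d c ξ‖)
      (Eventually.of_forall fun η => ?_) (Eventually.of_forall fun η => ?_) hint.norm
      (Eventually.of_forall fun ξ => ?_)
    · have h1 : Continuous fun ξ : I → ℝ => gaussWeight η ξ :=
        continuous_gaussWeight.comp (by fun_prop : Continuous fun ξ : I → ℝ => (η, ξ))
      exact (h1.mul (continuous_singInt d c)).aestronglyMeasurable
    · refine Eventually.of_forall fun ξ => ?_
      rw [norm_mul]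
      exact mul_le_of_le_one_left (norm_nonneg _) (norm_gaussWeight η ξ)
    · have h1 : Continuous fun η : ℝ => gaussWeight η ξ * singInt d c ξ :=
        (continuous_gaussWeight.comp (by fun_prop : Continuous fun η : ℝ => (η, ξ))).mul
          continuous_const
      have h2 := h1.tendsto 0
      simp only [gaussWeight, ne_eq, OfNat.ofNat_ne_zero, not_false_eq_true, zero_pow, mul_zero,
        Complex.ofReal_zero, neg_zero, zero_mul, Complex.exp_zero, one_mul] at h2
      exact h2.mono_left nhdsWithin_le_nhds
  have hclosed : IsClosed (Complex.ofReal '' Set.Ici (Real.exp (-(Real.pi * Fintype.card I)) * κ)) :=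
    Complex.isometry_ofReal.isClosedEmbedding.isClosedMap _ isClosed_Ici
  have hev : ∀ᶠ η : ℝ in nhdsWithin 0 (Set.Ioi 0), ∫ ξ : I → ℝ, gaussWeight η ξ * singInt d c ξ
      ∈ Complex.ofReal '' Set.Ici (Real.exp (-(Real.pi * Fintype.card I)) * κ) := by
    filter_upwards [Ioc_mem_nhdsGT hε] with η hη
    exact ⟨_, le_integral_gaussWeight hη.1 (hvol η hη.1 hη.2),
      (integral_gaussWeight_mul_singInt hη.1).symm⟩
  obtain ⟨a, ha, h⟩ := hclosed.mem_of_tendsto hlim hev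
  exact ⟨a, lt_of_lt_of_le (by positivity) ha, h.symm⟩

end SingularIntegral

section LocalDensity

variable {I J : Type*} [Fintype I] [Fintype J] (d : I → ℕ) (c : I → J → ℤ)

/-- The number of zeros of the diagonal forms modulo `W`. -/
def localCount (W : ℕ) : ℕ := Nat.card {x : J → ZMod W // ∀ i, diagForm d c x i = 0}

/-- The density of the zeros of the diagonal forms modulo `W`. -/
def localDensity (W : ℕ) : ℝ :=
  (W : ℝ) ^ Fintype.card I * ((W : ℝ) ^ Fintype.card J)⁻¹ * localCount d c W

theorem diagForm_intCast_eq_zero_iff (W : ℕ) (x : J → ℤ) (i : I) :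
    diagForm d c (fun j => (x j : ZMod W)) i = 0 ↔ (W : ℤ) ∣ diagForm d c x i := by
  rw [← ZMod.intCast_zmod_eq_zero_iff_dvd]
  exact (congrArg (· = 0) (map_diagForm d c (Int.castRingHom (ZMod W)) x i)).symm.to_iff

theorem localCount_eq_card {W : ℕ} (hW : 0 < W) :
    localCount d c W = #{x ∈ Fintype.piFinset fun _ : J => range W |
      ∀ i, (W : ℤ) ∣ diagForm d c (fun j => (x j : ℤ)) i} := by
  have : NeZero W := ⟨hW.ne'⟩
  rw [← Nat.card_eq_finsetCard]
  refine Nat.card_congr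
    { toFun := fun x => ⟨fun j => (x.1 j).val, ?_⟩
      invFun := fun y => ⟨fun j => (y.1 j : ZMod W), fun i => ?_⟩
      left_inv := fun x => ?_
      right_inv := fun y => ?_ }
  · rw [mem_filter, Fintype.mem_piFinset]
    refine ⟨fun j => mem_range.2 (ZMod.val_lt _), fun i => ?_⟩
    rw [← diagForm_intCast_eq_zero_iff]
    simpa using x.2 i
  · have := (diagForm_intCast_eq_zero_iff d c W (fun j => (y.1 j : ℤ)) i).2
      ((mem_filter.1 y.2).2 i)
    simpa using this
  · ext j
    simp
  · ext j
    have := (Fintype.mem_piFinset.1 (mem_filter.1 y.2).1) j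
    simpa using ZMod.val_natCast_of_lt (mem_range.1 this)

theorem smean_linForm_div {W : ℕ} (hW : 0 < W) (a : I → ℕ) (j : J) :
    smean d W (linForm c j fun i => (a i : ℝ) / W)
      = smean d (commonDen fun i => (a i : ℚ) / W)
          (linForm c j fun i => (((a i : ℚ) / W : ℚ) : ℝ)) := by
  have h : (fun i => (a i : ℝ) / W) = fun i => (((a i : ℚ) / W : ℚ) : ℝ) := by ext; push_cast; rfl
  rw [h]
  have hW' : (W : ℚ) ≠ 0 := by positivity
  refine smean_eq_smean d hW (commonDen_pos _) (exists_int_mul_linForm c (fun i => ⟨a i, ?_⟩) j)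
    (exists_int_mul_linForm c (exists_commonDen_mul_eq _) j)
  push_cast
  field_simp

theorem sum_piFinset_prod_eC {W : ℕ} (hW : 0 < W) (a : I → ℕ) :
    ∑ x ∈ Fintype.piFinset fun _ : J => range W,
        ∏ i, eC (a i * ((diagForm d c (fun j => (x j : ℤ)) i : ℤ) / W : ℝ))
      = (W : ℂ) ^ Fintype.card J * singTerm d c fun i => (a i : ℚ) / W := by
  have hW' : (W : ℂ) ≠ 0 := by exact_mod_cast hW.ne'
  have h : ∀ x : J → ℕ, ∏ i, eC (a i * ((diagForm d c (fun j => (x j : ℤ)) i : ℤ) / W : ℝ))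
      = ∏ j, eC (phase d (linForm c j fun i => (a i : ℝ) / W) (x j)) := fun x => by
    rw [← eC_sum, ← eC_sum, sum_phase_linForm (c := c) _ fun j => (x j : ℝ)]
    congr 1
    refine Finset.sum_congr rfl fun i _ => ?_
    have := map_diagForm d c (Int.castRingHom ℝ) (fun j => (x j : ℤ)) i
    simp only [eq_intCast, Int.cast_natCast] at this
    rw [this]
    ring
  simp_rw [h]
  rw [← Finset.prod_univ_sum (fun _ : J => range W)
    fun j x => eC (phase d (linForm c j fun i => (a i : ℝ) / W) (x : ℝ)), singTerm]
  simp_rw [← smean_linForm_div d c hW, smean]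
  rw [Finset.prod_mul_distrib, Finset.prod_const, Finset.card_univ, ← mul_assoc, ← mul_pow,
    mul_inv_cancel₀ hW', one_pow, one_mul]

theorem localDensity_eq_sum_piFinset {W : ℕ} (hW : 0 < W) :
    (localDensity d c W : ℂ)
      = ∑ a ∈ Fintype.piFinset fun _ : I => range W, singTerm d c fun i => (a i : ℚ) / W := by
  have hW' : (W : ℂ) ≠ 0 := by exact_mod_cast hW.ne'
  have h : ∀ x : J → ℕ, (if ∀ i, (W : ℤ) ∣ diagForm d c (fun j => (x j : ℤ)) i then
      (W : ℂ) ^ Fintype.card I else 0) = ∑ a ∈ Fintype.piFinset fun _ : I => range W,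
        ∏ i, eC (a i * ((diagForm d c (fun j => (x j : ℤ)) i : ℤ) / W : ℝ)) := fun x => by
    rw [← Finset.prod_univ_sum (fun _ : I => range W)
      fun i u => eC (u * ((diagForm d c (fun j => (x j : ℤ)) i : ℤ) / W : ℝ))]
    simp_rw [sum_range_eC_div hW]
    rw [Finset.prod_ite_zero]
    simp
  have h2 : (W : ℂ) ^ Fintype.card I * localCount d c W = (W : ℂ) ^ Fintype.card J *
      ∑ a ∈ Fintype.piFinset fun _ : I => range W, singTerm d c fun i => (a i : ℚ) / W := by
    rw [localCount_eq_card d c hW, Finset.card_filter, Nat.cast_sum, Finset.mul_sum,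
      Finset.mul_sum]
    simp_rw [← sum_piFinset_prod_eC d c hW]
    rw [Finset.sum_comm]
    refine Finset.sum_congr rfl fun x _ => ?_
    rw [← h]
    split_ifs <;> simp
  rw [localDensity]
  push_cast
  rw [mul_right_comm, h2]
  field_simp

/-- The fractional vectors whose denominator divides `W`. -/
def divVec (I : Type*) [Fintype I] (W : ℕ) : Finset (FracVec I) :=
  {ρ ∈ fareyVec I W | commonDen ρ.1 ∣ W}

theorem mem_divVec {W : ℕ} (hW : 0 < W) {ρ : FracVec I} :
    ρ ∈ divVec I W ↔ commonDen ρ.1 ∣ W := by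
  rw [divVec, mem_filter, mem_fareyVec]
  exact ⟨fun h => h.2, fun h => ⟨Nat.le_of_dvd hW h, h⟩⟩

theorem localDensity_eq_sum_divVec {W : ℕ} (hW : 0 < W) :
    (localDensity d c W : ℂ) = ∑ ρ ∈ divVec I W, singTerm d c ρ.1 := by
  have hW' : (0 : ℚ) < W := by exact_mod_cast hW
  rw [localDensity_eq_sum_piFinset d c hW]
  refine Finset.sum_bij' (fun a ha => ⟨fun i => (a i : ℚ) / W, fun i => ⟨by positivity, ?_⟩⟩)
    (fun ρ _ => fun i => (W * ρ.1 i).num.toNat) (fun a ha => ?_) (fun ρ hρ => ?_) (fun a ha => ?_)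
    (fun ρ hρ => ?_) fun a ha => rfl
  · rw [div_lt_one hW']
    exact_mod_cast mem_range.1 (Fintype.mem_piFinset.1 ha i)
  · rw [mem_divVec hW]
    refine commonDen_dvd hW fun i => ⟨a i, ?_⟩
    push_cast
    field_simp
  · rw [Fintype.mem_piFinset]
    intro i
    obtain ⟨m, hm⟩ := (mem_divVec hW).1 hρ
    obtain ⟨b, hb⟩ := exists_commonDen_mul_eq ρ.1 i
    have h1 : (W : ℚ) * ρ.1 i = ((b * m : ℤ) : ℚ) := by
      rw [hm]; push_cast; rw [← hb]; ring
    have h2 : (W : ℚ) * ρ.1 i < W := mul_lt_of_lt_one_right hW' (ρ.2 i).2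
    rw [mem_range, h1, Rat.num_intCast]
    rw [h1] at h2
    have h3 : b * m < (W : ℤ) := by exact_mod_cast h2
    omega
  · ext i
    have : (W : ℚ) * (a i / W) = (a i : ℤ) := by push_cast; field_simp
    simp only [this, Rat.num_intCast, Int.toNat_natCast]
  · ext i
    obtain ⟨m, hm⟩ := (mem_divVec hW).1 hρ
    obtain ⟨b, hb⟩ := exists_commonDen_mul_eq ρ.1 i
    have h1 : (W : ℚ) * ρ.1 i = ((b * m : ℤ) : ℚ) := by
      rw [hm]; push_cast; rw [← hb]; ring
    have h2 : 0 ≤ (W : ℚ) * ρ.1 i := mul_nonneg hW'.le (ρ.2 i).1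
    have h3 : 0 ≤ b * (m : ℤ) := by rw [h1] at h2; exact_mod_cast h2
    simp only [h1, Rat.num_intCast]
    rw [div_eq_iff hW'.ne', mul_comm _ (W : ℚ), h1, ← Int.cast_natCast, Int.toNat_of_nonneg h3]

theorem localCount_mul {m n : ℕ} (h : m.Coprime n) :
    localCount d c (m * n) = localCount d c m * localCount d c n := by
  rw [localCount, localCount, localCount, ← Nat.card_prod]
  set e := ZMod.chineseRemainder h
  have h1 : ∀ (x : J → ZMod (m * n)) i, (e (diagForm d c x i)).1
      = diagForm d c (fun j => (e (x j)).1) i :=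
    map_diagForm d c ((RingHom.fst _ _).comp (e : ZMod (m * n) →+* ZMod m × ZMod n))
  have h2 : ∀ (x : J → ZMod (m * n)) i, (e (diagForm d c x i)).2
      = diagForm d c (fun j => (e (x j)).2) i :=
    map_diagForm d c ((RingHom.snd _ _).comp (e : ZMod (m * n) →+* ZMod m × ZMod n))
  refine Nat.card_congr
    { toFun := fun x => (⟨fun j => (e (x.1 j)).1, fun i => by rw [← h1, x.2, map_zero]; rfl⟩,
        ⟨fun j => (e (x.1 j)).2, fun i => by rw [← h2, x.2, map_zero]; rfl⟩)
      invFun := fun y => ⟨fun j => e.symm (y.1.1 j, y.2.1 j), fun i => e.injective ?_⟩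
      left_inv := fun x => by ext j; simp
      right_inv := fun y => by ext j <;> simp }
  rw [map_zero]
  refine Prod.ext ?_ ?_
  · rw [h1]; simpa using y.1.2 i
  · rw [h2]; simpa using y.2.2 i

theorem localDensity_mul {m n : ℕ} (h : m.Coprime n) :
    localDensity d c (m * n) = localDensity d c m * localDensity d c n := by
  simp only [localDensity, localCount_mul d c h]
  push_cast
  rw [mul_pow, mul_pow, mul_inv]
  ring

theorem localDensity_prod {S : Finset ℕ} (hS : ∀ p ∈ S, p.Prime) (n : ℕ) :
    localDensity d c (∏ p ∈ S, p ^ n) = ∏ p ∈ S, localDensity d c (p ^ n) := by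
  induction S using Finset.induction_on with
  | empty =>
    have := localDensity_eq_sum_piFinset d c one_pos
    simp only [Finset.prod_empty]
    have h : (localDensity d c 1 : ℂ) = 1 := by
      rw [this]
      simp [Fintype.piFinset_singleton, singTerm_zero]
    exact_mod_cast h
  | insert p S hp ih =>
    rw [Finset.prod_insert hp, Finset.prod_insert hp, localDensity_mul, ih fun q hq =>
      hS q (mem_insert_of_mem hq)]
    refine Nat.Coprime.prod_right fun q hq => Nat.Coprime.pow _ _ ?_
    refine (Nat.coprime_primes (hS p (mem_insert_self _ _)) (hS q (mem_insert_of_mem hq))).2 ?_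
    rintro rfl
    exact hp hq

/-- The divisors of the numbers `∏_{p < n} p ^ n` exhaust the positive integers. -/
theorem dvd_prod_primesBelow {q : ℕ} (hq : 0 < q) :
    q ∣ ∏ p ∈ (q + 1).primesBelow, p ^ (q + 1) := by
  have h := Nat.prod_factorization_pow_eq_self hq.ne'
  conv_lhs => rw [← h, Finsupp.prod, Nat.support_factorization]
  refine (Finset.prod_dvd_prod_of_dvd _ _ fun p _ => pow_dvd_pow p
    (Nat.lt_succ_of_lt (Nat.factorization_lt p hq.ne')).le).trans
    (Finset.prod_dvd_prod_of_subset _ _ _ fun p hp => ?_)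
  exact Nat.mem_primesBelow.2 ⟨Nat.lt_succ_of_le (Nat.le_of_mem_primeFactors hp),
    Nat.prime_of_mem_primeFactors hp⟩

theorem tendsto_divVec_prod_primesBelow :
    Tendsto (fun n : ℕ => divVec I (∏ p ∈ n.primesBelow, p ^ n)) atTop atTop := by
  have hpos : ∀ n : ℕ, 0 < ∏ p ∈ n.primesBelow, p ^ n := fun n =>
    Finset.prod_pos fun p hp => pow_pos (Nat.mem_primesBelow.1 hp).2.pos _
  refine tendsto_atTop_finset_of_monotone (fun m n hmn ρ hρ => ?_)
    fun ρ => ⟨_, (mem_divVec (hpos _)).2 (dvd_prod_primesBelow (commonDen_pos ρ.1))⟩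
  rw [mem_divVec (hpos _)] at hρ ⊢
  refine hρ.trans ((Finset.prod_dvd_prod_of_dvd _ _ fun p _ => pow_dvd_pow p hmn).trans
    (Finset.prod_dvd_prod_of_subset _ _ _ fun p hp => ?_))
  rw [Nat.mem_primesBelow] at hp ⊢
  exact ⟨hp.1.trans_le hmn, hp.2⟩

theorem tendsto_localDensity (hsum : Summable fun ρ : FracVec I => ‖singTerm d c ρ.1‖) :
    Tendsto (fun n : ℕ => (localDensity d c (∏ p ∈ n.primesBelow, p ^ n) : ℂ)) atTop
      (nhds (∑' ρ : FracVec I, singTerm d c ρ.1)) := by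
  refine (hsum.of_norm.hasSum.comp tendsto_divVec_prod_primesBelow).congr fun n => ?_
  rw [localDensity_eq_sum_divVec]
  · rfl
  · exact Finset.prod_pos fun p hp => pow_pos (Nat.mem_primesBelow.1 hp).2.pos _

/-- The primes beyond a certain point contribute a factor bounded away from zero. -/
theorem exists_half_le_localDensity (hsum : Summable fun ρ : FracVec I => ‖singTerm d c ρ.1‖) :
    ∃ X : ℕ, ∀ W : ℕ, 0 < W → (∀ p, p.Prime → p ∣ W → X ≤ p) → 1 / 2 ≤ localDensity d c W := by
  obtain ⟨T, hT⟩ := summable_iff_vanishing_norm.1 hsum (1 / 2) (by norm_num)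
  refine ⟨T.sup (fun ρ => commonDen ρ.1) + 1, fun W hW h => ?_⟩
  set z : FracVec I := ⟨fun _ => 0, fun _ => ⟨le_rfl, one_pos⟩⟩ with hz
  have hz1 : ∀ ρ : FracVec I, commonDen ρ.1 = 1 → ρ = z := fun ρ hρ => by
    ext i
    obtain ⟨b, hb⟩ := exists_commonDen_mul_eq ρ.1 i
    have h0 := ρ.2 i
    rw [hρ, Nat.cast_one, one_mul] at hb
    rw [hb] at h0
    have h1 : 0 ≤ b ∧ b < 1 := by exact_mod_cast h0
    rw [hb, show b = 0 by omega]
    rfl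
  have hzW : z ∈ divVec I W := (mem_divVec hW).2 (commonDen_dvd hW fun i => ⟨0, by simp [hz]⟩)
  have hdisj : Disjoint ((divVec I W).erase z) T := by
    rw [Finset.disjoint_left]
    intro ρ hρ hρT
    rw [Finset.mem_erase] at hρ
    obtain ⟨p, hp, hpd⟩ := Nat.exists_prime_and_dvd (n := commonDen ρ.1) fun h1 => hρ.1 (hz1 ρ h1)
    have h1 := h p hp (hpd.trans ((mem_divVec hW).1 hρ.2))
    have h2 := Nat.le_of_dvd (commonDen_pos _) hpd
    have h3 := Finset.le_sup (f := fun ρ : FracVec I => commonDen ρ.1) hρT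
    omega
  have h1 := hT _ hdisj
  have h2 : ‖(localDensity d c W : ℂ) - 1‖ < 1 / 2 := by
    rw [localDensity_eq_sum_divVec d c hW, ← Finset.add_sum_erase _ _ hzW, hz, singTerm_zero,
      add_sub_cancel_left]
    refine (norm_sum_le _ _).trans_lt ((le_abs_self _).trans_lt h1)
  rw [← Complex.ofReal_one, ← Complex.ofReal_sub, Complex.norm_real, Real.norm_eq_abs] at h2
  linarith [(abs_lt.1 h2).1]

/-- The singular series is positive if all the local densities are bounded below. -/
theorem exists_tsum_singTerm_eq_ofReal (hsum : Summable fun ρ : FracVec I => ‖singTerm d c ρ.1‖)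
    (hloc : ∀ p : ℕ, p.Prime → ∃ κ : ℝ, 0 < κ ∧ ∃ n₀ : ℕ, ∀ n ≥ n₀, κ ≤ localDensity d c (p ^ n)) :
    ∃ a : ℝ, 0 < a ∧ ∑' ρ : FracVec I, singTerm d c ρ.1 = a := by
  obtain ⟨X, hX⟩ := exists_half_le_localDensity d c hsum
  choose! κ hκ n₀ hn₀ using hloc
  set κ' : ℝ := (∏ p ∈ X.primesBelow, κ p) * (1 / 2) with hκ'
  have hκpos : 0 < κ' := mul_pos (Finset.prod_pos fun p hp => hκ p (Nat.mem_primesBelow.1 hp).2)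
    one_half_pos
  have hclosed : IsClosed (Complex.ofReal '' Set.Ici κ') :=
    Complex.isometry_ofReal.isClosedEmbedding.isClosedMap _ isClosed_Ici
  have hev : ∀ᶠ n : ℕ in atTop, (localDensity d c (∏ p ∈ n.primesBelow, p ^ n) : ℂ)
      ∈ Complex.ofReal '' Set.Ici κ' := by
    filter_upwards [eventually_ge_atTop (X + X.primesBelow.sup n₀)] with n hn
    refine ⟨_, ?_, rfl⟩
    have hP : ∀ p ∈ n.primesBelow, p.Prime := fun p hp => (Nat.mem_primesBelow.1 hp).2
    have hfilter : {p ∈ n.primesBelow | p < X} = X.primesBelow := by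
      ext p
      simp only [mem_filter, Nat.mem_primesBelow]
      exact ⟨fun h => ⟨h.2, h.1.2⟩, fun h => ⟨⟨by omega, h.2⟩, h.1⟩⟩
    rw [Set.mem_Ici, localDensity_prod d c hP, ← Finset.prod_filter_mul_prod_filter_not _ (· < X),
      hfilter, ← localDensity_prod d c fun p hp => hP p (Finset.mem_filter.1 hp).1]
    refine mul_le_mul (Finset.prod_le_prod (fun p hp => (hκ p (Nat.mem_primesBelow.1 hp).2).le)
      fun p hp => hn₀ p (Nat.mem_primesBelow.1 hp).2 n ?_) (hX _ ?_ fun p hp hpd => ?_)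
      one_half_pos.le (Finset.prod_nonneg fun p hp => ?_)
    · exact (Finset.le_sup hp).trans (by omega)
    · exact Finset.prod_pos fun p hp => pow_pos (hP p (Finset.mem_filter.1 hp).1).pos _
    · obtain ⟨q, hq, hqd⟩ := (hp.prime.dvd_finsetProd_iff _).1 hpd
      rw [Finset.mem_filter] at hq
      have := (Nat.prime_dvd_prime_iff_eq hp (hP q hq.1)).1 (hp.dvd_of_dvd_pow hqd)
      omega
    · rw [localDensity]; positivity
  obtain ⟨a, ha, h⟩ := hclosed.mem_of_tendsto (tendsto_localDensity d c hsum) hev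
  exact ⟨a, lt_of_lt_of_le hκpos ha, h.symm⟩

end LocalDensity

section PadicDensity

variable {I J : Type*} [Fintype I] [Fintype J] {d : I → ℕ} {c : I → J → ℤ}

theorem pow_le_localCount {p : ℕ} [Fact p.Prime] {e : I → J} {x : J → ℚ_[p]} {n m : ℕ}
    (h : ∀ z : J → ℕ, ∃ u : J → ℤ_[p], (∀ i, diagForm d c u i = 0) ∧
      ∀ j, (¬ ∃ i, e i = j) → (u j : ℚ_[p]) = p ^ m * (x j + p ^ n * z j)) (b : ℕ) :
    (p ^ b) ^ Fintype.card {j // ¬ ∃ i, e i = j} ≤ localCount d c (p ^ (b + n + m)) := by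
  have hp : 0 < p := (Fact.out : p.Prime).pos
  choose u hu0 hu using h
  set extz : ({j // ¬ ∃ i, e i = j} → Fin (p ^ b)) → J → ℕ := fun z j =>
    if hj : ¬ ∃ i, e i = j then z ⟨j, hj⟩ else 0 with hextz
  have hNe : NeZero (p ^ (b + n + m)) := ⟨(pow_pos hp _).ne'⟩
  set f : ({j // ¬ ∃ i, e i = j} → Fin (p ^ b)) →
      {y : J → ZMod (p ^ (b + n + m)) // ∀ i, diagForm d c y i = 0} := fun z =>
    ⟨fun j => PadicInt.toZModPow (b + n + m) (u (extz z) j), fun i => by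
      rw [← map_diagForm, hu0, map_zero]⟩ with hf
  have hinj : Function.Injective f := by
    intro z z' hzz
    ext ⟨j, hj⟩
    have h1 := congrFun (congrArg Subtype.val hzz) j
    simp only [hf] at h1
    rw [← sub_eq_zero, ← map_sub, ← RingHom.mem_ker, PadicInt.ker_toZModPow,
      ← PadicInt.norm_le_pow_iff_mem_span_pow, PadicInt.norm_def, PadicInt.coe_sub, hu _ _ hj,
      hu _ _ hj] at h1
    have h2 : (p : ℚ_[p]) ^ m * (x j + p ^ n * (extz z j : ℕ)) - p ^ m * (x j + p ^ n * (extz z' j : ℕ))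
        = p ^ (m + n) * (((extz z j : ℤ) - (extz z' j : ℤ) : ℤ) : ℚ_[p]) := by push_cast; ring
    rw [h2, norm_mul, norm_pow, Padic.norm_p, inv_pow] at h1
    have h3 : ‖(((extz z j : ℤ) - (extz z' j : ℤ) : ℤ) : ℚ_[p])‖ ≤ (p : ℝ) ^ (-(b : ℤ)) := by
      rw [inv_mul_le_iff₀ (by positivity)] at h1
      refine h1.trans (le_of_eq ?_)
      rw [← zpow_natCast, ← zpow_add₀ (by positivity)]
      congr 1
      push_cast
      ring
    rw [Padic.norm_int_le_pow_iff_dvd] at h3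
    have h4 : extz z j < p ^ b := by simp only [hextz, dif_pos hj]; exact (z ⟨j, hj⟩).2
    have h5 : extz z' j < p ^ b := by simp only [hextz, dif_pos hj]; exact (z' ⟨j, hj⟩).2
    have h6 : extz z j = extz z' j := by
      have := Int.eq_zero_of_abs_lt_dvd h3
        (by rw [abs_lt]; constructor <;> linarith [h4, h5])
      omega
    simpa only [hextz, dif_pos hj] using h6
  have := Nat.card_le_card_of_injective f hinj
  rw [localCount]
  refine le_trans (le_of_eq ?_) this
  rw [Nat.card_fun]
  simp

theorem exists_le_localDensity {p : ℕ} [Fact p.Prime] {x : J → ℚ_[p]}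
    (h0 : ∀ i, diagForm d c x i = 0) (hrank : (diagJac d c x).rank = Fintype.card I) :
    ∃ κ : ℝ, 0 < κ ∧ ∃ n₀ : ℕ, ∀ n ≥ n₀, κ ≤ localDensity d c (p ^ n) := by
  have hp : 1 < p := (Fact.out : p.Prime).one_lt
  have hp' : (1 : ℝ) < p := by exact_mod_cast hp
  obtain ⟨e, he, hli⟩ := exists_injective_columns _ hrank
  obtain ⟨f', hf', hsurj⟩ := exists_hasStrictFDerivAt_chart d c he hli
  have himg : chart d c e '' Metric.ball x 1 ∈ nhds (chart d c e x) := by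
    rw [← hf'.map_nhds_eq_of_surj hsurj]
    exact Filter.image_mem_map (Metric.ball_mem_nhds _ one_pos)
  obtain ⟨ε, hε, hball⟩ := Metric.nhds_basis_closedBall.mem_iff.1 himg
  obtain ⟨n, hn⟩ := exists_pow_lt_of_lt_one hε (inv_lt_one_of_one_lt₀ hp')
  obtain ⟨m, hm⟩ := pow_unbounded_of_one_lt (1 + ‖x‖) hp'
  have hz : ∀ z : J → ℕ, ∃ u : J → ℤ_[p], (∀ i, diagForm d c u i = 0) ∧
      ∀ j, (¬ ∃ i, e i = j) → (u j : ℚ_[p]) = p ^ m * (x j + p ^ n * z j) := fun z => by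
    obtain ⟨u, hux, hu⟩ := @hball
      (fun j => chart d c e x j + if ∃ i, e i = j then 0 else (p : ℚ_[p]) ^ n * z j) (by
        rw [Metric.mem_closedBall, dist_pi_le_iff hε.le]
        intro j
        rw [dist_eq_norm, add_sub_cancel_left]
        split_ifs
        · simpa using hε.le
        · rw [norm_mul, norm_pow, Padic.norm_p]
          exact (mul_le_of_le_one_right (by positivity) (by
            simpa using Padic.norm_int_le_one (p := p) (z j))).trans hn.le)
    have hnorm : ∀ j, ‖(p : ℚ_[p]) ^ m * u j‖ ≤ 1 := fun j => by
      have h1 : ‖u - x‖ < 1 := by simpa [dist_eq_norm] using hux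
      have h2 := norm_le_pi_norm u j
      have h3 := norm_le_norm_add_norm_sub' u x
      rw [norm_mul, norm_pow, Padic.norm_p, inv_pow, inv_mul_le_iff₀ (by positivity), mul_one]
      linarith
    refine ⟨fun j => ⟨p ^ m * u j, hnorm j⟩, fun i => ?_, fun j hj => ?_⟩
    · have h1 := map_diagForm d c PadicInt.Coe.ringHom (fun j => (⟨p ^ m * u j, hnorm j⟩ : ℤ_[p])) i
      have h2 : diagForm d c ((p : ℚ_[p]) ^ m • u) i = 0 := by
        have := congrFun hu (e i)
        rw [chart_apply d c he, chart_apply d c he, h0, if_pos ⟨i, rfl⟩, add_zero] at this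
        rw [diagForm_smul, this, mul_zero]
      exact PadicInt.ext (h1.trans h2)
    · have := congrFun hu j
      rw [chart_apply_of_notMem d c _ hj, chart_apply_of_notMem d c _ hj, if_neg hj] at this
      simp only [this]
  have hcard : Fintype.card {j // ¬ ∃ i, e i = j} + Fintype.card I = Fintype.card J := by
    have h1 : Fintype.card {j // ∃ i, e i = j} = Fintype.card I :=
      Fintype.card_congr (Equiv.ofInjective e he).symm
    have h2 := Fintype.card_subtype_le fun j => ∃ i, e i = j
    rw [Fintype.card_subtype_compl, h1]
    omega
  set k := Fintype.card {j // ¬ ∃ i, e i = j} with hk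
  have hpos : (0 : ℝ) < p := by linarith
  refine ⟨(((p : ℝ) ^ (n + m)) ^ k)⁻¹, by positivity, n + m, fun a ha => ?_⟩
  obtain ⟨b, rfl⟩ := Nat.exists_eq_add_of_le ha
  have h := pow_le_localCount hz b
  rw [show b + n + m = n + m + b by ring] at h
  have h' : ((p : ℝ) ^ b) ^ k ≤ localCount d c (p ^ (n + m + b)) := by exact_mod_cast h
  rw [localDensity, ← hcard]
  push_cast
  calc (((p : ℝ) ^ (n + m)) ^ k)⁻¹
      = ((p : ℝ) ^ (n + m + b)) ^ Fintype.card I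
          * (((p : ℝ) ^ (n + m + b)) ^ (k + Fintype.card I))⁻¹ * ((p : ℝ) ^ b) ^ k := by
        rw [pow_add _ k, pow_add _ (n + m) b, mul_pow _ _ k]
        field_simp
    _ ≤ _ := by gcongr

end PadicDensity

theorem Ncount_eq_solCount (t : ℕ) (ν μ : Fin t → ℕ) (k : (l : Fin t) → Fin (ν l) → ℕ) (s : ℕ)
    (c : EqIdx t ν μ → Fin s → ℤ) (P : ℕ) :
    Ncount t ν μ k s c P = solCount (deg t ν μ k) c P := by
  rw [Ncount, solCount, ← Nat.card_eq_finsetCard]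
  refine Nat.card_congr (Equiv.subtypeEquivRight fun x => ?_)
  simp only [mem_filter, Fintype.mem_piFinset, mem_Icc, IsSol, Int.cast_id]

/-- Theorem 1.1 (B) of Brandes–Parsell: if
`s ≥ 2 Σ_h (μ_h - μ_{h+1}) max{v_0(𝐤_h), (k/2)(1+ϖ_h)} + 1`, then for every highly
non-singular system with a non-singular positive real solution and non-singular
`p`-adic solutions for all `p` one has `N(P) = (C + o(1)) P^{s-K}` with `C > 0`. -/
theorem statement1
    (t : ℕ) (ν μ : Fin t → ℕ) (k : (l : Fin t) → Fin (ν l) → ℕ)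
    (hgrp : GroupedDegrees t ν μ k)
    (s : ℕ)
    (hs : 2 * (∑ h ∈ Finset.Icc 1 t,
        ((mu1 t μ h : ℝ) - (mu1 t μ (h + 1) : ℝ)) *
          max (v0 t ν k h : ℝ) ((kmax t ν k : ℝ) * (1 + (varpi t ν h : ℝ)) / 2))
      + 1 ≤ (s : ℝ))
    (c : EqIdx t ν μ → Fin s → ℤ)
    (hns : HighlyNonSingular t ν μ s c)
    (hreal : ∃ x : Fin s → ℝ, (∀ j, 0 < x j) ∧ IsSol t ν μ k s c x ∧ JacFullRank t ν μ k s c x)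
    (hpadic : ∀ (p : ℕ) [Fact p.Prime], ∃ x : Fin s → ℚ_[p],
      IsSol t ν μ k s c x ∧ JacFullRank t ν μ k s c x) :
    ∃ C : ℝ, 0 < C ∧ Filter.Tendsto
      (fun P : ℕ => (Ncount t ν μ k s c P : ℝ) / (P : ℝ) ^ ((s : ℝ) - (Ktot t ν μ k : ℝ)))
      Filter.atTop (nhds C) := by
  have hd : ∀ i, 0 < deg t ν μ k i := fun i => hgrp.2.2.2.2.1 _ _
  have hM := hns.minorArcBound hgrp (fun h => le_max_left _ _) hs
  obtain ⟨x, hx, hx0, hxr⟩ := hreal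
  obtain ⟨a, ha, hJ⟩ := exists_integral_singInt_eq_ofReal (hM.integrable_singInt hd) hx hx0 hxr
  obtain ⟨b, hb, hS⟩ := exists_tsum_singTerm_eq_ofReal _ c (hM.summable_singTerm hd)
    fun p hp => by
      have : Fact p.Prime := ⟨hp⟩
      obtain ⟨y, hy0, hyr⟩ := hpadic p
      exact exists_le_localDensity hy0 hyr
  refine ⟨b * a, mul_pos hb ha, ?_⟩
  have hlim := hM.tendsto_solCount hd
  rw [hJ, hS, ← Complex.ofReal_mul] at hlim
  have hre := (Complex.continuous_re.tendsto _).comp hlim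
  rw [Complex.ofReal_re] at hre
  refine hre.congr' ?_
  filter_upwards [eventually_gt_atTop 0] with P hP
  have hP' : (0 : ℝ) < P := by exact_mod_cast hP
  rw [Ncount_eq_solCount, Real.rpow_sub hP', Real.rpow_natCast, Real.rpow_natCast,
    Function.comp_apply, Fintype.card_fin, Ktot]
  have h : (P : ℂ) ^ (∑ i, deg t ν μ k i) * (((P : ℂ) ^ s)⁻¹ * (solCount (deg t ν μ k) c P : ℂ))
      = (((P : ℝ) ^ (∑ i, deg t ν μ k i) * (((P : ℝ) ^ s)⁻¹ *
        (solCount (deg t ν μ k) c P : ℝ)) : ℝ) : ℂ) := by push_cast; rfl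
  rw [h, Complex.ofReal_re]
  field_simp

end
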